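/- arXiv:2501.05950 — 3 statements merged into one kernel-verified Lean document; each statement's English description precedes it below -/
import Mathlib

section
/- Let B be a commutative reduced ring in which 2 is invertible and let m be an even positive integer. Let P be the polynomial ring over B in the 2m^2 variables t_{ij}, w_{ij} (1 ≤ i, j ≤ m), let T = (t_{ij}) and W = (w_{ij}) be the corresponding m×m matrices over P, and let I ⊆ P be the ideal generated by all entries of the matrices W + Wᵀ, T + Tᵀ, and T·W. Then the quotient ring B' = P/I is reduced. -/
/-!
STATEMENT 0: Let `B` be a commutative reduced ring in which `2` is invertible and let
`m` be an even positive integer.  Let `P` be the polynomial ring over `B` in the `2m²`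
variables `t_{ij}, w_{ij}` (`1 ≤ i, j ≤ m`), let `T = (t_{ij})` and `W = (w_{ij})` be the
corresponding `m × m` matrices over `P`, and let `I ⊆ P` be the ideal generated by all
entries of the matrices `W + Wᵀ`, `T + Tᵀ` and `T·W`.  Then `B' = P/I` is reduced.
-/

open Matrix MvPolynomial

noncomputable section

/-- Variable indices: `Sum.inl (i,j)` is `t_{ij}`, `Sum.inr (i,j)` is `w_{ij}`. -/
abbrev MatVars (m : ℕ) := (Fin m × Fin m) ⊕ (Fin m × Fin m)

/-- The generic skew-candidate matrix `T = (t_{ij})`. -/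
def Tmat (B : Type*) [CommRing B] (m : ℕ) :
    Matrix (Fin m) (Fin m) (MvPolynomial (MatVars m) B) :=
  Matrix.of fun i j => MvPolynomial.X (Sum.inl (i, j))

/-- The generic skew-candidate matrix `W = (w_{ij})`. -/
def Wmat (B : Type*) [CommRing B] (m : ℕ) :
    Matrix (Fin m) (Fin m) (MvPolynomial (MatVars m) B) :=
  Matrix.of fun i j => MvPolynomial.X (Sum.inr (i, j))

/-- The set of entries of a square matrix. -/
def matEntries {α : Type*} {m : ℕ} (M : Matrix (Fin m) (Fin m) α) : Set α :=
  Set.range fun p : Fin m × Fin m => M p.1 p.2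

/-- The ideal generated by all entries of `W + Wᵀ`, `T + Tᵀ` and `T·W`. -/
def relIdeal (B : Type*) [CommRing B] (m : ℕ) : Ideal (MvPolynomial (MatVars m) B) :=
  Ideal.span (matEntries (Wmat B m + (Wmat B m)ᵀ) ∪
    matEntries (Tmat B m + (Tmat B m)ᵀ) ∪
    matEntries (Tmat B m * Wmat B m))


section Pf
open CliffordAlgebra

variable {S : Type*} [CommRing S] {M : Type*} [AddCommGroup M] [Module S M]
  {M' : Type*} [AddCommGroup M'] [Module S M']

theorem pf_aux {Bf : LinearMap.BilinForm S M} (h : Bf.IsAlt) :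
    (-Bf).toQuadraticMap = (0 : QuadraticForm S M) - 0 := by
  ext v; simp [h v]

open Classical in
/-- Pfaffian functional -/
def pf (Bf : LinearMap.BilinForm S M) : ExteriorAlgebra S M →ₗ[S] S :=
  if h : Bf.IsAlt then
    (ExteriorAlgebra.algebraMapInv (R := S) (M := M)).toLinearMap ∘ₗ
      (changeForm (pf_aux h) : CliffordAlgebra (0 : QuadraticForm S M) →ₗ[S] CliffordAlgebra (0 : QuadraticForm S M))
  else 0

abbrev ctr (d : Module.Dual S M) : ExteriorAlgebra S M →ₗ[S] ExteriorAlgebra S M :=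
  contractLeft (Q := (0 : QuadraticForm S M)) d

abbrev iot (v : M) : ExteriorAlgebra S M := ExteriorAlgebra.ι S v

theorem ctr_mul (d : Module.Dual S M) (v : M) (x : ExteriorAlgebra S M) :
    ctr d (iot v * x) = d v • x - iot v * ctr d x :=
  contractLeft_ι_mul (Q := (0 : QuadraticForm S M)) d v x

theorem ctr_one (d : Module.Dual S M) : ctr d 1 = 0 := contractLeft_one (Q := (0 : QuadraticForm S M)) d

theorem pf_one {Bf : LinearMap.BilinForm S M} (h : Bf.IsAlt) : pf Bf 1 = 1 := by
  simp [pf, h, changeForm_one]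

theorem ainv_iot (v : M) (x : ExteriorAlgebra S M) :
    ExteriorAlgebra.algebraMapInv (iot (S := S) v * x) = 0 := by
  rw [map_mul]; simp [ExteriorAlgebra.algebraMapInv]

theorem pf_wick {Bf : LinearMap.BilinForm S M} (h : Bf.IsAlt) (v : M) (x : ExteriorAlgebra S M) :
    pf Bf (iot v * x) = pf Bf (ctr (Bf v) x) := by
  simp only [pf, h, dif_pos, LinearMap.comp_apply, AlgHom.toLinearMap_apply]
  have := changeForm_ι_mul (pf_aux h) v x
  erw [this, map_sub]
  erw [ainv_iot]
  rw [changeForm_contractLeft]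
  simp

theorem E_induction {C : ExteriorAlgebra S M → Prop} (h1 : ∀ r : S, C (algebraMap S _ r))
    (ha : ∀ x y, C x → C y → C (x + y)) (hm : ∀ x v, C x → C (iot v * x)) (x) : C x :=
  CliffordAlgebra.left_induction (Q := (0 : QuadraticForm S M)) h1 (fun x y => ha x y) (fun x v h => hm x v h) x

theorem pf_unique {Bf : LinearMap.BilinForm S M} (h : Bf.IsAlt) (F : ExteriorAlgebra S M →ₗ[S] S)
    (hF : ∀ v x, F (iot v * x) = F (ctr (Bf v) x)) (y) : F y = F 1 * pf Bf y := by
  let cf : ExteriorAlgebra S M →ₗ[S] ExteriorAlgebra S M := changeForm (pf_aux h)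
  have hb : (Bf).toQuadraticMap = (0 : QuadraticForm S M) - 0 := by
    ext v; simp [h v]
  let cg : ExteriorAlgebra S M →ₗ[S] ExteriorAlgebra S M := changeForm hb
  have hcg : ∀ x, cg (cf x) = x := by
    intro x
    have := changeForm_changeForm (pf_aux h) hb x
    change changeForm hb (changeForm (pf_aux h) x) = x
    rw [this]
    have h3 : ∀ (C : LinearMap.BilinForm S M)
        (hC : C.toQuadraticMap = (0 : QuadraticForm S M) - 0), C = 0 → changeForm hC x = x := by
      rintro C hC rfl
      exact LinearMap.congr_fun (changeForm_self (Q := (0 : QuadraticForm S M))) x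
    exact h3 _ _ (neg_add_cancel Bf)
  have key : ∀ z, F (cg z) = F 1 * ExteriorAlgebra.algebraMapInv z := by
    intro z
    induction z using E_induction with
    | h1 r => 
      rw [Algebra.algebraMap_eq_smul_one, map_smul, map_smul, map_smul]
      change r • F (changeForm hb 1) = _
      rw [changeForm_one]; simp [mul_comm]
    | ha x y hx hy => simp only [map_add, hx, hy, mul_add]
    | hm x v hx =>
      rw [ainv_iot, mul_zero]
      have := changeForm_ι_mul hb v x
      change F (changeForm hb _) = 0
      erw [this, map_sub, hF]
      simp
  have := key (cf y)
  rw [hcg] at this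
  rw [this]
  simp [pf, h, cf]

theorem ctr_map (f : M →ₗ[S] M') (d : Module.Dual S M') (x : ExteriorAlgebra S M) :
    ctr d (ExteriorAlgebra.map f x) = ExteriorAlgebra.map f (ctr (d ∘ₗ f) x) := by
  induction x using E_induction with
  | h1 r => 
    rw [Algebra.algebraMap_eq_smul_one, map_smul, map_smul, map_smul, map_smul, map_one,
      ctr_one, ctr_one]; simp
  | ha x y hx hy => simp only [map_add, hx, hy]
  | hm x v hx =>
    rw [map_mul (ExteriorAlgebra.map f), ctr_mul, map_sub, map_mul (ExteriorAlgebra.map f), map_smul, ExteriorAlgebra.map_apply_ι, ctr_mul, hx]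
    simp

theorem ctr_mul_of_zero (d : Module.Dual S M) (x y : ExteriorAlgebra S M) (hy : ctr d y = 0) :
    ctr d (x * y) = ctr d x * y := by
  induction x using E_induction with
  | h1 r => 
    rw [Algebra.algebraMap_eq_smul_one, smul_mul_assoc, map_smul, map_smul, one_mul, hy, ctr_one]; simp
  | ha x z hx hz => simp only [map_add, hx, hz, add_mul]
  | hm x v hx =>
    rw [mul_assoc, ctr_mul, ctr_mul, hx, sub_mul, mul_assoc]; simp

theorem alt_comp {Bf : LinearMap.BilinForm S M'} (h : Bf.IsAlt) (f : M →ₗ[S] M') :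
    (Bf.compl₁₂ f f).IsAlt := fun v => by simp [h (f v)]

theorem pf_map {Bf : LinearMap.BilinForm S M'} (h : Bf.IsAlt) (f : M →ₗ[S] M') (y) :
    pf Bf (ExteriorAlgebra.map f y) = pf (Bf.compl₁₂ f f) y := by
  have := pf_unique (alt_comp h f) (pf Bf ∘ₗ (ExteriorAlgebra.map f).toLinearMap) (by
    intro v x
    simp only [LinearMap.comp_apply, AlgHom.toLinearMap_apply]
    rw [map_mul, ExteriorAlgebra.map_apply_ι, pf_wick h, ctr_map]
    rfl) y
  simpa [pf_one h] using this

/-- product over a sum of modules -/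
theorem pf_map_mul_map {M'' : Type*} [AddCommGroup M''] [Module S M'']
    {Bf : LinearMap.BilinForm S M'} (h : Bf.IsAlt) (f : M →ₗ[S] M') (g : M'' →ₗ[S] M')
    (hfg : ∀ v w, Bf (f v) (g w) = 0) (y z) :
    pf Bf (ExteriorAlgebra.map f y * ExteriorAlgebra.map g z) =
      pf (Bf.compl₁₂ f f) y * pf (Bf.compl₁₂ g g) z := by
  have := pf_unique (alt_comp h f) (pf Bf ∘ₗ
     (LinearMap.mulRight S (ExteriorAlgebra.map g z)) ∘ₗ (ExteriorAlgebra.map f).toLinearMap) (by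
    intro v x
    simp only [LinearMap.comp_apply, AlgHom.toLinearMap_apply, LinearMap.mulRight_apply]
    rw [map_mul (ExteriorAlgebra.map f), ExteriorAlgebra.map_apply_ι, mul_assoc, pf_wick h, ctr_mul_of_zero, ctr_map]
    · rfl
    · rw [ctr_map]
      have : (Bf (f v)) ∘ₗ g = 0 := by ext w; simp [hfg]
      rw [this]; simp) y
  simp only [LinearMap.comp_apply, AlgHom.toLinearMap_apply, LinearMap.mulRight_apply] at this
  rw [this, map_one, one_mul, pf_map h, mul_comm]

/-- the product of a list of vectors -/
def wd (l : List M) : ExteriorAlgebra S M := (l.map iot).prod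

@[simp] theorem wd_nil : wd (S := S) ([] : List M) = 1 := rfl
@[simp] theorem wd_cons (v : M) (l : List M) : wd (S := S) (v :: l) = iot v * wd l := by simp [wd]
@[simp] theorem wd_append (l l' : List M) : wd (S := S) (l ++ l') = wd l * wd l' := by simp [wd]

theorem map_wd (f : M →ₗ[S] M') (l : List M) :
    ExteriorAlgebra.map f (wd l) = wd (l.map f) := by
  induction l with
  | nil => simp
  | cons v l ih => simp [ih]

theorem ctr_wd (d : Module.Dual S M) (l : List M) :
    ctr d (wd l) = ∑ k : Fin l.length, ((-1 : S) ^ (k : ℕ) * d (l.get k)) • wd (l.eraseIdx k) := by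
  induction l with
  | nil => simp
  | cons v l ih =>
    rw [wd_cons, ctr_mul, ih]
    refine Eq.trans ?_ (Fin.sum_univ_succ (n := l.length) _).symm
    simp only [Fin.val_zero, pow_zero, one_mul, List.get_cons_zero, List.eraseIdx_cons_zero,
      Fin.val_succ, List.eraseIdx_cons_succ, wd_cons]
    rw [sub_eq_add_neg, Finset.mul_sum, ← Finset.sum_neg_distrib]
    congr 1
    refine Finset.sum_congr rfl fun k _ => ?_
    rw [mul_smul_comm, ← neg_smul]; congr 1
    change _ = (-1) ^ (k.1 + 1) * d (l.get k)
    ring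

theorem pf_cons {Bf : LinearMap.BilinForm S M} (h : Bf.IsAlt) (v : M) (l : List M) :
    pf Bf (wd (v :: l)) =
     ∑ k : Fin l.length, ((-1 : S) ^ (k : ℕ) * Bf v (l.get k)) * pf Bf (wd (l.eraseIdx k)) := by
  rw [wd_cons, pf_wick h, ctr_wd, map_sum]; simp

theorem pf_smul {Bf : LinearMap.BilinForm S M} (h : Bf.IsAlt) (c : S) (n : ℕ) : ∀ (l : List M),
    l.length = n → pf (c • Bf) (wd l) = c ^ (n / 2) * pf Bf (wd l) := by
  have h' : (c • Bf).IsAlt := fun v => by simp [h v]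
  induction n using Nat.strong_induction_on with
  | _ n ih =>
    intro l hl
    match l, hl with
    | [], hl => simp at hl; subst hl; simp [pf_one h, pf_one h']
    | v :: l, hl =>
      rw [pf_cons h', pf_cons h, Finset.mul_sum]
      refine Finset.sum_congr rfl fun k _ => ?_
      have hk := k.2
      have h2 : (l.eraseIdx k).length = l.length - 1 := by
        rw [List.length_eraseIdx]; simp
      simp only [List.length_cons] at hl
      rw [ih (l.length - 1) (by omega) _ h2]
      have : n / 2 = (l.length - 1) / 2 + 1 := by omega
      rw [this, pow_succ]; simp; ring

/-- swapping -/
theorem iot_swap (v w : M) : iot (S := S) v * iot w = - (iot w * iot v) := by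
  rw [eq_neg_iff_add_eq_zero]
  exact ExteriorAlgebra.ι_add_mul_swap v w

theorem iot_sq (v : M) : iot (S := S) v * iot v = 0 := ExteriorAlgebra.ι_sq_zero v

theorem wd_perm {l l' : List M} (h : l.Perm l') : wd (S := S) l = wd l' ∨ wd (S := S) l = - wd l' := by
  induction h with
  | nil => simp
  | cons x h ih => rcases ih with ih | ih <;> simp [ih]
  | swap x y l => right; simp [← mul_assoc, iot_swap y x]
  | trans h1 h2 i1 i2 => 
    rcases i1 with i1 | i1 <;> rcases i2 with i2 | i2 <;> simp [i1, i2]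

theorem wd_dup {l : List M} (h : ¬ l.Nodup) : wd (S := S) l = 0 := by
  classical
  induction l with
  | nil => simp at h
  | cons x l ih =>
    by_cases hx : x ∈ l
    · have h1 : wd (S := S) (x :: x :: l.erase x) = 0 := by
        rw [wd_cons, wd_cons, ← mul_assoc, iot_sq, zero_mul]
      rcases wd_perm (S := S) ((List.perm_cons_erase hx).cons x) with h | h <;> simp [h, h1]
    · rw [wd_cons, ih, mul_zero]
      intro h2; exact h (List.nodup_cons.2 ⟨hx, h2⟩)

end Pf


set_option linter.unusedSectionVars false
section Pfw
variable {S : Type*} [CommRing S] {n : Type*} [Fintype n] [DecidableEq n]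

/-- alternating matrices -/
def AltM (A : Matrix n n S) : Prop := (∀ i, A i i = 0) ∧ ∀ i j, A i j = - A j i

def bf (A : Matrix n n S) : LinearMap.BilinForm S (n → S) := Matrix.toBilin' A

theorem bf_apply (A : Matrix n n S) (v w : n → S) : bf A v w = v ⬝ᵥ A *ᵥ w := by
  simp [bf, Matrix.toBilin'_apply']

theorem bf_single (A : Matrix n n S) (v : n → S) (i : n) : bf A v (Pi.single i 1) = (v ᵥ* A) i := by
  rw [bf_apply, dotProduct_mulVec]; simp

theorem bf_ss (A : Matrix n n S) (i j : n) : bf A (Pi.single i 1) (Pi.single j 1) = A i j := by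
  rw [bf_single]; simp

theorem bf_alt {A : Matrix n n S} (h : AltM A) : (bf A).IsAlt := by
  intro v
  rw [bf_apply]
  simp only [dotProduct, mulVec, Finset.mul_sum]
  rw [← Finset.sum_product']
  refine Finset.sum_involution (fun a _ => (a.2, a.1)) ?_ ?_ ?_ ?_
  · rintro ⟨i, j⟩ _; simp only; rw [h.2 i j]; ring
  · rintro ⟨i, j⟩ _ h1 h2
    simp only [Prod.mk.injEq] at h2
    apply h1; simp only; rw [h2.1, h.1]; ring
  · simp
  · simp

theorem AltM.map {A : Matrix n n S} (h : AltM A) {S' : Type*} [CommRing S'] (f : S →+* S') :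
    AltM (A.map f) := ⟨fun i => by simp [h.1 i], fun i j => by simp [h.2 i j]⟩

abbrev ev (i : n) : n → S := Pi.single i 1

def pfw (A : Matrix n n S) (l : List n) : S := pf (bf A) (wd (l.map ev))

theorem pfw_nil {A : Matrix n n S} (h : AltM A) : pfw A [] = 1 := by
  simp [pfw, pf_one (bf_alt h)]

theorem pfw_cons {A : Matrix n n S} (h : AltM A) (i : n) (l : List n) :
    pfw A (i :: l) = ∑ k : Fin l.length, ((-1 : S) ^ (k : ℕ) * A i (l.get k)) * pfw A (l.eraseIdx k) := by
  rw [pfw, List.map_cons, pf_cons (bf_alt h)]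
  refine Fintype.sum_equiv (finCongr (by simp)) _ _ fun k => ?_
  simp [pfw, List.eraseIdx_map, bf_ss]

theorem pfw_map {A : Matrix n n S} (h : AltM A) {S' : Type*} [CommRing S'] (f : S →+* S') (k : ℕ) :
    ∀ l : List n, l.length = k → pfw (A.map f) l = f (pfw A l) := by
  induction k using Nat.strong_induction_on with
  | _ k ih =>
    intro l hl
    match l, hl with
    | [], _ => simp [pfw_nil h, pfw_nil (h.map f)]
    | i :: l, hl =>
      rw [pfw_cons h, pfw_cons (h.map f), map_sum]
      refine Finset.sum_congr rfl fun j _ => ?_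
      have hj := j.2
      rw [ih (l.length - 1) (by simp at hl; omega) _ (by rw [List.length_eraseIdx]; simp)]
      simp

theorem pfw_odd {A : Matrix n n S} (h : AltM A) (k : ℕ) :
    ∀ l : List n, l.length = k → Odd k → pfw A l = 0 := by
  induction k using Nat.strong_induction_on with
  | _ k ih =>
    intro l hl hk
    match l, hl with
    | [], hl => simp at hl; subst hl; simp at hk
    | i :: l, hl =>
      rw [pfw_cons h]
      refine Finset.sum_eq_zero fun j _ => ?_
      have hj := j.2
      simp at hl
      rw [ih (l.length - 1) (by omega) _ (by rw [List.length_eraseIdx]; simp), mul_zero]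
      rw [Nat.odd_iff] at hk ⊢; omega

theorem pfw_perm (A : Matrix n n S) {l l' : List n} (h : l.Perm l') :
    pfw A l = pfw A l' ∨ pfw A l = - pfw A l' := by
  rcases wd_perm (S := S) (h.map (ev (S := S))) with h | h <;> simp [pfw, h]

theorem pfw_dup (A : Matrix n n S) {l : List n} (h : ¬ l.Nodup) :
    pfw A l = 0 := by
  rcases subsingleton_or_nontrivial S with hs | hs
  · exact Subsingleton.elim _ _
  rw [pfw, wd_dup, map_zero]
  intro h1
  exact h (List.Nodup.of_map _ h1)

/-- block matrices -/
abbrev blk (T W : Matrix n n S) : Matrix (n ⊕ n) (n ⊕ n) S := Matrix.fromBlocks T 0 0 W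

theorem blk_alt {T W : Matrix n n S} (hT : AltM T) (hW : AltM W) : AltM (blk T W) := by
  refine ⟨?_, ?_⟩
  · rintro (i | i) <;> simp [hT.1, hW.1]
  · rintro (i | i) (j | j) <;> simp [← hT.2 i j, ← hW.2 i j]

def lfs (w : List (n ⊕ n)) : List n := w.filterMap Sum.getLeft?
def rts (w : List (n ⊕ n)) : List n := w.filterMap Sum.getRight?

theorem perm_lr (w : List (n ⊕ n)) : w.Perm ((lfs w).map Sum.inl ++ (rts w).map Sum.inr) := by
  induction w with
  | nil => simp [lfs, rts]
  | cons a w ih =>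
    rcases a with i | i
    · simp only [lfs, rts, List.filterMap_cons, Sum.getLeft?_inl, Sum.getRight?_inl, List.map_cons, List.cons_append] at ih ⊢
      exact ih.cons _
    · simp only [lfs, rts, List.filterMap_cons, Sum.getLeft?_inr, Sum.getRight?_inr, List.map_cons] at ih ⊢
      exact (ih.cons _).trans List.perm_middle.symm

theorem pfw_lr {T W : Matrix n n S} (hT : AltM T) (hW : AltM W) (l l' : List n) :
    pfw (blk T W) (l.map Sum.inl ++ l'.map Sum.inr) = pfw T l * pfw W l' := by
  let f : (n → S) →ₗ[S] (n ⊕ n → S) := 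
    { toFun := fun v => Sum.elim v 0
      map_add' := by intro v w; ext (i | i) <;> simp
      map_smul' := by intro v w; ext (i | i) <;> simp }
  let g : (n → S) →ₗ[S] (n ⊕ n → S) := 
    { toFun := fun v => Sum.elim 0 v
      map_add' := by intro v w; ext (i | i) <;> simp
      map_smul' := by intro v w; ext (i | i) <;> simp }
  have h := pf_map_mul_map (bf_alt (blk_alt hT hW)) f g (by
    intro v w
    rw [bf_apply]
    simp [f, g, fromBlocks_mulVec, dotProduct]) (wd (l.map ev)) (wd (l'.map ev))
  have h1 : (bf (blk T W)).compl₁₂ f f = bf T := by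
    refine LinearMap.ext fun v => LinearMap.ext fun w => ?_
    rw [LinearMap.compl₁₂_apply, bf_apply, bf_apply]
    simp [f, fromBlocks_mulVec, dotProduct]
  have h2 : (bf (blk T W)).compl₁₂ g g = bf W := by
    refine LinearMap.ext fun v => LinearMap.ext fun w => ?_
    rw [LinearMap.compl₁₂_apply, bf_apply, bf_apply]
    simp [g, fromBlocks_mulVec, dotProduct]
  have h3 : ∀ i : n, f (ev i) = ev (Sum.inl i) := by
    intro i; ext (j | j) <;> simp [f, Pi.single_apply]
  have h4 : ∀ i : n, g (ev i) = ev (Sum.inr i) := by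
    intro i; ext (j | j) <;> simp [g, Pi.single_apply]
  rw [h1, h2, map_wd, map_wd, ← wd_append] at h
  rw [pfw, pfw, pfw, ← h, List.map_append]
  simp only [List.map_map]
  congr 4
  · exact funext fun i => (h3 i).symm
  · exact funext fun i => (h4 i).symm

theorem pfw_blk {T W : Matrix n n S} (hT : AltM T) (hW : AltM W) (w : List (n ⊕ n)) :
    pfw (blk T W) w = pfw T (lfs w) * pfw W (rts w) ∨
    pfw (blk T W) w = - (pfw T (lfs w) * pfw W (rts w)) := by
  rw [← pfw_lr hT hW]
  exact pfw_perm _ (perm_lr w)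

end Pfw

section tau
variable {S : Type*} [CommRing S] {m : ℕ}

def tau (A : Matrix (Fin m) (Fin m) S) (I : Finset (Fin m)) : S := pfw A (I.sort (· ≤ ·))

theorem tau_of_list (A : Matrix (Fin m) (Fin m) S) {l : List (Fin m)} (h : l.Nodup) {I}
   (hI : l.toFinset = I) : pfw A l = tau A I ∨ pfw A l = - tau A I := by
  subst hI
  apply pfw_perm
  refine (List.perm_ext_iff_of_nodup h (Finset.sort_nodup _ _)).2 ?_
  simp

theorem tau_empty {A : Matrix (Fin m) (Fin m) S} (h : AltM A) : tau A ∅ = 1 := by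
  simp [tau, pfw_nil h]

theorem tau_odd {A : Matrix (Fin m) (Fin m) S} (h : AltM A) {I : Finset (Fin m)} (hI : Odd I.card) :
   tau A I = 0 := pfw_odd h _ _ rfl (by simpa using hI)

theorem tau_map {A : Matrix (Fin m) (Fin m) S} (h : AltM A) {S' : Type*} [CommRing S'] (f : S →+* S') (I) :
    tau (A.map f) I = f (tau A I) := pfw_map h f _ _ rfl

theorem word_mem {T W : Matrix (Fin m) (Fin m) S} (hT : AltM T) (hW : AltM W)
    (N : AddSubgroup S) (w : List (Fin m ⊕ Fin m))
    (h : (lfs w).Nodup → (rts w).Nodup → tau T (lfs w).toFinset * tau W (rts w).toFinset ∈ N) :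
    pfw (blk T W) w ∈ N := by
  have : pfw T (lfs w) * pfw W (rts w) ∈ N := by
    by_cases h1 : (lfs w).Nodup
    · by_cases h2 : (rts w).Nodup
      · have := h h1 h2
        have := N.neg_mem this
        rcases tau_of_list T h1 rfl with h3 | h3 <;> rcases tau_of_list W h2 rfl with h4 | h4 <;>
          rw [h3, h4] <;> simpa
      · rw [pfw_dup W h2, mul_zero]; exact N.zero_mem
    · rw [pfw_dup T h1, zero_mul]; exact N.zero_mem
  rcases pfw_blk hT hW w with h3 | h3 <;> rw [h3]
  · exact this
  · exact N.neg_mem this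

end tau

theorem list_prod_add {E : Type*} [Ring E] {α : Type*} [DecidableEq α] (u v : α → E) (l : List α)
    (hl : l.Nodup) : (l.map fun x => u x + v x).prod =
      ∑ s ∈ l.toFinset.powerset, (l.map fun x => if x ∈ s then u x else v x).prod := by
  induction l with
  | nil => simp
  | cons a l ih =>
    rw [List.nodup_cons] at hl
    have ha : a ∉ l.toFinset := by simpa using hl.1
    rw [List.toFinset_cons, Finset.sum_powerset_insert ha, List.map_cons, List.prod_cons, ih hl.2,
      add_mul, Finset.mul_sum, Finset.mul_sum, add_comm]
    congr 1
    · refine Finset.sum_congr rfl fun s hs => ?_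
      have : a ∉ s := fun h => ha (Finset.mem_powerset.1 hs h)
      simp [this]
    · refine Finset.sum_congr rfl fun s hs => ?_
      simp only [List.map_cons, List.prod_cons, Finset.mem_insert_self, if_true]
      congr 2
      refine List.map_congr_left fun x hx => ?_
      have : x ≠ a := by rintro rfl; exact hl.1 hx
      simp [this]

set_option linter.unusedSectionVars false
section mixed
variable {S : Type*} [CommRing S] {n : Type*} [Fintype n] [DecidableEq n]

def th (i : n) : ExteriorAlgebra S (n ⊕ n → S) := iot (ev (Sum.inl i)) * iot (ev (Sum.inr i))

theorem th_comm (i : n) (v : n ⊕ n → S) : th (S := S) i * iot v = iot v * th i := by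
  rw [th, mul_assoc, iot_swap _ v, mul_neg, ← mul_assoc, iot_swap _ v]
  simp [mul_assoc]

theorem th_l (i : n) : iot (S := S) (ev (Sum.inl i)) * th i = 0 := by
  rw [th, ← mul_assoc, iot_sq, zero_mul]

theorem th_r (i : n) : iot (S := S) (ev (Sum.inr i)) * th i = 0 := by
  rw [← th_comm, th, mul_assoc, iot_sq, mul_zero]

theorem th_sq (i : n) : th (S := S) i * th i = 0 := by
  nth_rewrite 1 [th]
  rw [mul_assoc, th_r, mul_zero]

theorem th_th (i j : n) : th (S := S) i * th j = th j * th i := by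
  nth_rewrite 2 [th]
  rw [← mul_assoc, th_comm, mul_assoc, th_comm, ← mul_assoc]; rfl

def kap (a : S) (l : List n) : ExteriorAlgebra S (n ⊕ n → S) := (l.map fun i => 1 + a • th i).prod

theorem kap_cons (a : S) (i : n) (l : List n) : kap a (i :: l) = (1 + a • th i) * kap a l := by
  simp [kap]

theorem kap_append (a : S) (l l' : List n) : kap a (l ++ l') = kap a l * kap a l' := by
  simp [kap]

theorem kap_comm (a : S) (l : List n) (v : n ⊕ n → S) : kap a l * iot v = iot v * kap a l := by
  induction l with
  | nil => simp [kap]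
  | cons i l ih =>
    rw [kap_cons, mul_assoc, ih, ← mul_assoc, ← mul_assoc, add_mul, mul_add, smul_mul_assoc, th_comm]
    simp

theorem kap_inv (a : S) (l : List n) : kap a l * kap (-a) l.reverse = 1 := by
  induction l with
  | nil => simp [kap]
  | cons i l ih =>
    rw [List.reverse_cons, kap_append, kap_cons, mul_assoc, ← mul_assoc (kap a l), ih]
    simp only [one_mul, kap, List.map_cons, List.map_nil, List.prod_cons, List.prod_nil, mul_one, neg_smul]
    rw [add_mul, mul_add, mul_add]
    simp [th_sq]

theorem kap_rev (a : S) (l : List n) : kap a l.reverse = kap a l := by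
  rw [kap, kap]
  refine List.Perm.prod_eq' ((List.reverse_perm l).map _) ?_
  refine List.Pairwise.map _ (R := fun _ _ => True) ?_ ?_
  · intro i j _
    simp only [Commute, SemiconjBy, add_mul, mul_add, smul_mul_assoc, mul_smul_comm, one_mul, mul_one, th_th i j]
    simp only [smul_add]; abel
  · exact List.pairwise_of_forall (by simp)

def gd (d : Module.Dual S (n ⊕ n → S)) (i : n) : n ⊕ n → S :=
  d (ev (Sum.inl i)) • ev (Sum.inr i) - d (ev (Sum.inr i)) • ev (Sum.inl i)

theorem ctr_th (d : Module.Dual S (n ⊕ n → S)) (i : n) (x) :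
    ctr d (th i * x) = iot (gd d i) * x + th i * ctr d x := by
  rw [th, mul_assoc, ctr_mul, ctr_mul]
  simp only [gd, iot, map_sub, map_smul, sub_mul, mul_sub, mul_smul_comm, smul_mul_assoc, mul_assoc]
  abel

theorem gd_th (d : Module.Dual S (n ⊕ n → S)) (i : n) : iot (gd d i) * th i = 0 := by
  simp only [gd, iot, map_sub, map_smul, sub_mul, smul_mul_assoc]
  have h1 := th_l (S := S) i
  have h2 := th_r (S := S) i
  simp only [iot] at h1 h2
  simp [h1, h2]

theorem ctr_kap (a : S) (d : Module.Dual S (n ⊕ n → S)) (l : List n) (x) :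
    ctr d (kap a l * x) = a • (iot ((l.map (gd d)).sum) * (kap a l * x)) + kap a l * ctr d x := by
  induction l with
  | nil => simp [kap]
  | cons i l ih =>
    rw [kap_cons, mul_assoc, mul_assoc]
    obtain ⟨z, hz⟩ : ∃ z, z = kap a l * x := ⟨_, rfl⟩
    rw [← hz] at ih ⊢
    have h1 : ctr d ((1 + a • th i) * z) =
        (1 + a • th i) * ctr d z + a • (iot (gd d i) * z) := by
      rw [add_mul, one_mul, map_add, smul_mul_assoc, map_smul, ctr_th, add_mul]
      simp; abel
    rw [h1, ih]
    simp only [List.map_cons, List.sum_cons]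
    set g := (l.map (gd d)).sum
    have h2 : iot (gd d i) * ((1 + a • th i) * z) = iot (gd d i) * z := by
      rw [← mul_assoc, mul_add, mul_smul_comm, gd_th]; simp
    have h3 : iot g * ((1 + a • th i) * z) = (1 + a • th i) * (iot g * z) := by
      rw [← mul_assoc, ← mul_assoc, mul_add, add_mul _ _ (iot g), mul_smul_comm, smul_mul_assoc, th_comm]
      simp
    have h4 : iot (S := S) (gd d i + g) = iot (gd d i) + iot g := map_add _ _ _
    rw [h4, add_mul (iot (gd d i)), h2, h3, mul_add (1 + a • th i)]
    simp only [smul_add, mul_smul_comm]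
    abel

theorem pf_kap {T W : Matrix n n S} (hT : AltM T) (hW : AltM W) (hTW : T * W = 0) (a : S)
    (l : List n) (hl : l.Nodup) (hl' : ∀ i, i ∈ l) (y) :
    pf (bf (blk T W)) (kap a l * y) = pf (bf (blk T W)) (kap a l) * pf (bf (blk T W)) y := by
  have hWT : W * T = 0 := by
    have h1 : Tᵀ = - T := by ext i j; simp [hT.2 j i]
    have h2 : Wᵀ = - W := by ext i j; simp [hW.2 j i]
    have := congrArg Matrix.transpose hTW
    simpa [h1, h2] using this
  have hb := bf_alt (blk_alt hT hW)
  have := pf_unique hb (pf (bf (blk T W)) ∘ₗ LinearMap.mulLeft S (kap a l)) (by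
    intro v x
    simp only [LinearMap.comp_apply, LinearMap.mulLeft_apply]
    rw [← mul_assoc, kap_comm, mul_assoc, pf_wick hb, ctr_kap, map_add, map_smul, pf_wick hb]
    have : bf (blk T W) ((l.map (gd (bf (blk T W) v))).sum) = 0 := by
      have h1 : (l.map (gd (bf (blk T W) v))).sum = ∑ i, gd (bf (blk T W) v) i := by
        rw [← List.sum_toFinset _ hl]
        congr 1; ext i; simp [hl']
      rw [h1]
      have h2 : ∑ i, gd (bf (blk T W) v) i =
          Sum.elim (- ((v ∘ Sum.inr) ᵥ* W)) ((v ∘ Sum.inl) ᵥ* T) := by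
        funext j
        rw [Finset.sum_apply]
        simp only [gd, bf_single]
        rcases j with j | j <;>
        simp [Pi.single_apply, vecMul_fromBlocks]
      rw [h2]
      refine LinearMap.ext fun w => ?_
      rw [bf_apply, dotProduct_mulVec, vecMul_fromBlocks]
      simp [hTW, hWT, neg_vecMul]
    rw [this]; simp) y
  simpa using this


theorem blk_map {S' : Type*} [CommRing S'] (f : S →+* S') (T W : Matrix n n S) :
    blk (T.map f) (W.map f) = (blk T W).map f := by
  ext (i | i) (j | j) <;> simp

def thw (l : List n) : List (n ⊕ n) := l.flatMap fun i => [Sum.inl i, Sum.inr i]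

theorem wd_thw (l : List n) : wd (S := S) ((thw l).map ev) = (l.map th).prod := by
  induction l with
  | nil => simp [thw]
  | cons i l ih =>
    simp only [thw] at ih
    simp [thw, ih, th, mul_assoc]

theorem ite_prod {E : Type*} [Ring E] [Algebra S E] (g : n → E) (a : S) (s : Finset n) (l : List n) :
    (l.map fun i => if i ∈ s then a • g i else 1).prod =
      a ^ (l.filter (· ∈ s)).length • ((l.filter (· ∈ s)).map g).prod := by
  induction l with
  | nil => simp
  | cons i l ih =>
    by_cases h : i ∈ s
    · simp [h, ih, pow_succ, smul_smul]
    · simp [h, ih]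

theorem filter_toFinset {l : List n} {s : Finset n} (hs : s ⊆ l.toFinset) :
    (l.filter (· ∈ s)).toFinset = s := by
  ext i; simp only [List.mem_toFinset, List.mem_filter, decide_eq_true_eq]
  exact ⟨fun h => h.2, fun h => ⟨by simpa using hs h, h⟩⟩

theorem filter_len {l : List n} (hl : l.Nodup) {s : Finset n} (hs : s ⊆ l.toFinset) :
    (l.filter (· ∈ s)).length = s.card := by
  rw [← List.toFinset_card_of_nodup (hl.filter _), filter_toFinset hs]

theorem kap_expand {T W : Matrix n n S} (hT : AltM T) (hW : AltM W)
    {S' : Type*} [CommRing S'] (f : S →+* S') (a : S') (l : List n) (hl : l.Nodup)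
    (y : List (n ⊕ n)) :
    pf (bf (blk (T.map f) (W.map f))) (kap a l * wd (y.map ev)) =
      ∑ s ∈ l.toFinset.powerset, a ^ s.card * f (pfw (blk T W) (thw (l.filter (· ∈ s)) ++ y)) := by
  have h1 : kap a l = (l.map fun i => a • th i + 1).prod := by
    simp only [kap, add_comm]
  rw [h1, list_prod_add _ _ _ hl, Finset.sum_mul, map_sum]
  refine Finset.sum_congr rfl fun s hs => ?_
  rw [Finset.mem_powerset] at hs
  rw [ite_prod, filter_len hl hs, smul_mul_assoc, map_smul, ← wd_thw, ← wd_append, ← List.map_append,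
   smul_eq_mul]
  congr 1
  rw [← pfw_map (blk_alt hT hW) f _ _ rfl, pfw, blk_map]

open scoped Polynomial in
theorem kap_one {T W : Matrix n n S} (hT : AltM T) (hW : AltM W) (hTW : T * W = 0)
    (h2 : IsUnit (2 : S)) (l : List n) (hl : l.Nodup) (hl' : ∀ i, i ∈ l) :
    pf (bf (blk (T.map Polynomial.C) (W.map Polynomial.C))) (kap (Polynomial.X : S[X]) l) = 1 := by
  set T' := T.map (Polynomial.C : S →+* S[X]) with hT'
  set W' := W.map (Polynomial.C : S →+* S[X]) with hW'
  have aT : AltM T' := hT.map _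
  have aW : AltM W' := hW.map _
  have hTW' : T' * W' = 0 := by
    rw [hT', hW', ← Matrix.map_mul, hTW]; simp
  set c := pf (bf (blk T' W')) (kap (Polynomial.X : S[X]) l) with hc
  -- sign symmetry
  let f : (n ⊕ n → S[X]) →ₗ[S[X]] (n ⊕ n → S[X]) :=
    { toFun := fun v => Sum.elim (- (v ∘ Sum.inl)) (v ∘ Sum.inr)
      map_add' := by intro v w; ext1 (i | i) <;> simp; ring
      map_smul' := by intro v w; ext1 (i | i) <;> simp }
  have hff : (bf (blk T' W')).compl₁₂ f f = bf (blk T' W') := by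
    refine LinearMap.ext fun v => LinearMap.ext fun w => ?_
    rw [LinearMap.compl₁₂_apply, bf_apply, bf_apply]
    simp [f, fromBlocks_mulVec, dotProduct, mulVec_neg]
  have hfe : ∀ i, f (ev (Sum.inl i)) = - ev (Sum.inl i) := by
    intro i; ext1 (j | j) <;> simp [f, Pi.single_apply]
  have hff' : ∀ i, f (ev (Sum.inr i)) = ev (Sum.inr i) := by
    intro i; ext1 (j | j) <;> simp [f, Pi.single_apply]
  have hfk : ExteriorAlgebra.map f (kap Polynomial.X l) = kap (-Polynomial.X) l := by
    rw [kap, kap, map_list_prod, List.map_map]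
    congr 1
    refine List.map_congr_left fun i _ => ?_
    simp only [Function.comp_apply, map_add, map_one, map_smul, th, map_mul,
      ExteriorAlgebra.map_apply_ι, hfe, hff', iot, map_neg, neg_mul, smul_neg, neg_smul]
  have hsym : pf (bf (blk T' W')) (kap (-Polynomial.X : S[X]) l) = c := by
    rw [← hfk, pf_map (bf_alt (blk_alt aT aW)), hff]
  have hcc : c * c = 1 := by
    have := pf_kap aT aW hTW' (Polynomial.X : S[X]) l hl hl' (kap (-Polynomial.X) l)
    rw [hsym, ← kap_rev (-Polynomial.X : S[X]), kap_inv, pf_one (bf_alt (blk_alt aT aW))] at this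
    exact this.symm
  have h0 : c.coeff 0 = 1 := by
    have := kap_expand hT hW Polynomial.C (Polynomial.X : S[X]) l hl []
    rw [List.map_nil, wd_nil, mul_one] at this
    rw [hc, this, Polynomial.finsetSum_coeff]
    rw [Finset.sum_eq_single ∅]
    · simp [thw, pfw_nil (blk_alt hT hW)]
    · intro s _ hs
      have : s.card ≠ 0 := by simpa using hs
      simp [Polynomial.coeff_X_pow, this.symm]
    · simp
  obtain ⟨u, hu⟩ := h2.exists_right_inv
  -- e = (1-c)/2
  set e := Polynomial.C u * (1 - c) with he
  have hu' : (2 : S[X]) * Polynomial.C u = 1 := by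
    rw [← Polynomial.C_1, ← hu, Polynomial.C_mul]; rfl
  have hee : e * e = e := by
    have : e * e = Polynomial.C u * (Polynomial.C u * 2) * (1 - c) + Polynomial.C u * Polynomial.C u * (c * c - 1) := by rw [he]; ring
    rw [this, hcc, mul_comm (Polynomial.C u) 2, hu', he]; ring
  have hX : Polynomial.X ∣ e := by
    rw [Polynomial.X_dvd_iff, he]; simp [h0]
  have hz : e = 0 := by
    have h3 : ∀ k : ℕ, e ^ (k + 1) = e := by
      intro k; induction k with
      | zero => simp
      | succ k ih => rw [pow_succ, ih, hee]
    ext k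
    have h4 : Polynomial.X ^ (k + 1) ∣ e := by
      rw [← h3 k]; exact pow_dvd_pow_of_dvd hX _
    rw [Polynomial.X_pow_dvd_iff] at h4
    simpa using h4 k (by omega)
  have : 1 - c = 2 * e := by rw [he, ← mul_assoc, hu', one_mul]
  rw [hz, mul_zero, sub_eq_zero] at this
  exact this.symm

open scoped Polynomial in
theorem coeff_pow_sum {R : Type*} [CommRing R] (e : R) (U : Finset n) (g : Finset n → R) (k : ℕ) :
    (∑ s ∈ U.powerset, (Polynomial.C e * Polynomial.X : R[X]) ^ s.card * Polynomial.C (g s)).coeff k =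
      e ^ k * ∑ s ∈ U.powersetCard k, g s := by
  rw [Polynomial.finsetSum_coeff, Finset.powersetCard_eq_filter, Finset.sum_filter, Finset.mul_sum]
  refine Finset.sum_congr rfl fun s _ => ?_
  rw [mul_pow, ← Polynomial.C_pow, Polynomial.coeff_mul_C, Polynomial.coeff_C_mul,
    Polynomial.coeff_X_pow]
  by_cases h : s.card = k
  · simp [h]
  · simp [h, Ne.symm h]

open scoped Polynomial in
theorem star_rel {T W : Matrix n n S} (hT : AltM T) (hW : AltM W) (hTW : T * W = 0)
    (h2 : IsUnit (2 : S)) (k kc : List n) (hl : (kc ++ k).Nodup) (hl' : ∀ i, i ∈ kc ++ k)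
    (y : List (n ⊕ n)) :
    (-1) ^ k.length * pfw (blk T W) (thw k.reverse ++ y) =
     ∑ s ∈ kc.toFinset.powersetCard k.length, pfw (blk T W) (thw (kc.filter (· ∈ s)) ++ y) := by
  have aT : AltM (T.map (Polynomial.C : S →+* S[X])) := hT.map _
  have aW : AltM (W.map (Polynomial.C : S →+* S[X])) := hW.map _
  have hTW' : T.map (Polynomial.C : S →+* S[X]) * W.map (Polynomial.C : S →+* S[X]) = 0 := by
    rw [← Matrix.map_mul, hTW]; simp
  have h := pf_kap aT aW hTW' (Polynomial.X : S[X]) (kc ++ k) hl hl'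
    (kap (-Polynomial.X) k.reverse * wd (y.map ev))
  rw [kap_one hT hW hTW h2 _ hl hl', one_mul, kap_append, mul_assoc, ← mul_assoc (kap _ k),
    kap_inv, one_mul] at h
  have hk : k.reverse.Nodup := List.nodup_reverse.2 (List.nodup_append.1 hl).2.1
  rw [kap_expand hT hW Polynomial.C _ _ hk, kap_expand hT hW Polynomial.C _ _ (List.nodup_append.1 hl).1] at h
  have e1 : (-Polynomial.X : S[X]) = Polynomial.C (-1) * Polynomial.X := by simp
  have e2 : (Polynomial.X : S[X]) = Polynomial.C 1 * Polynomial.X := by simp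
  rw [e1, e2] at h
  rw [← mul_assoc, ← Polynomial.C_mul] at h
  replace h := congrArg (fun p => p.coeff k.length) h
  have hkc : k.reverse.toFinset.card = k.length := by
    rw [List.toFinset_card_of_nodup hk]; simp
  simp only [coeff_pow_sum] at h
  have hf : k.reverse.filter (· ∈ k.reverse.toFinset) = k.reverse := by
    rw [List.filter_eq_self]; simp
  nth_rewrite 4 [← hkc] at h
  rw [Finset.powersetCard_self, Finset.sum_singleton, hf] at h
  simp only [one_pow, one_mul, mul_one] at h
  exact h.symm

end mixed

section mixed2

theorem lfs_append {n : Type*} (l l' : List (n ⊕ n)) : lfs (l ++ l') = lfs l ++ lfs l' := by simp [lfs]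
theorem rts_append {n : Type*} (l l' : List (n ⊕ n)) : rts (l ++ l') = rts l ++ rts l' := by simp [rts]
theorem lfs_inl {n : Type*} (l : List n) : lfs (l.map (Sum.inl : n → n ⊕ n)) = l := by
  induction l with
  | nil => rfl
  | cons i l ih => exact congrArg (List.cons i) ih
theorem lfs_inr {n : Type*} (l : List n) : lfs (l.map (Sum.inr : n → n ⊕ n)) = [] := by
  induction l with
  | nil => rfl
  | cons i l ih => exact congrArg id ih
theorem rts_inl {n : Type*} (l : List n) : rts (l.map (Sum.inl : n → n ⊕ n)) = [] := by
  induction l with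
  | nil => rfl
  | cons i l ih => exact congrArg id ih
theorem rts_inr {n : Type*} (l : List n) : rts (l.map (Sum.inr : n → n ⊕ n)) = l := by
  induction l with
  | nil => rfl
  | cons i l ih => exact congrArg (List.cons i) ih
theorem lfs_thw {n : Type*} (l : List n) : lfs (thw l) = l := by
  induction l with
  | nil => rfl
  | cons i l ih => exact congrArg (List.cons i) ih
theorem rts_thw {n : Type*} (l : List n) : rts (thw l) = l := by
  induction l with
  | nil => rfl
  | cons i l ih => exact congrArg (List.cons i) ih

variable {S : Type*} [CommRing S] {m : ℕ}

def wt (I : Finset (Fin m)) : ℕ := ∑ i ∈ I, 2 ^ (i : ℕ)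

def FF (I : Finset (Fin m)) (x : ℕ) : ℕ := (I.filter (fun i : Fin m => (i : ℕ) < x)).card

theorem word_eq {T W : Matrix (Fin m) (Fin m) S} (hT : AltM T) (hW : AltM W)
    (w : List (Fin m ⊕ Fin m)) {I J} (h1 : (lfs w).Nodup) (h2 : (rts w).Nodup)
    (hI : (lfs w).toFinset = I) (hJ : (rts w).toFinset = J) :
    tau T I * tau W J = pfw (blk T W) w ∨ tau T I * tau W J = - pfw (blk T W) w := by
  rcases pfw_blk hT hW w with h3 | h3 <;> rw [h3] <;>
  rcases tau_of_list T h1 hI with h3 | h3 <;> rcases tau_of_list W h2 hJ with h4 | h4 <;>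
          rw [h3, h4] <;> simp

theorem card_lt_le {m : ℕ} (U : Finset (Fin m)) (x : ℕ) (h : ∀ i ∈ U, (i : ℕ) < x) : U.card ≤ x := by
  have : (U.image (fun i : Fin m => (i : ℕ))).card ≤ (Finset.range x).card := by
    apply Finset.card_le_card
    intro i hi
    simp only [Finset.mem_image] at hi
    obtain ⟨j, hj, rfl⟩ := hi
    simpa using h j hj
  rw [Finset.card_image_of_injective _ Fin.val_injective] at this
  simpa using this

theorem wt_lt (U : Finset (Fin m)) (x : ℕ) (h : ∀ i ∈ U, (i : ℕ) < x) : wt U < 2 ^ x := by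
  have : wt U = ∑ i ∈ U.image (fun i : Fin m => (i : ℕ)), 2 ^ i := by
    rw [Finset.sum_image (by intro a _ b _ h; exact Fin.ext h)]; rfl
  rw [this]
  refine Nat.geomSum_lt le_rfl ?_
  intro k hk
  simp only [Finset.mem_image] at hk
  obtain ⟨j, hj, rfl⟩ := hk
  exact h j hj

theorem mixed_rel {T W : Matrix (Fin m) (Fin m) S} (hT : AltM T) (hW : AltM W) (hTW : T * W = 0)
    (h2 : IsUnit (2 : S)) (N : AddSubgroup S) (I J : Finset (Fin m)) (x : ℕ)
    (hx : x < FF I x + FF J x)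
    (h : ∀ I' J', I'.card = I.card → J'.card = J.card → wt I < wt I' → tau T I' * tau W J' ∈ N) :
    tau T I * tau W J ∈ N := by
  set K := (I ∩ J).filter (fun i : Fin m => (i : ℕ) < x) with hK
  have hKI : K ⊆ I := fun i hi => by simp [hK] at hi; tauto
  have hKJ : K ⊆ J := fun i hi => by simp [hK] at hi; tauto
  have star := star_rel hT hW hTW h2 K.toList Kᶜ.toList (by
      rw [List.nodup_append]
      refine ⟨Finset.nodup_toList _, Finset.nodup_toList _, ?_⟩
      intro a ha b hb hab
      simp at ha hb; subst hab; exact ha hb) (by intro i; simp; tauto)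
      ((I \ K).toList.map Sum.inl ++ (J \ K).toList.map Sum.inr)
  have hl : ∀ l : List (Fin m), lfs (thw l ++ ((I \ K).toList.map Sum.inl ++ (J \ K).toList.map Sum.inr))
      = l ++ (I \ K).toList := by
    intro l; simp [lfs_append, lfs_thw, lfs_inl, lfs_inr]
  have hr : ∀ l : List (Fin m), rts (thw l ++ ((I \ K).toList.map Sum.inl ++ (J \ K).toList.map Sum.inr))
      = l ++ (J \ K).toList := by
    intro l; simp [rts_append, rts_thw, rts_inl, rts_inr]
  have hsum : pfw (blk T W) (thw K.toList.reverse ++ ((I \ K).toList.map Sum.inl ++ (J \ K).toList.map Sum.inr)) ∈ N := by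
    have h3 : (-1) ^ K.toList.length * pfw (blk T W) (thw K.toList.reverse ++ ((I \ K).toList.map Sum.inl ++ (J \ K).toList.map Sum.inr)) ∈ N := by
      rw [star]
      refine N.sum_mem fun s hs => word_mem hT hW N _ ?_
      rw [hl, hr]
      intro n1 n2
      rw [Finset.mem_powersetCard] at hs
      obtain ⟨hs1, hs2⟩ := hs
      rw [List.toFinset_append, List.toFinset_append, filter_toFinset hs1]
      rw [List.nodup_append] at n1 n2
      rw [Finset.toList_toFinset, Finset.toList_toFinset] 
      simp only [Finset.length_toList] at hs2
      have hsK : ∀ i ∈ s, i ∉ K := fun i hi => by simpa using hs1 hi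
      have d1 : Disjoint s (I \ K) := by
        rw [Finset.disjoint_left]; intro i hi hi2
        refine n1.2.2 i ?_ i (by simpa using hi2) rfl
        rw [← List.mem_toFinset, filter_toFinset hs1]; exact hi
      have d2 : Disjoint s (J \ K) := by
        rw [Finset.disjoint_left]; intro i hi hi2
        refine n2.2.2 i ?_ i (by simpa using hi2) rfl
        rw [← List.mem_toFinset, filter_toFinset hs1]; exact hi
      have cI := Finset.card_sdiff_add_card_eq_card hKI
      have cJ := Finset.card_sdiff_add_card_eq_card hKJ
      refine h _ _ ?_ ?_ ?_
      · rw [Finset.card_union_of_disjoint d1]; omega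
      · rw [Finset.card_union_of_disjoint d2]; omega
      · have w1 : wt (s ∪ I \ K) = wt s + wt (I \ K) := Finset.sum_union d1
        have w2 : wt (I \ K) + wt K = wt I := Finset.sum_sdiff hKI
        have w3 : wt K < 2 ^ x := wt_lt _ _ (by intro i hi; simp [hK] at hi; tauto)
        have w4 : ∃ i ∈ s, x ≤ (i : ℕ) := by
          by_contra hc
          push Not at hc
          have u1 := Finset.card_union_add_card_inter (I.filter (fun i : Fin m => (i : ℕ) < x)) (J.filter (fun i : Fin m => (i : ℕ) < x))
          have u2 : (I.filter (fun i : Fin m => (i : ℕ) < x)) ∩ (J.filter (fun i : Fin m => (i : ℕ) < x)) = K := by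
            ext i; simp [hK]; tauto
          rw [u2] at u1
          have u3 : Disjoint s ((I.filter (fun i : Fin m => (i : ℕ) < x)) ∪ (J.filter (fun i : Fin m => (i : ℕ) < x))) := by
            rw [Finset.disjoint_left]; intro i hi hi2
            have := hsK i hi
            rw [Finset.disjoint_left] at d1 d2
            have := d1 hi
            have := d2 hi
            simp at *
            tauto
          have u4 := Finset.card_union_of_disjoint u3
          have u5 := card_lt_le (s ∪ ((I.filter (fun i : Fin m => (i : ℕ) < x)) ∪ (J.filter (fun i : Fin m => (i : ℕ) < x)))) x (by
            intro i hi; simp at hi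
            rcases hi with hi | hi | hi
            · exact hc i hi
            · exact hi.2
            · exact hi.2)
          simp only [FF] at hx
          omega
        obtain ⟨i, hi, hxi⟩ := w4
        have w5 : 2 ^ (i : ℕ) ≤ wt s := Finset.single_le_sum (f := fun i : Fin m => 2 ^ (i : ℕ)) (by simp) hi
        have w6 : 2 ^ x ≤ 2 ^ (i : ℕ) := Nat.pow_le_pow_right (by norm_num) hxi
        omega
    rcases neg_one_pow_eq_or S K.toList.length with h4 | h4 <;> rw [h4] at h3
    · simpa using h3
    · simpa using h3
  have e1 : K ∪ (I \ K) = I := Finset.union_sdiff_of_subset hKI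
  have e2 : K ∪ (J \ K) = J := Finset.union_sdiff_of_subset hKJ
  rcases word_eq hT hW (thw K.toList.reverse ++ ((I \ K).toList.map Sum.inl ++ (J \ K).toList.map Sum.inr)) 
    (I := I) (J := J) (by
      rw [hl, List.nodup_append]; refine ⟨by simpa using Finset.nodup_toList K, Finset.nodup_toList _, ?_⟩
      intro a ha b hb hab; subst hab; simp at ha hb; tauto) (by
      rw [hr, List.nodup_append]; refine ⟨by simpa using Finset.nodup_toList K, Finset.nodup_toList _, ?_⟩
      intro a ha b hb hab; subst hab; simp at ha hb; tauto) (by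
      rw [hl]; simp [e1]) (by rw [hr]; simp [e2]) with h5 | h5 <;> rw [h5]
  · exact hsum
  · exact N.neg_mem hsum
end mixed2

set_option linter.unusedSectionVars false
section TT
variable {S : Type*} [CommRing S] {m : ℕ}

section
variable {n : Type*} [Fintype n] [DecidableEq n]

def ch (s : Finset n) (x : n) : n ⊕ n := if x ∈ s then Sum.inl x else Sum.inr x

theorem wd_smul {M : Type*} [AddCommGroup M] [Module S M] (c : S) (g : n → M) (l : List n) :
    wd (S := S) (l.map fun x => c • g x) = c ^ l.length • wd (l.map g) := by
  induction l with
  | nil => simp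
  | cons i l ih => simp [ih, iot, smul_smul, pow_succ]

theorem wd_expand (a b : S) (l : List n) (hl : l.Nodup) :
    wd (S := S) (l.map fun x => a • ev (Sum.inl x) + b • ev (S := S) (Sum.inr x)) =
      ∑ s ∈ l.toFinset.powerset, (a ^ s.card * b ^ (l.length - s.card)) • wd ((l.map (ch s)).map ev) := by
  have h1 : wd (S := S) (l.map fun x => a • ev (Sum.inl x) + b • ev (S := S) (Sum.inr x)) =
     (l.map fun x => a • iot (S := S) (ev (Sum.inl x)) + b • iot (S := S) (ev (S := S) (Sum.inr x))).prod := by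
    simp only [wd, List.map_map]
    congr 2
    funext x
    simp [iot]
  rw [h1, list_prod_add _ _ _ hl]
  refine Finset.sum_congr rfl fun s hs => ?_
  rw [Finset.mem_powerset] at hs
  have h2 : ∀ l : List n, (l.map fun x => if x ∈ s then a • iot (S := S) (ev (Sum.inl x)) else b • iot (S := S) (ev (S := S) (Sum.inr x))).prod
    = (a ^ (l.filter (· ∈ s)).length * b ^ (l.length - (l.filter (· ∈ s)).length)) • wd ((l.map (ch s)).map ev) := by
    intro l
    induction l with
    | nil => simp
    | cons i l ih =>
      have := List.length_filter_le (· ∈ s) l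
      by_cases h : i ∈ s
      · simp [h, ih, ch, pow_succ, smul_smul]; congr 1; ring
      · simp [h, ih, ch, smul_smul]; congr 1
        rw [show l.length + 1 - (l.filter (· ∈ s)).length = l.length - (l.filter (· ∈ s)).length + 1 by omega, pow_succ]
        ring
  rw [h2, filter_len hl hs]

theorem lfs_ch (s : Finset n) (l : List n) : lfs (l.map (ch s)) = l.filter (· ∈ s) := by
  induction l with
  | nil => rfl
  | cons i l ih =>
    by_cases h : i ∈ s
    · simp only [List.map_cons, ch, h, if_true, List.filter_cons, decide_true]
      exact congrArg (List.cons i) ih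
    · simp only [List.map_cons, ch, h, if_false, List.filter_cons, decide_false]
      exact ih

theorem rts_ch (s : Finset n) (l : List n) : rts (l.map (ch s)) = l.filter (· ∉ s) := by
  induction l with
  | nil => rfl
  | cons i l ih =>
    by_cases h : i ∈ s
    · rw [List.filter_cons_of_neg (by simpa using h)]
      simp only [List.map_cons, ch, h, if_true]
      exact ih
    · rw [List.filter_cons_of_pos (by simpa using h)]
      simp only [List.map_cons, ch, h, if_false]
      exact congrArg (List.cons i) ih

theorem content (w : List (n ⊕ n)) (h1 : (lfs w).Nodup) (h2 : (rts w).Nodup) :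
    (lfs w).toFinset.val + (rts w).toFinset.val = ↑(w.map (Sum.elim id id)) := by
  rw [List.toFinset_val, List.toFinset_val, h1.dedup, h2.dedup, Multiset.coe_add]
  refine Quotient.sound ?_
  have := (perm_lr w).map (Sum.elim id id)
  simp only [List.map_append, List.map_map, Sum.elim_comp_inl, Sum.elim_comp_inr, List.map_id] at this
  exact this.symm

theorem elim_ch (s : Finset n) (l : List n) : (l.map (ch s)).map (Sum.elim id id) = l := by
  rw [List.map_map]
  conv_rhs => rw [← List.map_id l]
  refine List.map_congr_left fun x _ => ?_
  simp only [Function.comp_apply, ch]; split_ifs <;> rfl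

open scoped Polynomial in
theorem rot_rel {T : Matrix n n S} (hT : AltM T) (lX lA lL : List n) 
   (h : 2 * (lA.length + lL.length) ≤ lX.length + lA.length + lL.length) : ∃ r : ℕ,
   pf (bf (blk (T.map Polynomial.C) (T.map Polynomial.C))) 
     (wd (lX.map fun x => (Polynomial.X : S[X]) • ev (Sum.inl x) + (1 : S[X]) • ev (Sum.inr x)) *
       (wd (lA.map fun x => ev (Sum.inl x)) * wd (lL.map fun x => ev (Sum.inr x))))
   = (1 + Polynomial.X ^ 2) ^ r * pf (bf (blk (T.map Polynomial.C) (T.map Polynomial.C))) 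
     (wd (lX.map fun x => ev (Sum.inl x)) * 
      (wd (lA.map fun x => (Polynomial.X : S[X]) • ev (Sum.inl x) + (-1 : S[X]) • ev (Sum.inr x)) *
      wd (lL.map fun x => (1 : S[X]) • ev (Sum.inl x) + (Polynomial.X : S[X]) • ev (Sum.inr x)))) := by
  set T' := T.map (Polynomial.C : S →+* S[X]) with hT'
  have aT : AltM T' := hT.map _
  have hb := bf_alt (blk_alt aT aT)
  let a : S[X] := Polynomial.X
  let f : (n ⊕ n → S[X]) →ₗ[S[X]] (n ⊕ n → S[X]) :=
    { toFun := fun v => Sum.elim (a • (v ∘ Sum.inl) - v ∘ Sum.inr) (v ∘ Sum.inl + a • (v ∘ Sum.inr))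
      map_add' := by intro v w; ext1 (i | i) <;> simp <;> ring
      map_smul' := by intro v w; ext1 (i | i) <;> simp <;> ring }
  have hff : (bf (blk T' T')).compl₁₂ f f = (1 + a ^ 2) • bf (blk T' T') := by
    refine LinearMap.ext fun v => LinearMap.ext fun w => ?_
    rw [LinearMap.compl₁₂_apply, LinearMap.smul_apply, LinearMap.smul_apply, bf_apply, bf_apply]
    have h0 : v = Sum.elim (v ∘ Sum.inl) (v ∘ Sum.inr) := by simp
    conv_rhs => rw [h0]
    simp only [f, fromBlocks_mulVec, LinearMap.coe_mk, AddHom.coe_mk, sumElim_dotProduct_sumElim,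
      Sum.elim_comp_inl, Sum.elim_comp_inr, zero_mulVec, add_zero, zero_add, mulVec_sub, mulVec_add,
      mulVec_smul, mulVec_zero, dotProduct_zero, sub_dotProduct, add_dotProduct, smul_dotProduct, dotProduct_sub, dotProduct_add,
      dotProduct_smul, smul_eq_mul]
    ring
  have e1 : ∀ i, f (ev (Sum.inl i)) = a • ev (Sum.inl i) + (1 : S[X]) • ev (Sum.inr i) := by
    intro i; ext1 (j | j) <;> simp [f, Pi.single_apply]
  have e2 : ∀ i, f (ev (Sum.inr i)) = - ev (Sum.inl i) + a • ev (Sum.inr i) := by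
    intro i; ext1 (j | j) <;> simp [f, Pi.single_apply]
  have e3 : ∀ i, f (a • ev (Sum.inl i) + (-1 : S[X]) • ev (Sum.inr i)) = (1 + a ^ 2) • ev (Sum.inl i) := by
    intro i; rw [map_add, map_smul, map_smul, e1, e2]; module
  have e4 : ∀ i, f ((1 : S[X]) • ev (Sum.inl i) + a • ev (Sum.inr i)) = (1 + a ^ 2) • ev (Sum.inr i) := by
    intro i; rw [map_add, map_smul, map_smul, e1, e2]; module
  have key := pf_map hb f (wd (lX.map fun x => ev (Sum.inl x)) * 
      (wd (lA.map fun x => (Polynomial.X : S[X]) • ev (Sum.inl x) + (-1 : S[X]) • ev (Sum.inr x)) *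
      wd (lL.map fun x => (1 : S[X]) • ev (Sum.inl x) + (Polynomial.X : S[X]) • ev (Sum.inr x))))
  rw [hff, map_mul (ExteriorAlgebra.map f), map_mul (ExteriorAlgebra.map f), map_wd, map_wd, map_wd, List.map_map, List.map_map, List.map_map] at key
  have k1 : (f ∘ fun x : n => ev (Sum.inl x)) = fun x => a • ev (Sum.inl x) + (1 : S[X]) • ev (Sum.inr x) :=
    funext e1
  have k2 : (f ∘ fun x : n => (Polynomial.X : S[X]) • ev (Sum.inl x) + (-1 : S[X]) • ev (Sum.inr x)) = 
     fun x => (1 + a ^ 2) • ev (Sum.inl x) := funext e3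
  have k3 : (f ∘ fun x : n => (1 : S[X]) • ev (Sum.inl x) + (Polynomial.X : S[X]) • ev (Sum.inr x)) = 
     fun x => (1 + a ^ 2) • ev (Sum.inr x) := funext e4
  rw [k1, k2, k3, wd_smul, wd_smul, ← wd_append, ← wd_append, pf_smul hb _ _ _ rfl] at key
  simp only [smul_mul_assoc, mul_smul_comm, map_smul, smul_eq_mul, List.length_append, List.length_map] at key
  rw [← mul_assoc, ← pow_add, wd_append, wd_append] at key
  refine ⟨(lX.length + (lA.length + lL.length)) / 2 - (lA.length + lL.length), ?_⟩
  have hmon : (1 + a ^ 2).Monic := by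
    have : (1 + a ^ 2) = Polynomial.X ^ 2 + Polynomial.C (1 : S) := by simp [a, add_comm]
    rw [this]; exact Polynomial.monic_X_pow_add_C _ (by norm_num)
  have hreg := (hmon.pow (lL.length + lA.length)).isRegular.left
  apply hreg
  change (1 + a ^ 2) ^ _ * _ = (1 + a ^ 2) ^ _ * ((1 + a ^ 2) ^ _ * _)
  rw [← mul_assoc ((1 + a ^ 2) ^ _) ((1 + a ^ 2) ^ _), ← pow_add]
  rw [show lL.length + lA.length + ((lX.length + (lA.length + lL.length)) / 2 - (lA.length + lL.length)) = (lX.length + (lA.length + lL.length)) / 2 by omega]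
  exact key
end

end TT

section TT2
variable {S : Type*} [CommRing S] {m : ℕ}

open scoped Polynomial in
def pN (N : AddSubgroup S) : AddSubgroup S[X] where
  carrier := {p | ∀ k, p.coeff k ∈ N}
  zero_mem' := by intro k; simp
  add_mem' := by intro a b ha hb k; rw [Polynomial.coeff_add]; exact N.add_mem (ha k) (hb k)
  neg_mem' := by intro a ha k; rw [Polynomial.coeff_neg]; exact N.neg_mem (ha k)

open scoped Polynomial in
theorem pN_X (N : AddSubgroup S) {p : S[X]} (h : p ∈ pN N) (k : ℕ) : Polynomial.X ^ k * p ∈ pN N := by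
  intro j
  rw [Polynomial.coeff_X_pow_mul']
  split_ifs
  · exact h _
  · exact N.zero_mem

open scoped Polynomial in
theorem pN_neg (N : AddSubgroup S) {p : S[X]} (h : p ∈ pN N) (k : ℕ) : (-1) ^ k * p ∈ pN N := by
  rcases neg_one_pow_eq_or S[X] k with h1 | h1 <;> rw [h1]
  · simpa using h
  · simpa using h

open scoped Polynomial in
theorem pN_sq (N : AddSubgroup S) {p : S[X]} (h : p ∈ pN N) (k : ℕ) : (1 + Polynomial.X ^ 2) ^ k * p ∈ pN N := by
  induction k with
  | zero => simpa using h
  | succ k ih =>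
    rw [pow_succ', mul_assoc, add_mul, one_mul]
    exact add_mem ih (pN_X N ih 2)

open scoped Polynomial in
theorem pN_C (N : AddSubgroup S) {p : S} (h : p ∈ N) : Polynomial.C p ∈ pN N := by
  intro k
  rw [Polynomial.coeff_C]; split_ifs
  · exact h
  · exact N.zero_mem

section
variable {n : Type*} [Fintype n] [DecidableEq n]

theorem pfw_blkC {T : Matrix n n S} (hT : AltM T) (w : List (n ⊕ n)) :
    pf (bf (blk (T.map (Polynomial.C : S →+* Polynomial S)) (T.map Polynomial.C))) (wd (w.map ev)) = Polynomial.C (pfw (blk T T) w) := by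
  rw [← pfw_map (blk_alt hT hT) Polynomial.C _ w rfl, ← blk_map]; rfl

open scoped Polynomial in
theorem rot_L {T : Matrix n n S} (hT : AltM T) (lX lA lL : List n) (hX : lX.Nodup) (k : ℕ) :
   (pf (bf (blk (T.map Polynomial.C) (T.map Polynomial.C))) 
     (wd (lX.map fun x => (Polynomial.X : S[X]) • ev (Sum.inl x) + (1 : S[X]) • ev (Sum.inr x)) *
       (wd (lA.map fun x => ev (Sum.inl x)) * wd (lL.map fun x => ev (Sum.inr x))))).coeff k
   = ∑ s ∈ lX.toFinset.powersetCard k, pfw (blk T T) (lX.map (ch s) ++ (lA.map Sum.inl ++ lL.map Sum.inr)) := by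
  have h := coeff_pow_sum (1 : S) lX.toFinset (fun s => pfw (blk T T) (lX.map (ch s) ++ (lA.map Sum.inl ++ lL.map Sum.inr))) k
  rw [one_pow, one_mul] at h
  rw [← h, wd_expand _ _ _ hX]
  congr 1
  rw [Finset.sum_mul, map_sum]
  refine Finset.sum_congr rfl fun s _ => ?_
  rw [smul_mul_assoc, map_smul, ← pfw_blkC hT, one_pow, mul_one, map_one, one_mul, smul_eq_mul]
  simp only [List.map_append, wd_append, List.map_map, Function.comp_def]

open scoped Polynomial in
theorem rot_R {T : Matrix n n S} (hT : AltM T) (N : AddSubgroup S) (lX lA lL : List n) (hA : lA.Nodup) (hL : lL.Nodup)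
   (h : ∀ s s', pfw (blk T T) (lX.map Sum.inl ++ (lA.map (ch s) ++ lL.map (ch s'))) ∈ N) :
   pf (bf (blk (T.map Polynomial.C) (T.map Polynomial.C))) 
     (wd (lX.map fun x => ev (Sum.inl x)) * 
      (wd (lA.map fun x => (Polynomial.X : S[X]) • ev (Sum.inl x) + (-1 : S[X]) • ev (Sum.inr x)) *
      wd (lL.map fun x => (1 : S[X]) • ev (Sum.inl x) + (Polynomial.X : S[X]) • ev (Sum.inr x)))) ∈ pN N := by
  rw [wd_expand _ _ _ hA, wd_expand _ _ _ hL, Finset.sum_mul_sum, Finset.mul_sum, map_sum]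
  refine sum_mem fun s _ => ?_
  rw [Finset.mul_sum, map_sum]
  refine sum_mem fun s' _ => ?_
  rw [smul_mul_smul_comm, mul_smul_comm, map_smul, smul_eq_mul, one_pow, one_mul]
  have := pfw_blkC hT (lX.map Sum.inl ++ (lA.map (ch s) ++ lL.map (ch s')))
  simp only [List.map_append, wd_append] at this
  rw [show (lX.map Sum.inl).map (ev (S := S[X])) = lX.map fun x => ev (Sum.inl x : n ⊕ n) by simp] at this
  rw [this, mul_assoc, mul_assoc]
  exact pN_X _ (pN_neg _ (pN_X _ (pN_C _ (h s s')) _) _) _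
end

def uu (I : Finset (Fin m)) : ℕ := ∑ i ∈ I, ((m + 1) ^ 2 - (i : ℕ))

theorem uu_card {I J : Finset (Fin m)} (h : I.card < J.card) : uu I < uu J := by
  have h1 : uu I ≤ I.card * (m + 1) ^ 2 := Finset.sum_le_card_nsmul _ _ _ fun i _ => Nat.sub_le _ _
  have h2 : J.card * ((m + 1) ^ 2 - m) ≤ uu J := Finset.card_nsmul_le_sum _ _ _ fun i _ => by
    have := i.2; omega
  have h3 : I.card ≤ m := by simpa using I.card_le_univ
  have h4 : (I.card + 1) * ((m + 1) ^ 2 - m) ≤ J.card * ((m + 1) ^ 2 - m) := Nat.mul_le_mul_right _ h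
  have h5 : (m + 1) ^ 2 - m = m ^ 2 + m + 1 := by
    have : (m + 1) ^ 2 = m ^ 2 + m + 1 + m := by ring
    omega
  rw [h5] at h4 h2
  have h6 : (m + 1) ^ 2 = m ^ 2 + m + 1 + m := by ring
  rw [h6] at h1
  nlinarith

theorem uu_list {l : List (Fin m)} (h : l.Nodup) : uu l.toFinset = (l.map fun i : Fin m => (m + 1) ^ 2 - (i : ℕ)).sum := by
  rw [uu, List.sum_toFinset _ h]

theorem tt_rel {T : Matrix (Fin m) (Fin m) S} (hT : AltM T) (N : AddSubgroup S) (I I' : Finset (Fin m)) (x : ℕ)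
    (hc : I'.card ≤ I.card) (hx : FF I x < FF I' x)
    (h : ∀ Y Y' : Finset (Fin m), Y.val + Y'.val = I.val + I'.val → uu I < uu Y → tau T Y * tau T Y' ∈ N) :
    tau T I * tau T I' ∈ N := by
  set a := I'.filter (fun i : Fin m => (i : ℕ) < x) with ha
  set b := I.filter (fun i : Fin m => ¬ (i : ℕ) < x) with hb
  set A := I'.filter (fun i : Fin m => ¬ (i : ℕ) < x) with hA
  set L := I.filter (fun i : Fin m => (i : ℕ) < x) with hL
  have ca : a.card + A.card = I'.card := Finset.card_filter_add_card_filter_not _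
  have cb : L.card + b.card = I.card := Finset.card_filter_add_card_filter_not _
  have hx' : L.card < a.card := hx
  have dab : Disjoint a b := by
    rw [Finset.disjoint_left]; intro i hi hi'
    simp only [ha, hb, Finset.mem_filter] at hi hi'; exact hi'.2 hi.2
  set lX := a.toList ++ b.toList with hlX
  have nX : lX.Nodup := by
    rw [hlX, List.nodup_append']
    refine ⟨Finset.nodup_toList _, Finset.nodup_toList _, ?_⟩
    intro i hi hi'
    rw [Finset.mem_toList] at hi hi'
    exact Finset.disjoint_left.1 dab hi hi'
  have tX : lX.toFinset = a ∪ b := by simp [hlX]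
  have lenX : lX.length = a.card + b.card := by simp [hlX]
  have ab : ((a.toList ++ A.toList : List (Fin m)) : Multiset (Fin m)) = I'.val := by
    rw [← Multiset.coe_add, Finset.coe_toList, Finset.coe_toList, ha, hA, Finset.filter_val, Finset.filter_val]
    exact Multiset.filter_add_not _ _
  have bL : ((b.toList ++ L.toList : List (Fin m)) : Multiset (Fin m)) = I.val := by
    rw [← Multiset.coe_add, Finset.coe_toList, Finset.coe_toList, hb, hL, Finset.filter_val, Finset.filter_val, add_comm]
    exact Multiset.filter_add_not _ _
  have cont : ((lX ++ (A.toList ++ L.toList) : List (Fin m)) : Multiset (Fin m)) = I.val + I'.val := by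
    rw [← ab, ← bL, hlX]
    simp only [← Multiset.coe_add]
    abel
  have n1 : (a.toList ++ A.toList).Nodup := by rw [← Multiset.coe_nodup, ab]; exact I'.2
  have n2 : (b.toList ++ L.toList).Nodup := by rw [← Multiset.coe_nodup, bL]; exact I.2
  have t1 : (a.toList ++ A.toList).toFinset = I' := by
    ext i; rw [List.mem_toFinset, ← Multiset.mem_coe, ab]; rfl
  have t2 : (b.toList ++ L.toList).toFinset = I := by
    ext i; rw [List.mem_toFinset, ← Multiset.mem_coe, bL]; rfl
  obtain ⟨r, hr⟩ := rot_rel hT lX A.toList L.toList (by rw [lenX]; simp only [Finset.length_toList]; omega)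
  have hR := pN_sq N (rot_R hT N lX A.toList L.toList (Finset.nodup_toList _) (Finset.nodup_toList _) (by
    intro s s'
    refine word_mem hT hT N _ fun h1 h2 => ?_
    apply h
    · rw [content _ h1 h2]
      simp only [List.map_append, elim_ch]
      rw [← cont]
      simp [List.map_map]
    · apply uu_card
      rw [List.toFinset_card_of_nodup h1]
      simp only [lfs_append, lfs_inl, List.length_append, lenX]
      omega)) r
  rw [← hr] at hR
  have hR := hR a.card
  rw [rot_L hT _ _ _ nX] at hR
  have ha0 : a ∈ lX.toFinset.powersetCard a.card := by
    rw [Finset.mem_powersetCard, tX]; exact ⟨Finset.subset_union_left, rfl⟩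
  rw [← Finset.add_sum_erase _ _ ha0] at hR
  have hrest : ∑ s ∈ (lX.toFinset.powersetCard a.card).erase a, pfw (blk T T) (lX.map (ch s) ++ (A.toList.map Sum.inl ++ L.toList.map Sum.inr)) ∈ N := by
    refine sum_mem fun s hs => ?_
    rw [Finset.mem_erase, Finset.mem_powersetCard, tX] at hs
    obtain ⟨hs0, hs1, hs2⟩ := hs
    refine word_mem hT hT N _ fun h1 h2 => ?_
    rw [mul_comm]
    apply h
    · rw [add_comm, content _ h1 h2]
      simp only [List.map_append, elim_ch]
      rw [← cont]
      simp [List.map_map]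
    · rw [uu_list h2]
      conv_lhs => rw [← t2, uu_list n2]
      simp only [rts_append, rts_ch, rts_inl, rts_inr, List.nil_append, List.map_append, List.sum_append]
      refine Nat.add_lt_add_right ?_ _
      rw [← List.sum_toFinset _ (Finset.nodup_toList _), ← List.sum_toFinset _ (nX.filter _), Finset.toList_toFinset]
      have e1 : (lX.filter (· ∉ s)).toFinset = (a ∪ b) \ s := by
        ext i; rw [← tX]; simp
      rw [e1]
      set u : Fin m → ℕ := fun i => (m + 1) ^ 2 - (i : ℕ) with hu
      have e2 := Finset.sum_sdiff (f := u) hs1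
      have e3 := Finset.sum_union (f := u) dab
      have e4 : ∑ i ∈ s, u i < ∑ i ∈ a, u i := by
        rw [← Finset.sum_inter_add_sum_sdiff s a, ← Finset.sum_inter_add_sum_sdiff a s, Finset.inter_comm a s]
        refine Nat.add_lt_add_left ?_ _
        have c1 : (s \ a).card = (a \ s).card := Finset.card_sdiff_comm hs2
        have c2 : 0 < (s \ a).card := by
          rw [Finset.card_pos, Finset.sdiff_nonempty]
          intro hsub
          exact hs0 (Finset.eq_of_subset_of_card_le hsub hs2.ge)
        have f1 : ∑ i ∈ s \ a, u i ≤ (s \ a).card * ((m + 1) ^ 2 - x) := Finset.sum_le_card_nsmul _ _ _ fun i hi => by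
          rw [Finset.mem_sdiff] at hi
          have := (Finset.mem_union.1 (hs1 hi.1)).resolve_left hi.2
          rw [hb, Finset.mem_filter] at this
          simp only [hu]; omega
        have f2 : (a \ s).card * ((m + 1) ^ 2 - x + 1) ≤ ∑ i ∈ a \ s, u i := by
          refine Finset.card_nsmul_le_sum (a \ s) u _ fun i hi => ?_
          rw [Finset.mem_sdiff, ha, Finset.mem_filter] at hi
          have h7 : (i : ℕ) < (m + 1) ^ 2 := by have := i.2; nlinarith
          simp only [hu]; omega
        rw [c1] at f1 c2
        rw [Nat.mul_add] at f2
        omega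
      rw [e3] at e2
      change b.sum u < _ 
      have e5 : ∑ i ∈ b, u i = b.sum u := rfl
      have e6 : ∑ i ∈ (a ∪ b) \ s, u i = ((a ∪ b) \ s).sum u := rfl
      change ∑ i ∈ b, u i < ∑ i ∈ (a ∪ b) \ s, u i
      linarith
  have hmain := (N.add_mem_cancel_right hrest).1 hR
  have e1 : lX.filter (· ∈ a) = a.toList := by
    rw [hlX, List.filter_append, List.filter_eq_self.2, List.filter_eq_nil_iff.2, List.append_nil]
    · intro i hi; rw [Finset.mem_toList] at hi; simpa using fun h => Finset.disjoint_left.1 dab h hi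
    · intro i hi; simpa using hi
  have e2 : lX.filter (· ∉ a) = b.toList := by
    have z1 : a.toList.filter (· ∉ a) = [] := by
      rw [List.filter_eq_nil_iff]; intro i hi; simpa using hi
    have z2 : b.toList.filter (· ∉ a) = b.toList := by
      rw [List.filter_eq_self]
      intro i hi; rw [Finset.mem_toList] at hi; simpa using fun h => Finset.disjoint_left.1 dab h hi
    rw [hlX, List.filter_append, z1, z2, List.nil_append]
  rw [mul_comm]
  rcases word_eq hT hT (lX.map (ch a) ++ (A.toList.map Sum.inl ++ L.toList.map Sum.inr)) (I := I') (J := I)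
    (by simpa only [lfs_append, lfs_ch, lfs_inl, lfs_inr, List.append_nil, e1] using n1)
    (by simpa only [rts_append, rts_ch, rts_inl, rts_inr, List.nil_append, e2] using n2)
    (by simpa only [lfs_append, lfs_ch, lfs_inl, lfs_inr, List.append_nil, e1] using t1)
    (by simpa only [rts_append, rts_ch, rts_inl, rts_inr, List.nil_append, e2] using t2) with h' | h' <;> rw [h']
  · exact hmain
  · exact N.neg_mem hmain

end TT2

section Span
variable {S : Type*} [CommRing S] {m : ℕ}

abbrev St (m n : ℕ) := (Fin n → Finset (Fin m)) × (Fin n → Finset (Fin m))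

def bst {n : ℕ} (T W : Matrix (Fin m) (Fin m) S) (σ : St m n) : S :=
  (∏ k, tau T (σ.1 k)) * ∏ k, tau W (σ.2 k)

def Std {n : ℕ} (σ : St m n) : Prop :=
  (∀ k, Even (σ.1 k).card) ∧ (∀ k, Even (σ.2 k).card) ∧
  (∀ k l, k ≤ l → ∀ x, FF (σ.1 l) x ≤ FF (σ.1 k) x) ∧
  (∀ k l, k ≤ l → ∀ x, FF (σ.2 l) x ≤ FF (σ.2 k) x) ∧
  (∀ k l x, FF (σ.1 k) x + FF (σ.2 l) x ≤ x)

theorem prod_upd {ι M α : Type*} [Fintype ι] [DecidableEq ι] [CommMonoid M] (f : α → M) (I : ι → α) (k : ι) (Y : α) :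
    ∏ i, f (Function.update I k Y i) = f Y * ∏ i ∈ Finset.univ.erase k, f (I i) := by
  rw [← Finset.mul_prod_erase _ _ (Finset.mem_univ k)]
  congr 1
  · simp
  · refine Finset.prod_congr rfl fun i hi => ?_
    rw [Function.update_of_ne (Finset.ne_of_mem_erase hi)]

theorem sum_upd {ι M α : Type*} [Fintype ι] [DecidableEq ι] [AddCommMonoid M] (f : α → M) (I : ι → α) (k : ι) (Y : α) :
    ∑ i, f (Function.update I k Y i) = f Y + ∑ i ∈ Finset.univ.erase k, f (I i) := 
  prod_upd (M := Multiplicative M) f I k Y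

theorem prod_upd2 {ι M α : Type*} [Fintype ι] [DecidableEq ι] [CommMonoid M] (f : α → M) (I : ι → α) {k l : ι} (h : k ≠ l) (Y Y' : α) :
    ∏ i, f (Function.update (Function.update I k Y) l Y' i) = f Y * f Y' * ∏ i ∈ (Finset.univ.erase k).erase l, f (I i) := by
  rw [prod_upd, ← Finset.mul_prod_erase _ _ (show k ∈ Finset.univ.erase l by simp [h]), Finset.erase_right_comm, ← mul_assoc]
  congr 1
  · rw [mul_comm]; simp
  · refine Finset.prod_congr rfl fun i hi => ?_
    rw [Function.update_of_ne (Finset.ne_of_mem_erase (Finset.mem_of_mem_erase hi))]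

theorem sum_upd2 {ι M α : Type*} [Fintype ι] [DecidableEq ι] [AddCommMonoid M] (f : α → M) (I : ι → α) {k l : ι} (h : k ≠ l) (Y Y' : α) :
    ∑ i, f (Function.update (Function.update I k Y) l Y' i) = f Y + f Y' + ∑ i ∈ (Finset.univ.erase k).erase l, f (I i) := 
  prod_upd2 (M := Multiplicative M) f I h Y Y'

def key {n : ℕ} (σ : St m n) : ℕ ×ₗ ℕ :=
  toLex (∑ k, wt (σ.1 k), ∑ k, uu (σ.1 k) ^ 2 + ∑ k, uu (σ.2 k) ^ 2)

theorem content_sum (f : Fin m → ℕ) {Y Y' I I' : Finset (Fin m)} (h : Y.val + Y'.val = I.val + I'.val) :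
    ∑ i ∈ Y, f i + ∑ i ∈ Y', f i = ∑ i ∈ I, f i + ∑ i ∈ I', f i := by
  simp only [Finset.sum]
  rw [← Multiset.sum_add, ← Multiset.map_add, h, Multiset.map_add, Multiset.sum_add]

theorem sq_key {a b c d : ℕ} (h : c + d = a + b) (h1 : b ≤ a) (h2 : a < c) : a ^ 2 + b ^ 2 < c ^ 2 + d ^ 2 := by
  obtain ⟨e, rfl⟩ := Nat.exists_eq_add_of_lt h2
  have : b = d + e + 1 := by omega
  subst this
  nlinarith

def mulN (N : AddSubgroup S) (r : S) : AddSubgroup S := N.comap (AddMonoidHom.mulRight r)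

theorem mem_mulN {N : AddSubgroup S} {r s : S} : s ∈ mulN N r ↔ s * r ∈ N := Iff.rfl

theorem span_std {n : ℕ} {T W : Matrix (Fin m) (Fin m) S} (hT : AltM T) (hW : AltM W) (hTW : T * W = 0)
    (h2 : IsUnit (2 : S)) (N : AddSubgroup S) (hN : ∀ σ : St m n, Std σ → bst T W σ ∈ N) (σ : St m n) :
    bst T W σ ∈ N := by
  have wf : WellFounded (fun σ τ : St m n => key τ < key σ) := by
    have : IsTrans (St m n) (fun σ τ : St m n => key τ < key σ) := ⟨fun a b c h1 h2 => h2.trans h1⟩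
    have : Std.Irrefl (fun σ τ : St m n => key τ < key σ) := ⟨fun a => lt_irrefl _⟩
    exact Finite.wellFounded_of_trans_of_irrefl _
  induction σ using wf.induction with
  | _ σ ih =>
  obtain ⟨I, J⟩ := σ
  by_cases hI : ∀ k, Even (I k).card
  swap
  · push Not at hI
    obtain ⟨k, hk⟩ := hI
    rw [bst, Finset.prod_eq_zero (Finset.mem_univ k) (tau_odd hT (Nat.not_even_iff_odd.1 (by simpa using hk))), zero_mul]
    exact N.zero_mem
  by_cases hJ : ∀ k, Even (J k).card
  swap
  · push Not at hJ
    obtain ⟨k, hk⟩ := hJ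
    rw [bst, mul_comm, Finset.prod_eq_zero (Finset.mem_univ k) (tau_odd hW (Nat.not_even_iff_odd.1 (by simpa using hk))), zero_mul]
    exact N.zero_mem
  by_cases hm : ∀ k l x, FF (I k) x + FF (J l) x ≤ x
  swap
  · push Not at hm
    obtain ⟨k, l, x, hx⟩ := hm
    have e : ∀ Y Z, bst T W (Function.update I k Y, Function.update J l Z) = 
       (tau T Y * tau W Z) * ((∏ i ∈ Finset.univ.erase k, tau T (I i)) * ∏ i ∈ Finset.univ.erase l, tau W (J i)) := by
      intro Y Z
      rw [bst, prod_upd, prod_upd]; ring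
    have e0 := e (I k) (J l)
    rw [Function.update_eq_self, Function.update_eq_self] at e0
    rw [e0, ← mem_mulN]
    refine mixed_rel hT hW hTW h2 _ _ _ x hx fun Y Z _ _ hYZ => ?_
    rw [mem_mulN, ← e]
    apply ih
    simp only [key, Prod.Lex.toLex_lt_toLex]
    left
    rw [sum_upd, ← Finset.add_sum_erase _ _ (Finset.mem_univ k)]
    omega
  by_cases hTT : ∀ k l, k ≠ l → uu (I l) ≤ uu (I k) → ∀ x, FF (I l) x ≤ FF (I k) x
  swap
  · push Not at hTT
    obtain ⟨k, l, hkl, hu, x, hx⟩ := hTT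
    have e : ∀ Y Z, bst T W (Function.update (Function.update I k Y) l Z, J) = 
       (tau T Y * tau T Z) * ((∏ i ∈ (Finset.univ.erase k).erase l, tau T (I i)) * ∏ i, tau W (J i)) := by
      intro Y Z
      rw [bst, prod_upd2 _ _ hkl]; ring
    have e0 := e (I k) (I l)
    rw [Function.update_eq_self, Function.update_eq_self] at e0
    rw [e0, ← mem_mulN]
    refine tt_rel hT _ _ _ x (not_lt.1 fun h => absurd (uu_card h) (by omega)) hx fun Y Z hYZ hlt => ?_
    rw [mem_mulN, ← e]
    apply ih
    have s1 : ∀ f : Finset (Fin m) → ℕ, ∑ i, f (I i) = f (I k) + f (I l) + ∑ i ∈ (Finset.univ.erase k).erase l, f (I i) := by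
      intro f; rw [← sum_upd2 f I hkl, Function.update_eq_self, Function.update_eq_self]
    simp only [key, Prod.Lex.toLex_lt_toLex]
    right
    have c1 : wt Y + wt Z = wt (I k) + wt (I l) := content_sum _ hYZ
    have c2 := sq_key (content_sum _ hYZ) hu hlt
    rw [sum_upd2 _ _ hkl, sum_upd2 (fun Y => uu Y ^ 2) _ hkl, s1 wt, s1 (fun Y => uu Y ^ 2)]
    change uu (I k) ^ 2 + uu (I l) ^ 2 < uu Y ^ 2 + uu Z ^ 2 at c2
    constructor <;> omega
  by_cases hWW : ∀ k l, k ≠ l → uu (J l) ≤ uu (J k) → ∀ x, FF (J l) x ≤ FF (J k) x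
  swap
  · push Not at hWW
    obtain ⟨k, l, hkl, hu, x, hx⟩ := hWW
    have e : ∀ Y Z, bst T W (I, Function.update (Function.update J k Y) l Z) = 
       (tau W Y * tau W Z) * ((∏ i ∈ (Finset.univ.erase k).erase l, tau W (J i)) * ∏ i, tau T (I i)) := by
      intro Y Z
      rw [bst, prod_upd2 _ _ hkl]; ring
    have e0 := e (J k) (J l)
    rw [Function.update_eq_self, Function.update_eq_self] at e0
    rw [e0, ← mem_mulN]
    refine tt_rel hW _ _ _ x (not_lt.1 fun h => absurd (uu_card h) (by omega)) hx fun Y Z hYZ hlt => ?_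
    rw [mem_mulN, ← e]
    apply ih
    have s1 : ∀ f : Finset (Fin m) → ℕ, ∑ i, f (J i) = f (J k) + f (J l) + ∑ i ∈ (Finset.univ.erase k).erase l, f (J i) := by
      intro f; rw [← sum_upd2 f J hkl, Function.update_eq_self, Function.update_eq_self]
    simp only [key, Prod.Lex.toLex_lt_toLex]
    right
    have c2 := sq_key (content_sum _ hYZ) hu hlt
    rw [sum_upd2 (fun Y => uu Y ^ 2) _ hkl, s1 (fun Y => uu Y ^ 2)]
    change uu (J k) ^ 2 + uu (J l) ^ 2 < uu Y ^ 2 + uu Z ^ 2 at c2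
    constructor
    · trivial
    · omega
  have srt : ∀ K : Fin n → Finset (Fin m), (∀ k l, k ≠ l → uu (K l) ≤ uu (K k) → ∀ x, FF (K l) x ≤ FF (K k) x) →
      ∃ p : Equiv.Perm (Fin n), ∀ k l, k ≤ l → ∀ x, FF (K (p l)) x ≤ FF (K (p k)) x := by
    intro K hK
    refine ⟨Tuple.sort (fun i => OrderDual.toDual (uu (K i))), fun k l hkl x => ?_⟩
    have := Tuple.monotone_sort (fun i => OrderDual.toDual (uu (K i))) hkl
    by_cases h : k = l
    · rw [h]
    exact hK _ _ (fun h' => h (by simpa using h')) (by simpa using this) x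
  obtain ⟨p, hp⟩ := srt I hTT
  obtain ⟨q, hq⟩ := srt J hWW
  have : bst T W (I, J) = bst T W (I ∘ p, J ∘ q) := by
    simp only [bst, Function.comp]
    rw [Equiv.prod_comp p (fun k => tau T (I k)), Equiv.prod_comp q (fun k => tau W (J k))]
  rw [this]
  exact hN _ ⟨fun k => hI _, fun k => hJ _, hp, hq, fun k l x => hm _ _ x⟩

end Span

section Span2
variable {S : Type*} [CommRing S] {m : ℕ}

theorem bst_cons {n : ℕ} (T W : Matrix (Fin m) (Fin m) S) (Y Z : Finset (Fin m)) (σ : St m n) :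
    bst T W ((Fin.cons Y σ.1 : Fin (n + 1) → _), (Fin.cons Z σ.2 : Fin (n + 1) → _)) = tau T Y * tau W Z * bst T W σ := by
  simp only [bst, Fin.prod_univ_succ, Fin.cons_zero, Fin.cons_succ]; ring

theorem tau_pair {T : Matrix (Fin m) (Fin m) S} (hT : AltM T) {i j : Fin m} (h : i ≠ j) :
    T i j = tau T {i, j} ∨ T i j = - tau T {i, j} := by
  have h1 : pfw T [i, j] = T i j := by
    rw [pfw_cons hT]; simp [pfw_nil hT]
  rw [← h1]
  exact tau_of_list T (by simpa using h) (by simp)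

variable {B : Type*} [CommRing B] [Algebra B S]

def Sp (B : Type*) [CommRing B] [Algebra B S] (T W : Matrix (Fin m) (Fin m) S) (n : ℕ) : Submodule B S :=
  Submodule.span B (Set.range (bst (n := n) T W))

theorem Sp_mul {T W : Matrix (Fin m) (Fin m) S} {n : ℕ} {z : S} (hz : z ∈ Sp B T W n) (Y Z : Finset (Fin m)) :
    tau T Y * tau W Z * z ∈ Sp B T W (n + 1) := by
  have : Sp B T W n ≤ (Sp B T W (n + 1)).comap (LinearMap.mulLeft B (tau T Y * tau W Z)) := by
    rw [Sp, Submodule.span_le]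
    rintro _ ⟨σ, rfl⟩
    change tau T Y * tau W Z * bst T W σ ∈ Sp B T W (n + 1)
    rw [← bst_cons]
    exact Submodule.subset_span ⟨_, rfl⟩
  exact this hz

theorem Sp_mono {T W : Matrix (Fin m) (Fin m) S} (hT : AltM T) (hW : AltM W) {n k : ℕ} (h : n ≤ k) :
    Sp B T W n ≤ Sp B T W k := by
  induction h with
  | refl => rfl
  | step h ih =>
    intro z hz
    have := Sp_mul (ih hz) ∅ ∅
    rwa [tau_empty hT, tau_empty hW, one_mul, one_mul] at this

theorem Sp_all {T W : Matrix (Fin m) (Fin m) S} (hT : AltM T) (hW : AltM W) 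
   (f : MvPolynomial (MatVars m) B →ₐ[B] S) (fT : ∀ i j, f (X (Sum.inl (i, j))) = T i j)
   (fW : ∀ i j, f (X (Sum.inr (i, j))) = W i j) (p) : ∃ n, f p ∈ Sp B T W n := by
  induction p using MvPolynomial.induction_on with
  | C a =>
    refine ⟨0, ?_⟩
    rw [← MvPolynomial.algebraMap_eq, AlgHom.commutes, Algebra.algebraMap_eq_smul_one]
    refine Submodule.smul_mem _ _ (Submodule.subset_span ⟨(Fin.elim0, Fin.elim0), ?_⟩)
    simp [bst]
  | add p q hp hq =>
    obtain ⟨a, ha⟩ := hp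
    obtain ⟨b, hb⟩ := hq
    refine ⟨max a b, ?_⟩
    rw [map_add]
    exact add_mem (Sp_mono hT hW (le_max_left a b) ha) (Sp_mono hT hW (le_max_right a b) hb)
  | mul_X p v hp =>
    obtain ⟨a, ha⟩ := hp
    refine ⟨a + 1, ?_⟩
    rw [map_mul, mul_comm]
    rcases v with ⟨i, j⟩ | ⟨i, j⟩
    · rw [fT]
      by_cases h : i = j
      · rw [h, hT.1, zero_mul]; exact zero_mem _
      have := Sp_mul ha {i, j} ∅
      rw [tau_empty hW, mul_one] at this
      rcases tau_pair hT h with h | h <;> rw [h]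
      · exact this
      · rw [neg_mul]; exact neg_mem this
    · rw [fW]
      by_cases h : i = j
      · rw [h, hW.1, zero_mul]; exact zero_mem _
      have := Sp_mul ha ∅ {i, j}
      rw [tau_empty hT, one_mul] at this
      rcases tau_pair hW h with h | h <;> rw [h]
      · exact this
      · rw [neg_mul]; exact neg_mem this

theorem exists_std {T W : Matrix (Fin m) (Fin m) S} (hT : AltM T) (hW : AltM W) (hTW : T * W = 0) (h2 : IsUnit (2 : S))
   (f : MvPolynomial (MatVars m) B →ₐ[B] S) (fT : ∀ i j, f (X (Sum.inl (i, j))) = T i j)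
   (fW : ∀ i j, f (X (Sum.inr (i, j))) = W i j) (p) : ∃ n, ∃ c : St m n → B, (∀ σ, c σ ≠ 0 → Std σ) ∧
     f p = ∑ σ, c σ • bst T W σ := by
  classical
  obtain ⟨n, hn⟩ := Sp_all hT hW f fT fW p
  refine ⟨n, ?_⟩
  have : Sp B T W n ≤ Submodule.span B (Set.range fun σ : {σ : St m n // Std σ} => bst T W σ.1) := by
    rw [Sp, Submodule.span_le]
    rintro _ ⟨σ, rfl⟩
    exact span_std hT hW hTW h2 (Submodule.span B (Set.range fun σ : {σ : St m n // Std σ} => bst T W σ.1)).toAddSubgroup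
      (fun σ hσ => Submodule.subset_span ⟨⟨σ, hσ⟩, rfl⟩) σ
  obtain ⟨c, hc⟩ := (Submodule.mem_span_range_iff_exists_fun B).1 (this hn)
  refine ⟨fun σ => if h : Std σ then c ⟨σ, h⟩ else 0, fun σ h => ?_, ?_⟩
  · by_contra h'
    simp [h'] at h
  · rw [← hc]
    symm
    have := Finset.sum_subtype_of_mem (s := Finset.univ.filter (Std : St m n → Prop)) (p := Std) (fun σ => (if h : Std σ then c ⟨σ, h⟩ else 0) • bst T W σ) (by simp)
    rw [← Finset.sum_filter_of_ne (p := Std), ← this]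
    · refine Fintype.sum_congr _ _ ?_ |>.trans (Finset.sum_congr (by ext a; simpa using a.2) fun _ _ => rfl) |>.symm
      rintro ⟨σ, hσ⟩; simp [hσ]
    · intro σ _ h
      by_contra h'
      simp [h'] at h

end Span2

section CB
variable {S : Type*} [CommRing S] {n : Type*} [Fintype n] [DecidableEq n]

theorem bf_conj (A N : Matrix n n S) : (bf A).compl₁₂ N.mulVecLin N.mulVecLin = bf (Nᵀ * A * N) := by
  refine LinearMap.ext fun v => LinearMap.ext fun w => ?_
  rw [LinearMap.compl₁₂_apply, bf_apply, bf_apply, mulVecLin_apply, mulVecLin_apply,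
    ← mulVec_mulVec, ← mulVec_mulVec, dotProduct_mulVec v, vecMul_transpose]

theorem wd_ofFn {M : Type*} [AddCommGroup M] [Module S M] {r : ℕ} (v : Fin r → M) :
    wd (S := S) (List.ofFn v) = ExteriorAlgebra.ιMulti S r v := by
  rw [ExteriorAlgebra.ιMulti_apply, wd, List.map_ofFn]; rfl

theorem cauchy_binet {A : Matrix n n S} (hA : AltM A) (N : Matrix n n S) {r : ℕ} (v : Fin r → n) :
    pfw (Nᵀ * A * N) (List.ofFn v) = ∑ f : Fin r → n, (∏ j, N (f j) (v j)) * pfw A (List.ofFn f) := by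
  rw [pfw, ← bf_conj, ← pf_map (bf_alt hA), map_wd, List.map_ofFn, List.map_ofFn, wd_ofFn]
  have h1 : (N.mulVecLin ∘ ev ∘ v : Fin r → n → S) = fun j => ∑ c, N c (v j) • ev (S := S) c := by
    funext j
    ext i
    simp [Pi.single_apply]
  rw [h1]
  have h2 := (ExteriorAlgebra.ιMulti S r (M := n → S)).toMultilinearMap.map_sum (fun (j : Fin r) (c : n) => N c (v j) • ev (S := S) c)
  rw [AlternatingMap.coe_multilinearMap] at h2
  rw [h2, map_sum]
  refine Finset.sum_congr rfl fun f _ => ?_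
  have h3 := (ExteriorAlgebra.ιMulti S r (M := n → S)).toMultilinearMap.map_smul_univ (fun j => N (f j) (v j)) (fun j => ev (f j))
  rw [AlternatingMap.coe_multilinearMap] at h3
  rw [h3, map_smul, smul_eq_mul, ← wd_ofFn, pfw, List.map_ofFn]; rfl

theorem pfw_permute (A : Matrix n n S) {r : ℕ} (v : Fin r → n) (p : Equiv.Perm (Fin r)) :
    pfw A (List.ofFn (v ∘ p)) = (Equiv.Perm.sign p : ℤ) * pfw A (List.ofFn v) := by
  rw [pfw, pfw, List.map_ofFn, List.map_ofFn, wd_ofFn, wd_ofFn, ← Function.comp_assoc, AlternatingMap.map_perm]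
  rw [Units.smul_def, map_zsmul, zsmul_eq_mul]

theorem pfw_zero_row {A : Matrix n n S} (hA : AltM A) {i : n} (h : ∀ j, A i j = 0) {l : List n} (hi : i ∈ l) : pfw A l = 0 := by
  have h0 : pfw A (i :: l.erase i) = 0 := by
    rw [pfw_cons hA]; simp [h]
  rcases pfw_perm A (List.perm_cons_erase hi) with h | h <;> rw [h, h0]
  simp

theorem pfw_two {A : Matrix n n S} (hA : AltM A) {i j : n} {l : List n} (h : ∀ k ∈ l, A i k = 0) :
    pfw A (i :: j :: l) = A i j * pfw A l := by
  rw [pfw_cons hA]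
  have : ∀ k : Fin (j :: l).length, k ≠ ⟨0, by simp⟩ → (-1 : S) ^ (k : ℕ) * A i ((j :: l).get k) * pfw A ((j :: l).eraseIdx k) = 0 := by
    rintro ⟨k, hk⟩ h'
    match k with
    | 0 => exact absurd rfl h'
    | k + 1 =>
      simp only [List.get_eq_getElem, List.getElem_cons_succ]
      rw [h _ (List.getElem_mem _)]; simp
  rw [Fintype.sum_eq_single _ this]
  simp

end CB

section blockS
variable {S : Type*} [CommRing S] {m : ℕ}

def bS (m : ℕ) (s : ℕ → S) : Matrix (Fin m) (Fin m) S := fun a b =>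
  if (a : ℕ) / 2 = b / 2 then (if a < b then s (a / 2) else if b < a then - s (a / 2) else 0) else 0

theorem bS_alt (s : ℕ → S) : AltM (bS m s) := by
  refine ⟨fun i => by simp [bS], fun i j => ?_⟩
  simp only [bS]
  by_cases h : (i : ℕ) / 2 = j / 2
  · rcases lt_trichotomy i j with h1 | h1 | h1
    · simp [h, h1, not_lt.2 h1.le]
    · simp [h1]
    · simp [h, h1, not_lt.2 h1.le]
  · simp [h, Ne.symm h]

theorem bS_pfw (s : ℕ → S) (u : ℕ) : ∀ (a : ℕ) (f : Fin (2 * u) → Fin m), (∀ j, (f j : ℕ) = 2 * a + j) →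
    pfw (bS m s) (List.ofFn f) = ∏ i ∈ Finset.range u, s (a + i) := by
  induction u with
  | zero => intro a f _; simp [pfw_nil (bS_alt s)]
  | succ u ih =>
    intro a f hf
    change pfw (bS m s) (List.ofFn (n := 2 * u + 1 + 1) f) = _
    rw [List.ofFn_succ, List.ofFn_succ, pfw_two (bS_alt s), ih (a + 1), Finset.prod_range_succ']
    · have e0 := hf 0
      have e1 := hf (Fin.succ (0 : Fin (2 * u + 1)))
      simp only [Fin.val_succ, Fin.val_zero] at e0 e1
      rw [mul_comm]
      congr 1
      · refine Finset.prod_congr rfl fun i _ => ?_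
        congr 1; ring
      · simp only [bS]
        rw [if_pos (by rw [e1, e0]; omega), if_pos (by rw [Fin.lt_def, e1, e0]; omega), e0]
        congr 1; omega
    · intro j
      rw [hf]; simp; ring
    · intro k hk
      rw [List.mem_ofFn] at hk
      obtain ⟨j, rfl⟩ := hk
      simp only [bS]
      rw [if_neg]
      rw [hf, hf]; simp; omega

theorem bS_row (s : ℕ → S) {k : ℕ} (hs : ∀ i, k ≤ i → s i = 0) {i : Fin m} (hi : 2 * k ≤ i) (j) : bS m s i j = 0 := by
  simp only [bS]
  rw [hs (i / 2) (by omega)]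
  simp

end blockS

section LeadSec
open scoped Polynomial
variable {D : Type*} [CommRing D] {m : ℕ}

def Lead (p : D[X]) (d : ℕ) (μ : D) : Prop :=
  ∃ q : D[X], p = Polynomial.X ^ d * (Polynomial.C μ + Polynomial.X * q)

theorem Lead.mul {p p' : D[X]} {d d' : ℕ} {μ μ' : D} (h : Lead p d μ) (h' : Lead p' d' μ') :
    Lead (p * p') (d + d') (μ * μ') := by
  obtain ⟨q, rfl⟩ := h
  obtain ⟨q', rfl⟩ := h'
  refine ⟨q * Polynomial.C μ' + Polynomial.C μ * q' + Polynomial.X * q * q', ?_⟩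
  rw [map_mul]; ring

theorem Lead.one : Lead (1 : D[X]) 0 1 := ⟨0, by simp⟩

theorem Lead.C (a : D) : Lead (Polynomial.C a : D[X]) 0 a := ⟨0, by simp⟩

theorem Lead.X (n : ℕ) : Lead (Polynomial.X ^ n : D[X]) n 1 := ⟨0, by simp⟩

theorem Lead.add {p r : D[X]} {d : ℕ} {μ : D} (h : Lead p d μ) (h' : Polynomial.X ^ (d + 1) ∣ r) :
    Lead (p + r) d μ := by
  obtain ⟨q, rfl⟩ := h
  obtain ⟨q', rfl⟩ := h'
  exact ⟨q + q', by ring⟩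

theorem Lead.coeff {p : D[X]} {d : ℕ} {μ : D} (h : Lead p d μ) : p.coeff d = μ := by
  obtain ⟨q, rfl⟩ := h
  rw [Polynomial.coeff_X_pow_mul']; simp

theorem Lead.coeff_lt {p : D[X]} {d : ℕ} {μ : D} (h : Lead p d μ) {j : ℕ} (hj : j < d) : p.coeff j = 0 := by
  obtain ⟨q, rfl⟩ := h
  rw [Polynomial.coeff_X_pow_mul', if_neg (by omega)]

theorem lead_det {r : ℕ} (γ : Fin r → Fin r → D) (e : Fin r → Fin r → ℕ)
    (he : ∀ p : Equiv.Perm (Fin r), p ≠ 1 → ∑ j, e j j < ∑ j, e (p j) j) :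
    Lead (Matrix.det (Matrix.of fun i j => Polynomial.C (γ i j) * Polynomial.X ^ e i j)) (∑ j, e j j) (∏ j, γ j j) := by
  rw [Matrix.det_apply', ← Finset.add_sum_erase _ _ (Finset.mem_univ 1)]
  simp only [Matrix.of_apply]
  have ht : ∀ p : Equiv.Perm (Fin r), ∏ j, (Polynomial.C (γ (p j) j) * Polynomial.X ^ e (p j) j) =
    Polynomial.C (∏ j, γ (p j) j) * Polynomial.X ^ (∑ j, e (p j) j) := by
    intro p; rw [Finset.prod_mul_distrib, Finset.prod_pow_eq_pow_sum, map_prod]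
  refine Lead.add ?_ (Finset.dvd_sum fun p hp => ?_)
  · rw [ht 1]
    exact ⟨0, by simp [mul_comm]⟩
  · rw [ht p]
    refine Dvd.dvd.mul_left (Dvd.dvd.mul_left (pow_dvd_pow _ (he p (Finset.ne_of_mem_erase hp))) _) _

theorem rearr {r : ℕ} (v : Fin r → ℕ) (hv : StrictMono v) (p : Equiv.Perm (Fin r)) (hp : p ≠ 1) :
    ∑ j, ((v j : ℤ) - (j : ℕ)).natAbs ^ 2 < ∑ j, ((v j : ℤ) - (p j : ℕ)).natAbs ^ 2 := by
  zify
  simp only [sq_abs]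
  have h1 : ∀ q : Equiv.Perm (Fin r), ∑ j, ((v j : ℤ) - (q j : ℕ)) ^ 2 = ∑ j, (v j : ℤ) ^ 2 + ∑ j : Fin r, (((j : ℕ) : ℤ)) ^ 2
     - 2 * ∑ j, (v j : ℤ) * ((q j : ℕ) : ℤ) := by
    intro q
    rw [← Equiv.sum_comp q (fun j : Fin r => (((j : ℕ) : ℤ)) ^ 2), Finset.mul_sum, ← Finset.sum_add_distrib, ← Finset.sum_sub_distrib]
    refine Finset.sum_congr rfl fun j _ => by ring
  have h2 := h1 1
  simp only [Equiv.Perm.coe_one, id] at h2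
  rw [h1, h2]
  have hfg : Monovary (fun j => (v j : ℤ)) (fun j : Fin r => (((j : ℕ) : ℤ))) := by
    intro i j hij
    have : i < j := by simpa using hij
    simpa using (hv this).le
  have h3 := (hfg.sum_mul_comp_perm_lt_sum_mul_iff (σ := p)).2 (by
    intro hm
    apply hp
    have hs : StrictMono p.symm := by
      intro i j hij
      have := hm (i := p.symm i) (j := p.symm j) (by simpa using hij)
      have h4 : v (p.symm i) ≤ v (p.symm j) := by simpa using this
      exact lt_of_le_of_ne (hv.le_iff_le.1 h4) (by simpa using hij.ne)
    have h5 := (hs.range_inj strictMono_id).1 (by simp [Set.range_eq_univ.2 p.symm.surjective])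
    have : p.symm = 1 := Equiv.ext fun i => congrFun h5 i
    rw [← Equiv.symm_symm p, this]; rfl)
  linarith

theorem sum_gt {r : ℕ} (f : Fin r → ℕ) (hf : Function.Injective f) {j : Fin r} (hj : r ≤ f j) :
    ∑ i : Fin r, (i : ℕ) < ∑ i, f i := by
  rw [Fin.sum_univ_eq_sum_range (fun i => i), ← Finset.sum_image (s := Finset.univ) (f := fun i => i) (g := f) (by simpa using hf)]
  set A := Finset.univ.image f with hA
  have c0 : A.card = (Finset.range r).card := by rw [hA, Finset.card_image_of_injective _ hf]; simp
  rw [← Finset.sum_inter_add_sum_sdiff A (Finset.range r), ← Finset.sum_inter_add_sum_sdiff (Finset.range r) A, Finset.inter_comm A]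
  refine Nat.add_lt_add_left ?_ _
  have c1 := Finset.card_sdiff_comm c0
  have c2 : 0 < (A \ Finset.range r).card := Finset.card_pos.2 ⟨f j, by simp [hA, hj]⟩
  have f1 : (A \ Finset.range r).card * r ≤ ∑ i ∈ A \ Finset.range r, i := by
    refine Finset.card_nsmul_le_sum _ _ _ fun i hi => ?_
    simpa using (Finset.mem_sdiff.1 hi).2
  have f2 : ∑ i ∈ Finset.range r \ A, (i + 1) ≤ (Finset.range r \ A).card * r := by
    refine Finset.sum_le_card_nsmul _ _ _ fun i hi => ?_
    simpa using (Finset.mem_sdiff.1 hi).1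
  rw [Finset.sum_add_distrib, Finset.sum_const, smul_eq_mul, mul_one] at f2
  rw [c1] at f1 c2
  omega

def dM (N : ℕ) (M : Matrix (Fin m) (Fin m) D[X]) : Matrix (Fin m) (Fin m) D[X] :=
  fun c j => Polynomial.X ^ (N * (c : ℕ)) * M c j

theorem sort_ofFn (I : Finset (Fin m)) : I.sort (· ≤ ·) = List.ofFn (fun j : Fin I.card => I.orderEmbOfFin rfl j) := by
  apply List.ext_getElem
  · simp
  · intro i h1 h2
    simp [Finset.orderEmbOfFin_apply]

theorem lead_tau (s : ℕ → D) (M : Matrix (Fin m) (Fin m) D[X]) (I : Finset (Fin m)) {u : ℕ} (hI : I.card = 2 * u)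
    (hc : I.card ≤ m) {N e : ℕ} (heN : e < N) {μ : D}
    (hd : Lead (Matrix.det (Matrix.of fun i j : Fin I.card => M (Fin.castLE hc i) (I.orderEmbOfFin rfl j))) e μ) :
    Lead (tau ((dM N M)ᵀ * bS m (fun i => Polynomial.C (s i)) * dM N M) I) (N * (∑ j : Fin I.card, (j : ℕ)) + e)
      (μ * ∏ i ∈ Finset.range u, s i) := by
  set v := fun j : Fin I.card => I.orderEmbOfFin rfl j with hv
  set A := bS m (fun i => (Polynomial.C (s i) : D[X])) with hA
  rw [tau, sort_ofFn, cauchy_binet (bS_alt _)]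
  set Q := ∑ j : Fin I.card, (j : ℕ) with hQ
  rw [← Finset.sum_filter_add_sum_filter_not _ (fun f : Fin I.card → Fin m => Function.Injective f ∧ ∀ j, (f j : ℕ) < I.card)]
  have hpf : pfw A (List.ofFn (Fin.castLE hc)) = Polynomial.C (∏ i ∈ Finset.range u, s i) := by
    have h1 := bS_pfw (m := m) (fun i => (Polynomial.C (s i) : D[X])) u 0 (fun j => Fin.castLE hc (Fin.cast hI.symm j)) (by simp)
    rw [map_prod]
    simp only [zero_add] at h1
    rw [← h1]
    congr 1
    apply List.ext_getElem
    · simp [hI]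
    · intro i h1 h2; simp
  refine Lead.add ?_ ?_
  · have : ∑ f ∈ Finset.univ.filter (fun f : Fin I.card → Fin m => Function.Injective f ∧ ∀ j, (f j : ℕ) < I.card),
         (∏ j, dM N M (f j) (v j)) * pfw A (List.ofFn f) = 
        Polynomial.X ^ (N * Q) * Matrix.det (Matrix.of fun i j : Fin I.card => M (Fin.castLE hc i) (v j)) * Polynomial.C (∏ i ∈ Finset.range u, s i) := by
      rw [Matrix.det_apply', Finset.mul_sum, Finset.sum_mul]
      simp only [Matrix.of_apply]
      symm
      refine Finset.sum_bij (fun p _ => Fin.castLE hc ∘ p) ?_ ?_ ?_ ?_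
      · intro p _
        simp only [Finset.mem_filter, Finset.mem_univ, true_and]
        exact ⟨(Fin.castLE_injective hc).comp p.injective, by simp⟩
      · intro p _ q _ h
        ext j
        have := congrArg Fin.val (congrFun h j)
        simpa using this
      · intro f hf
        simp only [Finset.mem_filter, Finset.mem_univ, true_and] at hf
        have inj : Function.Injective (fun j => (⟨f j, hf.2 j⟩ : Fin I.card)) := by
          intro i j hij
          exact hf.1 (Fin.ext (by simpa using hij))
        refine ⟨Equiv.ofBijective _ (Finite.injective_iff_bijective.1 inj), Finset.mem_univ _, ?_⟩
        funext j; ext; simp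
      · intro p _
        rw [pfw_permute, hpf]
        simp only [dM, Finset.prod_mul_distrib, Function.comp_apply, Fin.val_castLE]
        rw [Finset.prod_pow_eq_pow_sum, ← Finset.mul_sum, Equiv.sum_comp p (fun j : Fin I.card => (j : ℕ))]
        ring
    rw [this]
    have := ((Lead.X (D := D) (N * Q)).mul hd).mul (Lead.C (∏ i ∈ Finset.range u, s i))
    simpa using this
  · refine Finset.dvd_sum fun f hf => ?_
    simp only [Finset.mem_filter, Finset.mem_univ, true_and, not_and, not_forall, not_lt] at hf
    by_cases hinj : Function.Injective f
    · obtain ⟨j, hj⟩ := hf hinj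
      have := sum_gt (fun j => (f j : ℕ)) (Fin.val_injective.comp hinj) hj
      refine Dvd.dvd.mul_right ?_ _
      simp only [dM, Finset.prod_mul_distrib, Finset.prod_pow_eq_pow_sum, ← Finset.mul_sum]
      refine Dvd.dvd.mul_right (pow_dvd_pow _ ?_) _
      nlinarith
    · rw [pfw_dup A (by rwa [List.nodup_ofFn]), mul_zero]
      exact dvd_zero _

theorem tau_big (s : ℕ → D) {k : ℕ} (hs : ∀ i, k ≤ i → s i = 0) (M : Matrix (Fin m) (Fin m) D) (I : Finset (Fin m)) (h : 2 * k < I.card) :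
    tau (Mᵀ * bS m s * M) I = 0 := by
  rw [tau, sort_ofFn, cauchy_binet (bS_alt _)]
  refine Finset.sum_eq_zero fun f _ => ?_
  by_cases hinj : Function.Injective f
  · by_cases hex : ∃ j, 2 * k ≤ f j
    · obtain ⟨j, hj⟩ := hex
      rw [pfw_zero_row (bS_alt s) (bS_row s hs hj) (List.mem_ofFn.2 ⟨j, rfl⟩), mul_zero]
    · push Not at hex
      have := Finset.card_le_card_of_injOn (s := Finset.univ) (t := Finset.range (2 * k)) (fun j => (f j : ℕ))
        (by intro j _; simpa using hex j) (fun i _ j _ h => hinj (Fin.ext h))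
      simp at this; omega
  · rw [pfw_dup _ (by rwa [List.nodup_ofFn]), mul_zero]

end LeadSec

section JacSec
variable {R : Type*} [CommRing R] {m : ℕ}

theorem jacobi (g h : Matrix (Fin m) (Fin m) R) (hgh : g * h = 1) (hg : g.det = 1) (J : Finset (Fin m))
    (hJ : J.card ≤ m) (hJc : Jᶜ.card ≤ m) :
    ∃ ε : ℤˣ, Matrix.det (Matrix.of fun i j : Fin J.card => (h.submatrix Fin.rev id) (Fin.castLE hJ i) (J.orderEmbOfFin rfl j)) =
      ((ε : ℤ) : R) * Matrix.det (Matrix.of fun i j : Fin Jᶜ.card => gᵀ (Fin.castLE hJc i) (Jᶜ.orderEmbOfFin rfl j)) := by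
  have hcard : J.card + Jᶜ.card = m := by
    rw [Finset.card_add_card_compl, Fintype.card_fin]
  let e : Fin J.card ⊕ Fin Jᶜ.card ≃ Fin m := finSumEquivOfFinset (s := J) rfl rfl
  let f0 : Fin J.card ⊕ Fin Jᶜ.card → Fin m := Sum.elim (fun i => Fin.rev (Fin.castLE hJ i)) (fun i => Fin.castLE hJc i)
  have finj : Function.Injective f0 := by
    rintro (i | i) (j | j) h <;> simp only [f0, Sum.elim_inl, Sum.elim_inr] at h
    · have := congrArg Fin.val h
      simp [Fin.val_rev] at this
      congr 1; ext; omega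
    · have := congrArg Fin.val h
      simp [Fin.val_rev] at this
      omega
    · have := congrArg Fin.val h
      simp [Fin.val_rev] at this
      omega
    · have := congrArg Fin.val h
      simp at this
      congr 1; ext; omega
  let f : Fin J.card ⊕ Fin Jᶜ.card ≃ Fin m := Equiv.ofBijective f0
    ((Fintype.bijective_iff_injective_and_card f0).2 ⟨finj, by simp [hcard]⟩)
  set G := g.submatrix e f with hG
  set H := h.submatrix f e with hH
  have hGH : G * H = 1 := by
    rw [hG, hH, Matrix.submatrix_mul_equiv, hgh, Matrix.submatrix_one_equiv]
  have h1 : G * Matrix.fromBlocks H.toBlocks₁₁ 0 H.toBlocks₂₁ 1 = Matrix.fromBlocks 1 G.toBlocks₁₂ 0 G.toBlocks₂₂ := by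
    rw [← Matrix.fromBlocks_toBlocks G, ← Matrix.fromBlocks_toBlocks H, Matrix.fromBlocks_multiply, ← Matrix.fromBlocks_one,
      Matrix.fromBlocks_inj] at hGH
    conv_lhs => rw [← Matrix.fromBlocks_toBlocks G]
    rw [Matrix.fromBlocks_multiply, hGH.1, hGH.2.2.1]
    simp
  have h2 := congrArg Matrix.det h1
  rw [Matrix.det_mul, Matrix.det_fromBlocks_zero₁₂, Matrix.det_fromBlocks_zero₂₁, Matrix.det_one, Matrix.det_one, mul_one, one_mul] at h2
  have h3 : ∃ ε : ℤˣ, G.det = ((ε : ℤ) : R) := by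
    refine ⟨Equiv.Perm.sign (f.symm.trans e), ?_⟩
    have : G = ((g.submatrix (f.symm.trans e) id).submatrix f f) := by
      ext i j; simp [hG]
    rw [this, Matrix.det_submatrix_equiv_self, Matrix.det_permute, hg, mul_one]
  obtain ⟨ε, hε⟩ := h3
  refine ⟨ε, ?_⟩
  have e1 : (Matrix.of fun i j : Fin J.card => (h.submatrix Fin.rev id) (Fin.castLE hJ i) (J.orderEmbOfFin rfl j)) = H.toBlocks₁₁ := by
    ext i j; simp [hH, Matrix.toBlocks₁₁, e, f, f0]
  have e2 : (Matrix.of fun i j : Fin Jᶜ.card => gᵀ (Fin.castLE hJc i) (Jᶜ.orderEmbOfFin rfl j)) = G.toBlocks₂₂ᵀ := by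
    ext i j; simp [hG, Matrix.toBlocks₂₂, e, f, f0]
  rw [e1, e2, Matrix.det_transpose, ← h2, hε, ← mul_assoc]
  have : ((ε : ℤ) : R) * ((ε : ℤ) : R) = 1 := by
    rcases Int.units_eq_one_or ε with h | h <;> simp [h]
  rw [this, one_mul]

theorem conj_alt {A : Matrix (Fin m) (Fin m) R} (hA : AltM A) (N : Matrix (Fin m) (Fin m) R) : AltM (Nᵀ * A * N) := by
  have hb := bf_alt hA
  have hx : ∀ i j, (Nᵀ * A * N) i j = bf A (N.mulVecLin (Pi.single i 1)) (N.mulVecLin (Pi.single j 1)) := by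
    intro i j
    rw [← bf_ss (Nᵀ * A * N) i j, ← bf_conj]; rfl
  refine ⟨fun i => ?_, fun i j => ?_⟩
  · rw [hx]; exact hb _
  · rw [hx, hx]; exact (hb.neg_eq _ _).symm

theorem FF_emb (Z : Finset (Fin m)) (j : Fin Z.card) : FF Z (Z.orderEmbOfFin rfl j : Fin m) = j := by
  have : (Z.filter (fun i : Fin m => (i : ℕ) < (Z.orderEmbOfFin rfl j : Fin m))) =
      (Finset.univ.filter (fun i : Fin Z.card => i < j)).image (Z.orderEmbOfFin rfl) := by
    ext x
    simp only [Finset.mem_filter, Finset.mem_image, Finset.mem_univ, true_and]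
    constructor
    · rintro ⟨hx, hlt⟩
      have : x ∈ Set.range (Z.orderEmbOfFin rfl) := by rw [Finset.range_orderEmbOfFin]; exact hx
      obtain ⟨i, rfl⟩ := this
      exact ⟨i, by simpa using hlt, rfl⟩
    · rintro ⟨i, hi, rfl⟩
      exact ⟨Finset.orderEmbOfFin_mem _ _ _, by simpa using hi⟩
  rw [FF, this, Finset.card_image_of_injective _ (Z.orderEmbOfFin rfl).injective]
  rw [show (Finset.univ.filter (fun i : Fin Z.card => i < j)) = Finset.Iio j from by ext; simp, Fin.card_Iio]

theorem FF_le (Z : Finset (Fin m)) (x : ℕ) : FF Z x ≤ x :=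
  card_lt_le _ _ (fun _ hi => (Finset.mem_filter.1 hi).2)

theorem prod_emb {M : Type*} [CommMonoid M] (Z : Finset (Fin m)) (F : ℕ → ℕ → M) :
    ∏ j : Fin Z.card, F (Z.orderEmbOfFin rfl j : Fin m) j = ∏ i ∈ Z, F i (FF Z i) := by
  conv_rhs => rw [← Finset.image_orderEmbOfFin_univ Z rfl]
  rw [Finset.prod_image (fun _ _ _ _ h => (Z.orderEmbOfFin rfl).injective h)]
  refine Finset.prod_congr rfl fun j _ => ?_
  rw [Finset.image_orderEmbOfFin_univ, FF_emb]

end JacSec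

section SpecSec
open scoped Polynomial
variable {B : Type*} [CommRing B] {m : ℕ}

abbrev VV := (ℕ × ℕ) ⊕ (ℕ ⊕ ℕ)

def gG (B : Type*) [CommRing B] (i c : ℕ) : MvPolynomial VV B :=
  if c < i then MvPolynomial.X (Sum.inl (i, c)) else if c = i then 1 else 0

def gh (B : Type*) [CommRing B] (m : ℕ) : Matrix (Fin m) (Fin m) (MvPolynomial VV B)[X] :=
  Matrix.of fun i c => Polynomial.C (gG B i c) * Polynomial.X ^ (((i : ℕ) : ℤ) - (c : ℕ)).natAbs ^ 2

theorem gh_det : (gh B m).det = 1 := by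
  rw [Matrix.det_of_isLowerTriangular]
  · refine Finset.prod_eq_one fun i _ => ?_
    simp [gh, gG]
  · intro i j hij
    have : i < j := hij
    simp only [gh, gG, Matrix.of_apply]
    rw [if_neg (by omega), if_neg (by omega)]; simp

def EZ (Z : Finset (Fin m)) : VV →₀ ℕ :=
  ∑ i ∈ Z, if FF Z i < i then Finsupp.single (Sum.inl ((i : ℕ), FF Z i)) 1 else 0

def eZ (Z : Finset (Fin m)) : ℕ := ∑ j : Fin Z.card, ((((Z.orderEmbOfFin rfl j : Fin m) : ℕ) : ℤ) - (j : ℕ)).natAbs ^ 2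

theorem eZ_lt (Z : Finset (Fin m)) : eZ Z < m ^ 3 + 1 := by
  have hZ : Z.card ≤ m := by simpa using Finset.card_le_univ Z
  have : eZ Z ≤ ∑ j : Fin Z.card, m ^ 2 := by
    refine Finset.sum_le_sum fun j _ => ?_
    have := j.2
    have := (Z.orderEmbOfFin rfl j : Fin m).2
    exact Nat.pow_le_pow_left (by omega) 2
  simp at this
  nlinarith [Nat.mul_le_mul_right (m ^ 2) hZ]

theorem lead_minor (Z : Finset (Fin m)) (hZ : Z.card ≤ m) :
    Lead (Matrix.det (Matrix.of fun i j : Fin Z.card => (gh B m)ᵀ (Fin.castLE hZ i) (Z.orderEmbOfFin rfl j))) (eZ Z)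
      (monomial (EZ Z) (1 : B)) := by
  have h1 := lead_det (D := MvPolynomial VV B) (r := Z.card)
    (fun i j => gG B (Z.orderEmbOfFin rfl j : Fin m) i)
    (fun i j => ((((Z.orderEmbOfFin rfl j : Fin m) : ℕ) : ℤ) - (i : ℕ)).natAbs ^ 2)
    (fun p hp => rearr (fun j => ((Z.orderEmbOfFin rfl j : Fin m) : ℕ)) (fun i j hij => by simpa using hij) p hp)
  have h2 : ∏ j : Fin Z.card, gG B (Z.orderEmbOfFin rfl j : Fin m) j = monomial (EZ Z) (1 : B) := by
    rw [prod_emb Z (fun a b => gG B a b), EZ, MvPolynomial.monomial_sum_one]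
    refine Finset.prod_congr rfl fun i _ => ?_
    have := FF_le Z i
    unfold gG
    split_ifs
    · rfl
    · rfl
    · omega
  rw [h2] at h1
  exact h1

def LeadM (p : (MvPolynomial VV B)[X]) (d : ℕ) (E : VV →₀ ℕ) : Prop :=
  ∃ ε : B, IsUnit ε ∧ Lead p d (monomial E ε)

theorem LeadM.mul {p p' : (MvPolynomial VV B)[X]} {d d' : ℕ} {E E'} (h : LeadM p d E) (h' : LeadM p' d' E') :
    LeadM (p * p') (d + d') (E + E') := by
  obtain ⟨ε, hε, h⟩ := h
  obtain ⟨ε', hε', h'⟩ := h'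
  refine ⟨ε * ε', hε.mul hε', ?_⟩
  have := h.mul h'
  rwa [monomial_mul] at this

theorem LeadM.prod {ι : Type*} (s : Finset ι) (p : ι → (MvPolynomial VV B)[X]) (d : ι → ℕ) (E : ι → VV →₀ ℕ)
    (h : ∀ i ∈ s, LeadM (p i) (d i) (E i)) : LeadM (∏ i ∈ s, p i) (∑ i ∈ s, d i) (∑ i ∈ s, E i) := by
  classical
  induction s using Finset.induction_on with
  | empty => exact ⟨1, isUnit_one, by simpa using Lead.one⟩
  | insert a s ha ih =>
    rw [Finset.prod_insert ha, Finset.sum_insert ha, Finset.sum_insert ha]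
    exact (h a (Finset.mem_insert_self _ _)).mul (ih fun i hi => h i (Finset.mem_insert_of_mem hi))

def sT (B : Type*) [CommRing B] (k i : ℕ) : MvPolynomial VV B := if i < k then MvPolynomial.X (Sum.inr (Sum.inl i)) else 0
def sW (B : Type*) [CommRing B] (k i : ℕ) : MvPolynomial VV B := if i < k then MvPolynomial.X (Sum.inr (Sum.inr i)) else 0

def mT (B : Type*) [CommRing B] (m : ℕ) := dM (m ^ 3 + 1) (gh B m)ᵀ
def mW (B : Type*) [CommRing B] (m : ℕ) := dM (m ^ 3 + 1) ((gh B m).adjugate.submatrix Fin.rev id)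

def hT (B : Type*) [CommRing B] (m k : ℕ) : Matrix (Fin m) (Fin m) (MvPolynomial VV B)[X] :=
  (mT B m)ᵀ * bS m (fun i => Polynomial.C (sT B k i)) * mT B m
def hW (B : Type*) [CommRing B] (m k : ℕ) : Matrix (Fin m) (Fin m) (MvPolynomial VV B)[X] :=
  (mW B m)ᵀ * bS m (fun i => Polynomial.C (sW B k i)) * mW B m

theorem hT_alt (k) : AltM (hT B m k) := conj_alt (bS_alt _) _
theorem hW_alt (k) : AltM (hW B m k) := conj_alt (bS_alt _) _

theorem gh_mul : (gh B m) * (gh B m).adjugate = 1 := by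
  rw [Matrix.mul_adjugate, gh_det, one_smul]

theorem hTW {k l : ℕ} (hkl : 2 * k + 2 * l ≤ m) : hT B m k * hW B m l = 0 := by
  have hh : (gh B m).adjugate * (gh B m) = 1 := by
    rw [Matrix.adjugate_mul, gh_det, one_smul]
  have key : bS m (fun i => Polynomial.C (sT B k i)) * (mT B m * (mW B m)ᵀ) * bS m (fun i => Polynomial.C (sW B l i)) = 0 := by
    ext a d : 1
    rw [Matrix.mul_apply, Matrix.zero_apply]
    refine Finset.sum_eq_zero fun c _ => ?_
    rw [Matrix.mul_apply, Finset.sum_mul]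
    refine Finset.sum_eq_zero fun b _ => ?_
    by_cases hb : 2 * k ≤ b
    · rw [(bS_alt _).2 a b, bS_row (k := k) _ (fun i hi => by rw [sT, if_neg (by omega), map_zero]) hb]; simp
    by_cases hc : 2 * l ≤ c
    · rw [bS_row (k := l) _ (fun i hi => by rw [sW, if_neg (by omega), map_zero]) hc]; simp
    have : (mT B m * (mW B m)ᵀ) b c = 0 := by
      rw [Matrix.mul_apply]
      have h1 := congrFun (congrFun hh (Fin.rev c)) b
      rw [Matrix.mul_apply, Matrix.one_apply_ne (by
        intro h; have := congrArg Fin.val h; simp [Fin.val_rev] at this; omega)] at h1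
      calc _ = ∑ x, (Polynomial.X ^ ((m ^ 3 + 1) * (b : ℕ)) * Polynomial.X ^ ((m ^ 3 + 1) * (c : ℕ))) *
            ((gh B m).adjugate (Fin.rev c) x * gh B m x b) := by
            refine Finset.sum_congr rfl fun x _ => ?_
            simp only [mT, mW, dM, Matrix.transpose_apply, Matrix.submatrix_apply, id]
            ring
        _ = 0 := by rw [← Finset.mul_sum, h1, mul_zero]
    rw [this]; simp
  calc hT B m k * hW B m l = (mT B m)ᵀ * (bS m (fun i => Polynomial.C (sT B k i)) * (mT B m * (mW B m)ᵀ) * bS m (fun i => Polynomial.C (sW B l i))) * mW B m := by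
        simp only [hT, hW, Matrix.mul_assoc]
    _ = 0 := by rw [key]; simp

def dZ (Z : Finset (Fin m)) (e : ℕ) : ℕ := (m ^ 3 + 1) * (∑ j : Fin Z.card, (j : ℕ)) + e

def ETr (Z : Finset (Fin m)) : VV →₀ ℕ := EZ Z + ∑ i ∈ Finset.range (Z.card / 2), Finsupp.single (Sum.inr (Sum.inl i)) 1
def EWr (Z : Finset (Fin m)) : VV →₀ ℕ := EZ Zᶜ + ∑ i ∈ Finset.range (Z.card / 2), Finsupp.single (Sum.inr (Sum.inr i)) 1

theorem prod_sT {k u : ℕ} (h : u ≤ k) : ∏ i ∈ Finset.range u, sT B k i =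
    monomial (∑ i ∈ Finset.range u, Finsupp.single (Sum.inr (Sum.inl i)) 1) (1 : B) := by
  rw [MvPolynomial.monomial_sum_one]
  refine Finset.prod_congr rfl fun i hi => ?_
  rw [sT, if_pos (by simp at hi; omega)]; rfl

theorem prod_sW {k u : ℕ} (h : u ≤ k) : ∏ i ∈ Finset.range u, sW B k i =
    monomial (∑ i ∈ Finset.range u, Finsupp.single (Sum.inr (Sum.inr i)) 1) (1 : B) := by
  rw [MvPolynomial.monomial_sum_one]
  refine Finset.prod_congr rfl fun i hi => ?_
  rw [sW, if_pos (by simp at hi; omega)]; rfl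

theorem lead_hT {k : ℕ} {Z : Finset (Fin m)} (he : Even Z.card) (hk : Z.card ≤ 2 * k) :
    LeadM (tau (hT B m k) Z) (dZ Z (eZ Z)) (ETr Z) := by
  have hZ : Z.card ≤ m := by simpa using Finset.card_le_univ Z
  have h2 : Z.card = 2 * (Z.card / 2) := by rcases he with ⟨a, ha⟩; omega
  have := lead_tau (sT B k) (gh B m)ᵀ Z h2 hZ (eZ_lt Z) (lead_minor Z hZ)
  rw [prod_sT (by omega), monomial_mul] at this
  exact ⟨1 * 1, by simp, this⟩

theorem lead_hW {k : ℕ} {Z : Finset (Fin m)} (he : Even Z.card) (hk : Z.card ≤ 2 * k) :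
    LeadM (tau (hW B m k) Z) (dZ Z (eZ Zᶜ)) (EWr Z) := by
  have hZ : Z.card ≤ m := by simpa using Finset.card_le_univ Z
  have hZc : Zᶜ.card ≤ m := by simpa using Finset.card_le_univ Zᶜ
  have h2 : Z.card = 2 * (Z.card / 2) := by rcases he with ⟨a, ha⟩; omega
  obtain ⟨ε, hε⟩ := jacobi (gh B m) _ gh_mul gh_det Z hZ hZc
  have hl : Lead ((((ε : ℤ) : (MvPolynomial VV B)[X])) * Matrix.det (Matrix.of fun i j : Fin Zᶜ.card => (gh B m)ᵀ (Fin.castLE hZc i) (Zᶜ.orderEmbOfFin rfl j))) (eZ Zᶜ)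
      (monomial (EZ Zᶜ) ((ε : ℤ) : B)) := by
    have := (Lead.C ((MvPolynomial.C ((ε : ℤ) : B)) : MvPolynomial VV B)).mul (lead_minor (B := B) Zᶜ hZc)
    rw [zero_add, C_mul_monomial, mul_one] at this
    simpa using this
  rw [← hε] at hl
  have := lead_tau (sW B k) _ Z h2 hZ (eZ_lt Zᶜ) hl
  rw [prod_sW (by omega), monomial_mul] at this
  refine ⟨_, ?_, this⟩
  rw [mul_one]
  exact (ε.isUnit).map (Int.castRingHom B)

theorem big_hT {k : ℕ} {Z : Finset (Fin m)} (h : 2 * k < Z.card) : tau (hT B m k) Z = 0 :=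
  tau_big _ (fun i hi => by rw [sT, if_neg (by omega), map_zero]) _ _ h
theorem big_hW {k : ℕ} {Z : Finset (Fin m)} (h : 2 * k < Z.card) : tau (hW B m k) Z = 0 :=
  tau_big _ (fun i hi => by rw [sW, if_neg (by omega), map_zero]) _ _ h

def Eσ {n : ℕ} (σ : St m n) : VV →₀ ℕ := ∑ k, ETr (σ.1 k) + ∑ k, EWr (σ.2 k)
def dσ {n : ℕ} (σ : St m n) : ℕ := ∑ k, dZ (σ.1 k) (eZ (σ.1 k)) + ∑ k, dZ (σ.2 k) (eZ (σ.2 k)ᶜ)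

theorem lead_bst {n k l : ℕ} {σ : St m n} (hσ : Std σ) (h1 : ∀ i, (σ.1 i).card ≤ 2 * k) (h2 : ∀ i, (σ.2 i).card ≤ 2 * l) :
    LeadM (bst (hT B m k) (hW B m l) σ) (dσ σ) (Eσ σ) := by
  have a1 := LeadM.prod Finset.univ (fun i => tau (hT B m k) (σ.1 i)) (fun i => dZ (σ.1 i) (eZ (σ.1 i))) (fun i => ETr (σ.1 i))
    (fun i _ => lead_hT (hσ.1 i) (h1 i))
  have a2 := LeadM.prod Finset.univ (fun i => tau (hW B m l) (σ.2 i)) (fun i => dZ (σ.2 i) (eZ (σ.2 i)ᶜ)) (fun i => EWr (σ.2 i))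
    (fun i _ => lead_hW (hσ.2.1 i) (h2 i))
  exact a1.mul a2

theorem big_bst {n k l : ℕ} {σ : St m n} (h : ¬ ((∀ i, (σ.1 i).card ≤ 2 * k) ∧ (∀ i, (σ.2 i).card ≤ 2 * l))) :
    bst (hT B m k) (hW B m l) σ = 0 := by
  rw [not_and_or] at h
  push Not at h
  rw [bst]
  rcases h with ⟨i, hi⟩ | ⟨i, hi⟩
  · have h0 : ∏ j, tau (hT B m k) (σ.1 j) = 0 := Finset.prod_eq_zero (Finset.mem_univ i) (big_hT hi)
    rw [h0, zero_mul]
  · have h0 : ∏ j, tau (hW B m l) (σ.2 j) = 0 := Finset.prod_eq_zero (Finset.mem_univ i) (big_hW hi)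
    rw [h0, mul_zero]
end SpecSec

section InjSec
variable {m : ℕ}

theorem FF_zero (Z : Finset (Fin m)) : FF Z 0 = 0 := by simp [FF]

theorem FF_succ (Z : Finset (Fin m)) (i : Fin m) : FF Z ((i : ℕ) + 1) = FF Z i + if i ∈ Z then 1 else 0 := by
  unfold FF
  have : Z.filter (fun j : Fin m => (j : ℕ) < (i : ℕ) + 1) =
      (Z.filter (fun j : Fin m => (j : ℕ) < (i : ℕ))) ∪ (if i ∈ Z then {i} else ∅) := by
    ext j
    by_cases hi : i ∈ Z
    · simp only [hi, if_true, Finset.mem_filter, Finset.mem_union, Finset.mem_singleton]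
      constructor
      · rintro ⟨h1, h2⟩
        by_cases h : (j : ℕ) < i
        · exact Or.inl ⟨h1, h⟩
        · right; ext; omega
      · rintro (⟨h1, h2⟩ | rfl)
        · exact ⟨h1, by omega⟩
        · exact ⟨hi, by omega⟩
    · simp only [hi, if_false, Finset.mem_filter, Finset.union_empty]
      constructor
      · rintro ⟨h1, h2⟩
        refine ⟨h1, ?_⟩
        by_contra h
        apply hi
        rwa [show i = j from by ext; omega]
      · rintro ⟨h1, h2⟩
        exact ⟨h1, by omega⟩
  rw [this, Finset.card_union_of_disjoint]
  · split_ifs <;> simp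
  · split_ifs <;> simp

theorem FF_top (Z : Finset (Fin m)) : FF Z m = Z.card := by
  simp [FF]

theorem FF_compl (Z : Finset (Fin m)) : ∀ x ≤ m, FF Z x + FF Zᶜ x = x := by
  intro x
  induction x with
  | zero => intro _; simp [FF_zero]
  | succ x ih =>
    intro hx
    have h1 := FF_succ Z ⟨x, hx⟩
    have h2 := FF_succ Zᶜ ⟨x, hx⟩
    have := ih (by omega)
    simp only [Finset.mem_compl] at h1 h2
    split_ifs at h1 h2 <;> omega

theorem FF_inj {Z Z' : Finset (Fin m)} (h : ∀ x ≤ m, FF Z x = FF Z' x) : Z = Z' := by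
  ext i
  have h1 := FF_succ Z i
  have h2 := FF_succ Z' i
  rw [h ((i : ℕ) + 1) i.2, h _ i.2.le] at h1
  by_cases a : i ∈ Z <;> by_cases b : i ∈ Z' <;> simp only [a, b, if_true, if_false] at h1 h2 ⊢ <;> omega

def ind (Z : Finset (Fin m)) (x c : ℕ) : ℕ := if c < FF Z x then 1 else 0

theorem EZ_inl (Z : Finset (Fin m)) (i : Fin m) {c : ℕ} (hc : c < i) :
    EZ Z (Sum.inl ((i : ℕ), c)) = if i ∈ Z ∧ FF Z i = c then 1 else 0 := by
  classical
  rw [EZ, Finsupp.finsetSum_apply]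
  have : ∀ j ∈ Z, (if FF Z j < j then Finsupp.single (Sum.inl ((j : ℕ), FF Z j) : VV) 1 else 0) (Sum.inl ((i : ℕ), c)) =
      if j = i then (if FF Z i = c then 1 else 0) else 0 := by
    intro j _
    by_cases hji : j = i
    · subst hji
      by_cases h : FF Z j = c
      · simp [h, hc]
      · rw [if_pos rfl, if_neg h]
        split_ifs
        · rw [Finsupp.single_eq_of_ne]
          intro h'; apply h; simpa using h'.symm
        · rfl
    · rw [if_neg hji]
      split_ifs
      · rw [Finsupp.single_eq_of_ne]
        intro h'; apply hji
        simp only [Sum.inl.injEq, Prod.mk.injEq] at h'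
        exact Fin.ext h'.1.symm
      · rfl
  rw [Finset.sum_congr rfl this, Finset.sum_ite_eq' Z i]
  by_cases hi : i ∈ Z <;> simp [hi]

theorem EZ_inr (Z : Finset (Fin m)) (a : ℕ ⊕ ℕ) : EZ Z (Sum.inr a) = 0 := by
  rw [EZ, Finsupp.finsetSum_apply]
  refine Finset.sum_eq_zero fun j _ => ?_
  split_ifs
  · rw [Finsupp.single_eq_of_ne]; simp
  · rfl

theorem ind_succ (Z : Finset (Fin m)) (i : Fin m) {c : ℕ} (hc : c < i) :
    ind Z ((i : ℕ) + 1) c = ind Z i c + EZ Z (Sum.inl ((i : ℕ), c)) := by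
  rw [EZ_inl Z i hc, ind, ind, FF_succ]
  by_cases hi : i ∈ Z
  · simp only [hi, if_true, true_and]
    split_ifs <;> omega
  · simp [hi]

theorem ETr_inl (Z : Finset (Fin m)) (a) : ETr Z (Sum.inl a) = EZ Z (Sum.inl a) := by
  rw [ETr, Finsupp.add_apply, Finsupp.finsetSum_apply, Finset.sum_eq_zero, add_zero]
  intro i _; rw [Finsupp.single_eq_of_ne]; simp
theorem EWr_inl (Z : Finset (Fin m)) (a) : EWr Z (Sum.inl a) = EZ Zᶜ (Sum.inl a) := by
  rw [EWr, Finsupp.add_apply, Finsupp.finsetSum_apply, Finset.sum_eq_zero, add_zero]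
  intro i _; rw [Finsupp.single_eq_of_ne]; simp
theorem ETr_inrr (Z : Finset (Fin m)) (a) : ETr Z (Sum.inr (Sum.inr a)) = 0 := by
  rw [ETr, Finsupp.add_apply, Finsupp.finsetSum_apply, Finset.sum_eq_zero, add_zero, EZ_inr]
  intro i _; rw [Finsupp.single_eq_of_ne]; simp
theorem EWr_inrl (Z : Finset (Fin m)) (a) : EWr Z (Sum.inr (Sum.inl a)) = 0 := by
  rw [EWr, Finsupp.add_apply, Finsupp.finsetSum_apply, Finset.sum_eq_zero, add_zero, EZ_inr]
  intro i _; rw [Finsupp.single_eq_of_ne]; simp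
theorem ETr_inrl (Z : Finset (Fin m)) (a) : ETr Z (Sum.inr (Sum.inl a)) = if a < Z.card / 2 then 1 else 0 := by
  rw [ETr, Finsupp.add_apply, Finsupp.finsetSum_apply, EZ_inr, zero_add]
  rw [Finset.sum_congr rfl (g := fun i => if a = i then 1 else 0), Finset.sum_ite_eq]
  · simp
  · intro i _
    by_cases h : a = i
    · simp [h]
    · rw [if_neg h, Finsupp.single_eq_of_ne]; simpa using h
theorem EWr_inrr (Z : Finset (Fin m)) (a) : EWr Z (Sum.inr (Sum.inr a)) = if a < Z.card / 2 then 1 else 0 := by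
  rw [EWr, Finsupp.add_apply, Finsupp.finsetSum_apply, EZ_inr, zero_add]
  rw [Finset.sum_congr rfl (g := fun i => if a = i then 1 else 0), Finset.sum_ite_eq]
  · simp
  · intro i _
    by_cases h : a = i
    · simp [h]
    · rw [if_neg h, Finsupp.single_eq_of_ne]; simpa using h

def NN {n : ℕ} (σ : St m n) (x c : ℕ) : ℕ := ∑ k, ind (σ.1 k) x c + ∑ k, ind (σ.2 k)ᶜ x c

theorem Eσ_apply {n : ℕ} (σ : St m n) (v : VV) : Eσ σ v = ∑ k, ETr (σ.1 k) v + ∑ k, EWr (σ.2 k) v := by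
  rw [Eσ, Finsupp.add_apply, Finsupp.finsetSum_apply, Finsupp.finsetSum_apply]

theorem NN_succ {n : ℕ} (σ : St m n) (i : Fin m) {c : ℕ} (hc : c < i) :
    NN σ ((i : ℕ) + 1) c = NN σ i c + Eσ σ (Sum.inl ((i : ℕ), c)) := by
  rw [Eσ_apply]
  simp only [NN, ETr_inl, EWr_inl, ind_succ _ i hc, Finset.sum_add_distrib]
  ring

theorem ind_zero (Z : Finset (Fin m)) {x c : ℕ} (h : x ≤ c) : ind Z x c = 0 := by
  rw [ind, if_neg]; have := FF_le Z x; omega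

theorem NN_zero {n : ℕ} (σ : St m n) {x c : ℕ} (h : x ≤ c) : NN σ x c = 0 := by
  simp [NN, ind_zero _ h]

theorem NN_top {n : ℕ} {σ : St m n} (hσ : Std σ) {c : ℕ} (hc : c < m) :
    NN σ m c + Eσ σ (Sum.inr (Sum.inr ((m - c - 1) / 2))) = Eσ σ (Sum.inr (Sum.inl (c / 2))) + n := by
  rw [Eσ_apply, Eσ_apply]
  simp only [NN, ETr_inrl, EWr_inrr, ETr_inrr, EWr_inrl, Finset.sum_const_zero, zero_add, add_zero]
  rw [add_assoc, ← Finset.sum_add_distrib]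
  congr 1
  · refine Finset.sum_congr rfl fun k _ => ?_
    obtain ⟨a, ha⟩ := hσ.1 k
    rw [ind, FF_top]
    split_ifs <;> omega
  · rw [Finset.sum_congr rfl (g := fun _ => 1)]
    · simp
    · intro k _
      obtain ⟨a, ha⟩ := hσ.2.1 k
      have h1 := Finset.card_add_card_compl (σ.2 k)
      rw [Fintype.card_fin] at h1
      rw [ind, FF_top]
      split_ifs <;> omega

theorem NN_eq {n : ℕ} {σ σ' : St m n} (hσ : Std σ) (hσ' : Std σ') (hE : Eσ σ = Eσ σ') :
    ∀ d x c, x + d = m → NN σ x c = NN σ' x c := by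
  intro d
  induction d with
  | zero =>
    intro x c hx
    obtain rfl : x = m := by omega
    by_cases hc : c < x
    · have h1 := NN_top hσ hc
      have h2 := NN_top hσ' hc
      rw [hE] at h1
      omega
    · rw [NN_zero _ (by omega), NN_zero _ (by omega)]
  | succ d ih =>
    intro x c hx
    by_cases hc : c < x
    · have h1 := NN_succ σ ⟨x, by omega⟩ hc
      have h2 := NN_succ σ' ⟨x, by omega⟩ hc
      have := ih (x + 1) c (by omega)
      rw [hE] at h1
      simp only at h1 h2
      omega
    · rw [NN_zero _ (by omega), NN_zero _ (by omega)]

theorem cnt {n : ℕ} {a b : Fin n → ℕ} (ha : Antitone a) (hb : Monotone b) (hab : ∀ k l, a k ≤ b l) (c : ℕ) :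
    (∀ k, c < a k ↔ n + k + 1 ≤ ∑ k, (if c < a k then 1 else 0) + ∑ k, (if c < b k then 1 else 0)) ∧
    (∀ l : Fin n, c < b l ↔ n - l ≤ ∑ k, (if c < a k then 1 else 0) + ∑ k, (if c < b k then 1 else 0)) := by
  simp only [← Finset.card_filter]
  have ub : (Finset.univ.filter (fun k : Fin n => c < b k)).card ≤ n := by
    simpa using Finset.card_le_univ (Finset.univ.filter (fun k : Fin n => c < b k))
  refine ⟨fun k => ⟨fun h => ?_, fun h => ?_⟩, fun l => ⟨fun h => ?_, fun h => ?_⟩⟩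
  · have h1 := Finset.card_le_card (s := Finset.Iic k) (t := Finset.univ.filter (fun k : Fin n => c < a k))
      (fun j hj => by
        simp only [Finset.mem_filter, Finset.mem_univ, true_and]
        exact lt_of_lt_of_le h (ha (Finset.mem_Iic.1 hj)))
    have h2 : (Finset.univ.filter (fun k : Fin n => c < b k)) = Finset.univ := by
      ext j; simp only [Finset.mem_filter, Finset.mem_univ, true_and, iff_true]
      exact lt_of_lt_of_le h (hab k j)
    rw [h2]
    simp only [Fin.card_Iic, Finset.card_univ, Fintype.card_fin] at h1 ⊢
    omega
  · by_contra hn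
    have h1 := Finset.card_le_card (t := Finset.Iio k) (s := Finset.univ.filter (fun k : Fin n => c < a k))
      (fun j hj => by
        simp only [Finset.mem_filter, Finset.mem_univ, true_and] at hj
        rw [Finset.mem_Iio]
        by_contra hjk
        have := ha (not_lt.1 hjk)
        omega)
    simp only [Fin.card_Iio] at h1
    omega
  · have h1 := Finset.card_le_card (s := Finset.Ici l) (t := Finset.univ.filter (fun k : Fin n => c < b k))
      (fun j hj => by
        simp only [Finset.mem_filter, Finset.mem_univ, true_and]
        exact lt_of_lt_of_le h (hb (Finset.mem_Ici.1 hj)))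
    simp only [Fin.card_Ici] at h1
    omega
  · by_contra hn
    have h1 := Finset.card_le_card (t := Finset.Ioi l) (s := Finset.univ.filter (fun k : Fin n => c < b k))
      (fun j hj => by
        simp only [Finset.mem_filter, Finset.mem_univ, true_and] at hj
        rw [Finset.mem_Ioi]
        by_contra hjk
        have := hb (not_lt.1 hjk)
        omega)
    have h2 : (Finset.univ.filter (fun k : Fin n => c < a k)) = ∅ := by
      ext j; simp only [Finset.mem_filter, Finset.mem_univ, true_and]
      have := hab j l
      simp; omega
    rw [h2] at h
    simp only [Fin.card_Ioi, Finset.card_empty] at h1 h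
    have := l.2
    omega

theorem Eσ_inj {n : ℕ} {σ σ' : St m n} (hσ : Std σ) (hσ' : Std σ') (hE : Eσ σ = Eσ σ') : σ = σ' := by
  have key : ∀ τ : St m n, Std τ → ∀ x ≤ m, ∀ c,
      (∀ k, c < FF (τ.1 k) x ↔ n + k + 1 ≤ NN τ x c) ∧ (∀ l : Fin n, c < FF (τ.2 l)ᶜ x ↔ n - l ≤ NN τ x c) := by
    intro τ hτ x hx c
    have hc := fun l => FF_compl (τ.2 l) x hx
    refine cnt (a := fun k => FF (τ.1 k) x) (b := fun l => FF (τ.2 l)ᶜ x) (fun k l hkl => hτ.2.2.1 k l hkl x)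
      (fun k l hkl => ?_) (fun k l => ?_) c
    · have := hτ.2.2.2.1 k l hkl x
      have := hc k
      have := hc l
      show FF (τ.2 k)ᶜ x ≤ FF (τ.2 l)ᶜ x
      omega
    · have := hτ.2.2.2.2 k l x
      have := hc l
      show FF (τ.1 k) x ≤ FF (τ.2 l)ᶜ x
      omega
  have hN : ∀ x ≤ m, ∀ c, NN σ x c = NN σ' x c := fun x hx c => NN_eq hσ hσ' hE (m - x) x c (by omega)
  refine Prod.ext (funext fun k => FF_inj fun x hx => ?_) (funext fun k => compl_injective (FF_inj fun x hx => ?_))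
  · refine eq_of_forall_lt_iff fun c => ?_
    rw [(key σ hσ x hx c).1, (key σ' hσ' x hx c).1, hN x hx]
  · refine eq_of_forall_lt_iff fun c => ?_
    rw [(key σ hσ x hx c).2, (key σ' hσ' x hx c).2, hN x hx]
end InjSec

section FinSec
open scoped Polynomial
variable {B : Type*} [CommRing B] {m : ℕ}

theorem rel_alt {R : Type*} [CommRing R] (h2 : IsUnit (2 : R)) (A : Matrix (Fin m) (Fin m) R) (h : ∀ i j, A i j + A j i = 0) : AltM A := by
  refine ⟨fun i => ?_, fun i j => eq_neg_of_add_eq_zero_left (h i j)⟩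
  have := h i i
  rw [← two_mul] at this
  exact (h2.mul_right_eq_zero).1 this

def qT (B : Type*) [CommRing B] (m : ℕ) : Matrix (Fin m) (Fin m) (MvPolynomial (MatVars m) B ⧸ relIdeal B m) :=
  (Tmat B m).map (Ideal.Quotient.mk _)
def qW (B : Type*) [CommRing B] (m : ℕ) : Matrix (Fin m) (Fin m) (MvPolynomial (MatVars m) B ⧸ relIdeal B m) :=
  (Wmat B m).map (Ideal.Quotient.mk _)

theorem q2 [Invertible (2 : B)] : IsUnit (2 : MvPolynomial (MatVars m) B ⧸ relIdeal B m) := by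
  have := (isUnit_of_invertible (2 : B)).map (algebraMap B (MvPolynomial (MatVars m) B ⧸ relIdeal B m))
  rwa [map_ofNat] at this

theorem qT_alt [Invertible (2 : B)] : AltM (qT B m) := by
  refine rel_alt q2 _ fun i j => ?_
  have : (Tmat B m + (Tmat B m)ᵀ) i j ∈ relIdeal B m :=
    Ideal.subset_span (Or.inl (Or.inr ⟨(i, j), rfl⟩))
  have := Ideal.Quotient.eq_zero_iff_mem.2 this
  simpa [qT] using this

theorem qW_alt [Invertible (2 : B)] : AltM (qW B m) := by
  refine rel_alt q2 _ fun i j => ?_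
  have : (Wmat B m + (Wmat B m)ᵀ) i j ∈ relIdeal B m :=
    Ideal.subset_span (Or.inl (Or.inl ⟨(i, j), rfl⟩))
  have := Ideal.Quotient.eq_zero_iff_mem.2 this
  simpa [qW] using this

theorem qTW : qT B m * qW B m = 0 := by
  have h1 : qT B m * qW B m = (Tmat B m * Wmat B m).map (Ideal.Quotient.mk (relIdeal B m)) := by
    rw [Matrix.map_mul]; rfl
  rw [h1]
  ext i j : 1
  exact Ideal.Quotient.eq_zero_iff_mem.2 (Ideal.subset_span (Or.inr ⟨(i, j), rfl⟩))

theorem exists_phi {S : Type*} [CommRing S] [Algebra B S] {T W : Matrix (Fin m) (Fin m) S} (hT : AltM T) (hW : AltM W) (hTW : T * W = 0) :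
    ∃ φ : (MvPolynomial (MatVars m) B ⧸ relIdeal B m) →ₐ[B] S, (qT B m).map φ = T ∧ (qW B m).map φ = W := by
  let f : MvPolynomial (MatVars m) B →ₐ[B] S := aeval (Sum.elim (fun p => T p.1 p.2) (fun p => W p.1 p.2))
  have fT : (Tmat B m).map f = T := by ext i j; simp [Tmat, f]
  have fW : (Wmat B m).map f = W := by ext i j; simp [Wmat, f]
  have fT' : ∀ i j, f (Tmat B m i j) = T i j := fun i j => congrFun (congrFun fT i) j
  have fW' : ∀ i j, f (Wmat B m i j) = W i j := fun i j => congrFun (congrFun fW i) j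
  have hI : ∀ a ∈ relIdeal B m, f a = 0 := by
    intro a ha
    have : relIdeal B m ≤ RingHom.ker f := by
      rw [relIdeal, Ideal.span_le]
      rintro _ ((⟨⟨i, j⟩, rfl⟩ | ⟨⟨i, j⟩, rfl⟩) | ⟨⟨i, j⟩, rfl⟩)
      · simp only [SetLike.mem_coe, RingHom.mem_ker, Matrix.add_apply, Matrix.transpose_apply, map_add, fW']
        rw [hW.2 i j]; simp
      · simp only [SetLike.mem_coe, RingHom.mem_ker, Matrix.add_apply, Matrix.transpose_apply, map_add, fT']
        rw [hT.2 i j]; simp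
      · simp only [SetLike.mem_coe, RingHom.mem_ker]
        have h1 : f ((Tmat B m * Wmat B m) i j) = (T * W) i j := by
          simp only [Matrix.mul_apply, map_sum, map_mul, fT', fW']
        rw [h1, hTW]; rfl
    exact this ha
  refine ⟨Ideal.Quotient.liftₐ _ f hI, ?_, ?_⟩
  · ext i j
    exact fT' i j
  · ext i j
    exact fW' i j

theorem bst_map {S S' : Type*} [CommRing S] [CommRing S'] {T W : Matrix (Fin m) (Fin m) S} (hT : AltM T) (hW : AltM W) (f : S →+* S')
    {n : ℕ} (σ : St m n) : f (bst T W σ) = bst (T.map f) (W.map f) σ := by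
  simp only [bst, map_mul, map_prod, tau_map hT, tau_map hW]

theorem main_red (B : Type*) [CommRing B] [IsReduced B] [Invertible (2 : B)] (m : ℕ) (hm : Even m) :
    IsReduced (MvPolynomial (MatVars m) B ⧸ relIdeal B m) := by
  classical
  refine ⟨fun z hz => ?_⟩
  obtain ⟨p, rfl⟩ := Ideal.Quotient.mk_surjective z
  obtain ⟨n, c, hc, hp⟩ := exists_std (qT_alt (B := B) (m := m)) qW_alt qTW q2 (Ideal.Quotient.mkₐ B (relIdeal B m))
    (fun i j => rfl) (fun i j => rfl) p
  rw [Ideal.Quotient.mkₐ_eq_mk] at hp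
  suffices h : ∀ σ, c σ = 0 by rw [hp]; simp [h]
  by_contra hne
  push Not at hne
  obtain ⟨σ0, h0⟩ := hne
  have s0 := hc σ0 h0
  -- choose the component
  obtain ⟨k, l, hkl, hk, hl⟩ : ∃ k l, 2 * k + 2 * l ≤ m ∧ (∀ i, (σ0.1 i).card ≤ 2 * k) ∧ (∀ i, (σ0.2 i).card ≤ 2 * l) := by
    obtain ⟨M, hM⟩ := hm
    have hle : ∀ i j, (σ0.1 i).card + (σ0.2 j).card ≤ m := by
      intro i j
      have := s0.2.2.2.2 i j m
      rwa [FF_top, FF_top] at this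
    set K := Finset.univ.sup (fun i => (σ0.1 i).card / 2) with hK
    have hK1 : ∀ i, (σ0.1 i).card / 2 ≤ K := fun i => Finset.le_sup (f := fun i => (σ0.1 i).card / 2) (Finset.mem_univ i)
    have hKm : K ≤ M := by
      refine Finset.sup_le fun i _ => ?_
      have := hle i i
      omega
    refine ⟨K, M - K, by omega, fun i => ?_, fun j => ?_⟩
    · obtain ⟨a, ha⟩ := s0.1 i
      have := hK1 i
      omega
    · have : K ≤ M - (σ0.2 j).card / 2 := by
        refine Finset.sup_le fun i _ => ?_
        have := hle i j
        obtain ⟨a, ha⟩ := s0.1 i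
        obtain ⟨b, hb⟩ := s0.2.1 j
        omega
      have := hle j j
      obtain ⟨b, hb⟩ := s0.2.1 j
      omega
  obtain ⟨φ, φT, φW⟩ := exists_phi (B := B) (hT_alt (B := B) (m := m) k) (hW_alt l) (hTW hkl)
  have hφ : φ (Ideal.Quotient.mk _ p) = 0 := by
    have h1 := Polynomial.isNilpotent_iff.1 (hz.map φ)
    ext1 i
    rw [(h1 i).eq_zero, Polynomial.coeff_zero]
  have hb : ∀ σ : St m n, φ (bst (qT B m) (qW B m) σ) = bst (hT B m k) (hW B m l) σ := by
    intro σ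
    have h1 := bst_map qT_alt qW_alt (φ : (MvPolynomial (MatVars m) B ⧸ relIdeal B m) →+* (MvPolynomial VV B)[X]) σ
    have h2 : (qT B m).map (φ : (MvPolynomial (MatVars m) B ⧸ relIdeal B m) →+* (MvPolynomial VV B)[X]) = hT B m k := φT
    have h3 : (qW B m).map (φ : (MvPolynomial (MatVars m) B ⧸ relIdeal B m) →+* (MvPolynomial VV B)[X]) = hW B m l := φW
    rw [h2, h3] at h1
    exact h1
  rw [hp, map_sum] at hφ
  simp only [map_smul, hb] at hφ
  set adm := Finset.univ.filter (fun σ : St m n => c σ ≠ 0 ∧ (∀ i, (σ.1 i).card ≤ 2 * k) ∧ (∀ i, (σ.2 i).card ≤ 2 * l)) with hadm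
  have hne : adm.Nonempty := ⟨σ0, by simp only [hadm, Finset.mem_filter, Finset.mem_univ, true_and]; exact ⟨h0, hk, hl⟩⟩
  obtain ⟨σ1, h1, hmin⟩ := Finset.exists_min_image adm dσ hne
  have h1' := (Finset.mem_filter.1 h1).2
  have hco := congrArg (fun q : (MvPolynomial VV B)[X] => MvPolynomial.coeff (Eσ σ1) (q.coeff (dσ σ1))) hφ
  simp only [Polynomial.finsetSum_coeff, MvPolynomial.coeff_sum, Polynomial.coeff_smul, MvPolynomial.coeff_smul, Polynomial.coeff_zero,
    MvPolynomial.coeff_zero] at hco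
  rw [Finset.sum_eq_single σ1] at hco
  · obtain ⟨ε, hε, hl⟩ := lead_bst (B := B) (hc σ1 h1'.1) h1'.2.1 h1'.2.2
    rw [hl.coeff, MvPolynomial.coeff_monomial, if_pos rfl, smul_eq_mul] at hco
    exact h1'.1 ((hε.mul_left_eq_zero).1 hco)
  · intro σ _ hσ
    by_cases hcσ : c σ = 0
    · rw [hcσ, zero_smul]
    by_cases had : (∀ i, (σ.1 i).card ≤ 2 * k) ∧ (∀ i, (σ.2 i).card ≤ 2 * l)
    · obtain ⟨ε, hε, hl⟩ := lead_bst (B := B) (hc σ hcσ) had.1 had.2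
      have hle := hmin σ (Finset.mem_filter.2 ⟨Finset.mem_univ _, hcσ, had⟩)
      rcases hle.lt_or_eq with hlt | heq
      · rw [hl.coeff_lt hlt]; simp
      · rw [heq, hl.coeff, MvPolynomial.coeff_monomial, if_neg, smul_zero]
        intro hE
        exact hσ (Eσ_inj (hc σ hcσ) (hc σ1 h1'.1) hE)
    · rw [big_bst had]; simp
  · intro h; exact absurd (Finset.mem_univ _) h

end FinSec

/-- Lemma 5.2 of the paper. -/
theorem statement0 (B : Type*) [CommRing B] [IsReduced B] [Invertible (2 : B)]
    (m : ℕ) (hm_pos : 0 < m) (hm_even : Even m) :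
    IsReduced (MvPolynomial (MatVars m) B ⧸ relIdeal B m) := by
  exact main_red B m hm_even

end
end

section
/- Let k be a field of characteristic ≠ 2, n a positive integer, and let T, W ∈ M_n(k) be skew-symmetric matrices (Tᵀ = −T, Wᵀ = −W) with T·W = 0. Then rank T and rank W are even, say rank T = 2a and rank W = 2b, one has 2a + 2b ≤ n, and there exists u ∈ GL_n(k) such that u·T·uᵀ = J_{2a} ⊕ 0_{n−2a} and (uᵀ)⁻¹·W·u⁻¹ = 0_{2a} ⊕ J_{2b} ⊕ 0_{n−2a−2b}. -/
open Matrix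

noncomputable section

/-- The `n × n` matrix which is zero except for a copy of the standard nondegenerate
skew-symmetric matrix `J_{2c} = [[0, I_c], [−I_c, 0]]` occupying the rows and columns
with indices `off, off+1, …, off+2c−1`.  So `offsetJ k n 0 a = J_{2a} ⊕ 0_{n−2a}` and
`offsetJ k n (2a) b = 0_{2a} ⊕ J_{2b} ⊕ 0_{n−2a−2b}`. -/
def offsetJ (k : Type*) [Field k] (n off c : ℕ) : Matrix (Fin n) (Fin n) k :=
  Matrix.of fun i j =>
    if off ≤ i.val ∧ i.val < off + c ∧ j.val = i.val + c then 1
    else if off ≤ j.val ∧ j.val < off + c ∧ i.val = j.val + c then -1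
    else 0

/-- Congruence of matrices over possibly different index types. -/
def CongTo {k : Type*} [Field k] {ι κ : Type} [Fintype ι] [Fintype κ] [DecidableEq ι]
    [DecidableEq κ] (M : Matrix ι ι k) (N : Matrix κ κ k) : Prop :=
  ∃ (U : Matrix κ ι k) (V : Matrix ι κ k), U * V = 1 ∧ V * U = 1 ∧ U * M * Uᵀ = N

section aux
variable {k : Type*} [Field k] {ι κ l m : Type} [Fintype ι] [Fintype κ] [DecidableEq ι]
    [DecidableEq κ] [Fintype l] [DecidableEq l] [Fintype m] [DecidableEq m]

theorem CongTo.trans {M : Matrix ι ι k} {N : Matrix κ κ k} {L : Matrix l l k}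
    (h1 : CongTo M N) (h2 : CongTo N L) : CongTo M L := by
  obtain ⟨U, V, h, h', rfl⟩ := h1
  obtain ⟨U2, V2, g, g', rfl⟩ := h2
  refine ⟨U2 * U, V * V2, ?_, ?_, ?_⟩
  · calc U2 * U * (V * V2) = U2 * (U * V) * V2 := by simp only [Matrix.mul_assoc]
      _ = 1 := by rw [h, Matrix.mul_one, g]
  · calc V * V2 * (U2 * U) = V * (V2 * U2) * U := by simp only [Matrix.mul_assoc]
      _ = 1 := by rw [g', Matrix.mul_one, h']
  · simp only [Matrix.transpose_mul, Matrix.mul_assoc]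

theorem CongTo.reindex (M : Matrix ι ι k) (e : κ ≃ ι) : CongTo M (M.submatrix e e) := by
  refine ⟨(1 : Matrix ι ι k).submatrix e id, (1 : Matrix ι ι k).submatrix id e, ?_, ?_, ?_⟩
  · ext i j; simp [Matrix.mul_apply, Matrix.one_apply]
  · rw [Matrix.submatrix_mul_equiv]; simp
  · ext i j; simp [Matrix.mul_apply, Matrix.one_apply]

theorem CongTo.block (A : Matrix l l k) {D : Matrix ι ι k} {D' : Matrix κ κ k}
    (h : CongTo D D') : CongTo (fromBlocks A 0 0 D) (fromBlocks A 0 0 D') := by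
  obtain ⟨U, V, h, h', rfl⟩ := h
  refine ⟨fromBlocks 1 0 0 U, fromBlocks 1 0 0 V, ?_, ?_, ?_⟩
  · simp [fromBlocks_multiply, h, fromBlocks_one]
  · simp [fromBlocks_multiply, h', fromBlocks_one]
  · simp [fromBlocks_multiply, fromBlocks_transpose]

theorem CongTo.schur (A C S S' A' : Matrix l l k) (B : Matrix l ι k) (D : Matrix ι ι k)
    (hAC : A * C = 1) (hCA : C * A = 1) (hC : Cᵀ = -C)
    (hS : S * S' = 1) (hS' : S' * S = 1) (hA' : S * A * Sᵀ = A') :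
    CongTo (fromBlocks A B (-Bᵀ) D) (fromBlocks A' 0 0 (Bᵀ * C * B + D)) := by
  refine ⟨fromBlocks S 0 (Bᵀ * C) 1, fromBlocks S' 0 (-(Bᵀ * C * S')) 1, ?_, ?_, ?_⟩
  · simp [fromBlocks_multiply, hS, fromBlocks_one]
  · simp [fromBlocks_multiply, hS', fromBlocks_one, Matrix.mul_assoc]
  · have h1 : S * (A * (C * B)) = S * B := by
      rw [← Matrix.mul_assoc A, hAC, Matrix.one_mul]
    simp [fromBlocks_multiply, fromBlocks_transpose, hC, hA', Matrix.mul_assoc, hCA, h1]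

theorem skew_normal (hchar : (2 : k) ≠ 0) : ∀ (n : ℕ) (ι : Type) [Fintype ι] [DecidableEq ι]
    (_ : Fintype.card ι = n) (M : Matrix ι ι k) (_ : Mᵀ = -M),
    ∃ (α ρ : Type) (_ : Fintype α) (_ : Fintype ρ) (_ : DecidableEq α) (_ : DecidableEq ρ),
      CongTo M (fromBlocks (Matrix.J α k) 0 0 (0 : Matrix ρ ρ k)) := by
  intro n
  induction n using Nat.strong_induction_on with
  | _ n ih =>
  intro ι _ _ hn M hM
  have hsk : ∀ i j, M i j = - M j i := fun i j => by
    have := congrFun (congrFun hM j) i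
    simpa using this
  have hdiag : ∀ i, M i i = 0 := fun i => by
    have h2 : 2 * M i i = 0 := by linear_combination hsk i i
    exact (mul_eq_zero.mp h2).resolve_left hchar
  by_cases hM0 : M = 0
  · subst hM0
    refine ⟨Empty, ι, inferInstance, inferInstance, inferInstance, inferInstance, ?_⟩
    convert CongTo.reindex (0 : Matrix ι ι k) (Equiv.sumCongr (Equiv.equivOfIsEmpty (Empty ⊕ Empty) Empty) (Equiv.refl ι) |>.trans (Equiv.emptySum Empty ι)) using 1
    ext (i | i) (j | j)
    · exact i.elim Empty.elim Empty.elim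
    · exact i.elim Empty.elim Empty.elim
    · exact j.elim Empty.elim Empty.elim
    · simp
  · obtain ⟨i, j, hij⟩ : ∃ i j, M i j ≠ 0 := by
      by_contra! h
      exact hM0 (by ext i j; exact h i j)
    have hne : i ≠ j := fun h => hij (by rw [h, hdiag])
    let κ := {x : ι // ¬ (x = i ∨ x = j)}
    let f : (Unit ⊕ Unit) ⊕ κ → ι := Sum.elim (Sum.elim (fun _ => i) (fun _ => j)) (fun x => x.1)
    have hf : Function.Bijective f := by
      constructor
      · rintro ((x | x) | ⟨x, hx⟩) ((y | y) | ⟨y, hy⟩) h <;> simp [f] at h ⊢ <;> grind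
      · intro x
        by_cases h1 : x = i
        · exact ⟨.inl (.inl ()), by simp [f, h1]⟩
        by_cases h2 : x = j
        · exact ⟨.inl (.inr ()), by simp [f, h2]⟩
        exact ⟨.inr ⟨x, by simp [h1, h2]⟩, by simp [f]⟩
    let e := Equiv.ofBijective f hf
    set c := M i j with hc
    have hcard : Fintype.card κ < n := by
      have := Fintype.card_congr e
      simp at this
      omega
    let B : Matrix (Unit ⊕ Unit) κ k := M.submatrix (Sum.elim (fun _ => i) (fun _ => j)) (fun x => x.1)
    let D : Matrix κ κ k := M.submatrix (fun x => x.1) (fun x => x.1)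
    let A : Matrix (Unit ⊕ Unit) (Unit ⊕ Unit) k := (-c) • Matrix.J Unit k
    let C : Matrix (Unit ⊕ Unit) (Unit ⊕ Unit) k := c⁻¹ • Matrix.J Unit k
    have e1 : M.submatrix e e = fromBlocks A B (-Bᵀ) D := by
      ext ((x | x) | x) ((y | y) | y) <;>
        simp [e, f, A, B, D, Matrix.J, hdiag, ← hc]
      · rw [hsk, ← hc]
      · exact hsk _ _
      · exact hsk _ _
    have hCt : Cᵀ = -C := by simp [C, Matrix.J_transpose]
    have hAC : A * C = 1 := by simp [A, C, Matrix.J_squared, hij]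
    have hCA : C * A = 1 := by simp [A, C, Matrix.J_squared, hij]
    have h1 := CongTo.schur A C (fromBlocks (-c⁻¹ • 1) 0 0 1) (fromBlocks (-c • 1) 0 0 1)
      (Matrix.J Unit k) B D hAC hCA hCt
      (by simp [fromBlocks_multiply, hij, fromBlocks_one])
      (by simp [fromBlocks_multiply, hij, fromBlocks_one])
      (by simp [A, Matrix.J, fromBlocks_multiply, fromBlocks_transpose, fromBlocks_smul, fromBlocks_neg, hij])
    rw [← e1] at h1
    have hD : Dᵀ = -D := by ext x y; exact hsk _ _
    obtain ⟨α, ρ, _, _, _, _, h2⟩ := ih _ hcard κ rfl (Bᵀ * C * B + D) (by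
      simp [hCt, hD, Matrix.mul_assoc]; abel)
    refine ⟨Unit ⊕ α, ρ, inferInstance, inferInstance, inferInstance, inferInstance, ?_⟩
    refine ((CongTo.reindex M e).trans h1).trans ((CongTo.block _ h2).trans ?_)
    let g : ((Unit ⊕ α) ⊕ (Unit ⊕ α)) ⊕ ρ ≃ (Unit ⊕ Unit) ⊕ ((α ⊕ α) ⊕ ρ) :=
      (Equiv.sumCongr (Equiv.sumSumSumComm Unit α Unit α) (Equiv.refl ρ)).trans
        (Equiv.sumAssoc _ _ _)
    convert CongTo.reindex _ g using 1
    ext (((x | x) | (x | x)) | x) (((y | y) | (y | y)) | y) <;> simp [g, Matrix.J, Matrix.one_apply]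

theorem offsetJ_rank (n off c : ℕ) (h : off + 2 * c ≤ n) : (offsetJ k n off c).rank = 2 * c := by
  let r : Fin c ⊕ Fin c → Fin n := Sum.elim (fun i => ⟨off + c + i, by omega⟩)
    (fun i => ⟨off + i, by omega⟩)
  apply le_antisymm
  · refine (rank_le_card_of_support_subset _ (Finset.univ.image r) ?_).trans
      (Finset.card_image_le.trans (by simp; omega))
    intro i hi
    obtain ⟨j, hj⟩ := Function.ne_iff.mp hi
    simp only [offsetJ, Matrix.row, Matrix.of_apply, Pi.zero_apply] at hj
    simp only [Finset.coe_image, Finset.coe_univ, Set.image_univ, Set.mem_range]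
    split_ifs at hj with h1 h2
    · exact ⟨.inr ⟨i - off, by omega⟩, by ext; simp [r]; omega⟩
    · exact ⟨.inl ⟨i - off - c, by omega⟩, by ext; simp [r]; omega⟩
    · exact absurd rfl hj
  · have h1 := rank_submatrix_le (offsetJ k n off c) r r
    have h2 : (offsetJ k n off c).submatrix r r = Matrix.J (Fin c) k := by
      ext (x | x) (y | y) <;> simp [offsetJ, r, Matrix.J, Matrix.one_apply, Fin.ext_iff] <;>
        grind
    rw [h2, rank_of_isUnit _ ((Matrix.isUnit_iff_isUnit_det _).mpr (isUnit_det_J _ _))] at h1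
    simp at h1
    omega

end aux

set_option maxHeartbeats 2000000 in
theorem exists_index_equiv (k : Type*) [Field k] {α β σ : Type} [Fintype α] [Fintype β] [Fintype σ]
    [DecidableEq α] [DecidableEq β] [DecidableEq σ] (n a b : ℕ)
    (ha : a = Fintype.card α) (hb : b = Fintype.card β)
    (hcard : Fintype.card ((α ⊕ α) ⊕ ((β ⊕ β) ⊕ σ)) = n)
    (hcard' : a + a + (b + b + Fintype.card σ) = n) :
    ∃ e : (α ⊕ α) ⊕ ((β ⊕ β) ⊕ σ) ≃ Fin n,
      (offsetJ k n 0 a).submatrix e e = fromBlocks (Matrix.J α k) 0 0 0 ∧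
      (offsetJ k n (2 * a) b).submatrix e e
        = fromBlocks 0 0 0 (fromBlocks (Matrix.J β k) 0 0 0) := by
  let ea : α ≃ Fin a := Fintype.equivFinOfCardEq ha.symm
  let eb : β ≃ Fin b := Fintype.equivFinOfCardEq hb.symm
  let es : σ ≃ Fin (Fintype.card σ) := Fintype.equivFin σ
  let f : (α ⊕ α) ⊕ ((β ⊕ β) ⊕ σ) → Fin n :=
    Sum.elim (Sum.elim (fun x => ⟨a + ea x, by omega⟩) (fun x => ⟨ea x, by omega⟩))
      (Sum.elim (Sum.elim (fun x => ⟨2 * a + b + eb x, by omega⟩)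
        (fun x => ⟨2 * a + eb x, by omega⟩)) (fun x => ⟨2 * a + 2 * b + es x, by omega⟩))
  have hf : Function.Bijective f := by
    rw [Fintype.bijective_iff_injective_and_card]
    refine ⟨?_, by rw [hcard]; simp⟩
    rintro ((x | x) | ((x | x) | x)) ((y | y) | ((y | y) | y)) h <;>
      simp [f] at h ⊢ <;>
      first
      | (exact ea.injective (Fin.ext (by omega)))
      | (exact eb.injective (Fin.ext (by omega)))
      | (exact es.injective (Fin.ext (by omega)))
      | omega
  let e := Equiv.ofBijective f hf
  have hea : ∀ x y : α, x = y ↔ (ea x).val = (ea y).val := fun x y => by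
    rw [← Fin.ext_iff, ea.injective.eq_iff]
  have heb : ∀ x y : β, x = y ↔ (eb x).val = (eb y).val := fun x y => by
    rw [← Fin.ext_iff, eb.injective.eq_iff]
  have oT : (offsetJ k n 0 a).submatrix e e = fromBlocks (Matrix.J α k) 0 0 0 := by
    ext ((x | x) | ((x | x) | x)) ((y | y) | ((y | y) | y)) <;>
      simp [e, f, offsetJ, Matrix.J, Matrix.one_apply, hea] <;>
      (try split_ifs) <;> first | rfl | (exfalso; omega) | omega | simp
  have oW : (offsetJ k n (2 * a) b).submatrix e e
      = fromBlocks 0 0 0 (fromBlocks (Matrix.J β k) 0 0 0) := by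
    ext ((x | x) | ((x | x) | x)) ((y | y) | ((y | y) | y)) <;>
      simp [e, f, offsetJ, Matrix.J, Matrix.one_apply, heb] <;>
      (try split_ifs) <;> first | rfl | (exfalso; omega) | omega | simp
  exact ⟨e, oT, oW⟩

/-- simultaneous normal form for a pair of skew-symmetric matrices with
vanishing product (used in the proof of Theorem 5.1 of the paper). -/
theorem statement2 (k : Type*) [Field k] (hchar : (2 : k) ≠ 0)
    (n : ℕ) (hn : 0 < n) (T W : Matrix (Fin n) (Fin n) k)
    (hT : Tᵀ = -T) (hW : Wᵀ = -W) (hTW : T * W = 0) :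
    ∃ a b : ℕ, T.rank = 2 * a ∧ W.rank = 2 * b ∧ 2 * a + 2 * b ≤ n ∧
      ∃ u : Matrix (Fin n) (Fin n) k, IsUnit u ∧
        u * T * uᵀ = offsetJ k n 0 a ∧
        (uᵀ)⁻¹ * W * u⁻¹ = offsetJ k n (2 * a) b := by
  obtain ⟨α, ρ, _, _, _, _, U, V, hUV, hVU, hU⟩ := skew_normal hchar n (Fin n) (by simp) T hT
  -- the transformed `W`
  have hVUt : Uᵀ * Vᵀ = 1 := by rw [← Matrix.transpose_mul, hVU, Matrix.transpose_one]
  have hprod : fromBlocks (Matrix.J α k) 0 0 (0 : Matrix ρ ρ k) * (Vᵀ * W * V) = 0 := by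
    calc _ = U * (T * ((Uᵀ * Vᵀ) * W)) * V := by rw [← hU]; simp only [Matrix.mul_assoc]
      _ = 0 := by rw [hVUt, Matrix.one_mul, hTW]; simp
  have hW's : (Vᵀ * W * V)ᵀ = -(Vᵀ * W * V) := by
    simp [Matrix.transpose_mul, hW, Matrix.mul_assoc]
  obtain ⟨X, Y, Z, D, hW'⟩ : ∃ X Y Z D, Vᵀ * W * V = fromBlocks X Y Z D :=
    ⟨_, _, _, _, (fromBlocks_toBlocks _).symm⟩
  rw [hW'] at hprod hW's
  rw [fromBlocks_multiply, ← fromBlocks_zero, fromBlocks_inj] at hprod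
  rw [fromBlocks_transpose, fromBlocks_neg, fromBlocks_inj] at hW's
  obtain ⟨p1, p2, -, -⟩ := hprod
  obtain ⟨-, q1, -, hD⟩ := hW's
  have hJ0 : ∀ {m : Type} (X : Matrix (α ⊕ α) m k), Matrix.J α k * X = 0 → X = 0 := by
    intro m X h
    have : Matrix.J α k * (Matrix.J α k * X) = -X := by
      rw [← Matrix.mul_assoc, Matrix.J_squared]; simp
    rw [h, Matrix.mul_zero] at this
    exact (neg_eq_zero.mp this.symm)
  have hX : X = 0 := hJ0 X (by simpa using p1)
  have hY : Y = 0 := hJ0 Y (by simpa using p2)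
  have hZ : Z = 0 := by
    rw [hY, neg_zero] at q1
    exact Matrix.transpose_eq_zero.mp q1
  subst hX hY hZ
  obtain ⟨β, σ, _, _, _, _, P, Q, hPQ, hQP, hP⟩ := skew_normal hchar _ ρ rfl D hD
  have hPQt : Qᵀ * Pᵀ = 1 := by rw [← Matrix.transpose_mul, hPQ, Matrix.transpose_one]
  have hQPt : Pᵀ * Qᵀ = 1 := by rw [← Matrix.transpose_mul, hQP, Matrix.transpose_one]
  -- combined change of basis
  obtain ⟨U', V', h1, h2, h3, h4⟩ : ∃ (U' : Matrix ((α ⊕ α) ⊕ ((β ⊕ β) ⊕ σ)) (Fin n) k)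
      (V' : Matrix (Fin n) ((α ⊕ α) ⊕ ((β ⊕ β) ⊕ σ)) k), U' * V' = 1 ∧ V' * U' = 1 ∧
      U' * T * U'ᵀ = fromBlocks (Matrix.J α k) 0 0 0 ∧
      V'ᵀ * W * V' = fromBlocks 0 0 0 (fromBlocks (Matrix.J β k) 0 0 0) := by
    let R : Matrix ((α ⊕ α) ⊕ ((β ⊕ β) ⊕ σ)) ((α ⊕ α) ⊕ ρ) k := fromBlocks 1 0 0 Qᵀ
    let S : Matrix ((α ⊕ α) ⊕ ρ) ((α ⊕ α) ⊕ ((β ⊕ β) ⊕ σ)) k := fromBlocks 1 0 0 Pᵀ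
    refine ⟨R * U, V * S, ?_, ?_, ?_, ?_⟩
    · calc _ = R * (U * V) * S := by
            simp only [Matrix.mul_assoc]
        _ = 1 := by
            rw [hUV]; simp [R, S, fromBlocks_multiply, hPQt, fromBlocks_one]
    · calc _ = V * (S * R) * U := by
            simp only [Matrix.mul_assoc]
        _ = 1 := by
            have : S * R = 1 := by simp [R, S, fromBlocks_multiply, hQPt, fromBlocks_one]
            rw [this]; simp [hQPt, fromBlocks_one, hVU]
    · calc _ = R * (U * T * Uᵀ) * (R)ᵀ := by
            simp only [Matrix.mul_assoc, Matrix.transpose_mul]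
        _ = _ := by
            rw [hU]; simp [R, S, fromBlocks_multiply, fromBlocks_transpose]
    · calc _ = (S)ᵀ * (Vᵀ * W * V) * (S) := by
            simp only [Matrix.mul_assoc, Matrix.transpose_mul]
        _ = _ := by
            rw [hW']; simp [R, S, fromBlocks_multiply, fromBlocks_transpose, hP]
  have hcard : Fintype.card ((α ⊕ α) ⊕ ((β ⊕ β) ⊕ σ)) = n := by
    have := Matrix.square_of_invertible U' V' h1 h2
    simpa using this
  set a := Fintype.card α with ha
  set b := Fintype.card β with hb
  have hcard' : a + a + (b + b + Fintype.card σ) = n := by simpa using hcard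
  obtain ⟨e, oT, oW⟩ := exists_index_equiv k n a b ha hb hcard hcard'
  let u : Matrix (Fin n) (Fin n) k := U'.submatrix e.symm id
  let v : Matrix (Fin n) (Fin n) k := V'.submatrix id e.symm
  have huv : u * v = 1 := by
    have : u * v = (U' * V').submatrix e.symm e.symm := rfl
    rw [this, h1]; simp
  have hvu : v * u = 1 := by
    simp only [u, v]
    rw [Matrix.submatrix_mul_equiv, h2]; simp
  have huT : u * T * uᵀ = offsetJ k n 0 a := by
    have : u * T * uᵀ = (U' * T * U'ᵀ).submatrix e.symm e.symm := rfl
    rw [this, h3, ← oT]; simp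
  have hvW : vᵀ * W * v = offsetJ k n (2 * a) b := by
    have : vᵀ * W * v = (V'ᵀ * W * V').submatrix e.symm e.symm := rfl
    rw [this, h4, ← oW]; simp
  have huu : IsUnit u := ⟨⟨u, v, huv, hvu⟩, rfl⟩
  have huvt : IsUnit v := ⟨⟨v, u, hvu, huv⟩, rfl⟩
  have hinv : u⁻¹ = v := Matrix.inv_eq_right_inv huv
  have hrank : ∀ (p M : Matrix (Fin n) (Fin n) k), IsUnit p → (p * M * pᵀ).rank = M.rank := by
    intro p M hp
    have hd := (Matrix.isUnit_iff_isUnit_det _).mp hp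
    rw [Matrix.rank_mul_eq_left_of_isUnit_det _ _ (by rwa [Matrix.det_transpose]),
      Matrix.rank_mul_eq_right_of_isUnit_det _ _ hd]
  refine ⟨a, b, ?_, ?_, by omega, u, huu, huT, ?_⟩
  · rw [← hrank u T huu, huT, offsetJ_rank _ _ _ (by omega)]
  · rw [← hrank vᵀ W (by rwa [Matrix.isUnit_transpose]), Matrix.transpose_transpose, hvW,
      offsetJ_rank _ _ _ (by omega)]
  · rw [← Matrix.transpose_nonsing_inv, hinv, hvW]

end
end

section
/- Let k be a field of characteristic ≠ 2 and n a positive integer. Consider the action of GL_n(k) on the set X = {(T, W) ∈ M_n(k) × M_n(k) : Tᵀ = −T, Wᵀ = −W, T·W = 0} given by u·(T, W) = (u·T·uᵀ, (uᵀ)⁻¹·W·u⁻¹). Then two pairs (T, W) and (T', W') in X lie in the same orbit if and only if rank T = rank T' and rank W = rank W'; in particular, the action of GL_n(k) on X has only finitely many orbits. -/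
/-!
STATEMENT 3: Let `k` be a field of characteristic `≠ 2` and `n` a positive integer.
Consider the action of `GLₙ(k)` on the set
`X = {(T, W) ∈ Mₙ(k) × Mₙ(k) : Tᵀ = −T, Wᵀ = −W, T·W = 0}` given by
`u·(T, W) = (u·T·uᵀ, (uᵀ)⁻¹·W·u⁻¹)`.  Then two pairs `(T, W)` and `(T', W')` in `X` lie
in the same orbit if and only if `rank T = rank T'` and `rank W = rank W'`; in
particular the action of `GLₙ(k)` on `X` has only finitely many orbits.
-/

open Matrix

noncomputable section

/-- Equivalence of pairs, over possibly different index types. -/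
def PEqv {k ι κ : Type*} [Field k] [Fintype ι] [Fintype κ] [DecidableEq ι] [DecidableEq κ]
    (T W : Matrix ι ι k) (T' W' : Matrix κ κ k) : Prop :=
  ∃ (u : Matrix κ ι k) (v : Matrix ι κ k), u * v = 1 ∧ v * u = 1 ∧
    T' = u * T * uᵀ ∧ W' = vᵀ * W * v

section
variable {k ι κ μ : Type*} [Field k] [Fintype ι] [Fintype κ] [Fintype μ]
  [DecidableEq ι] [DecidableEq κ] [DecidableEq μ]

theorem cancel_aux {u : Matrix κ ι k} {v : Matrix ι κ k} (h : v * u = 1) (T : Matrix ι ι k) :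
    v * (u * T * uᵀ) * vᵀ = T := by
  have h2 : uᵀ * vᵀ = 1 := by rw [← transpose_mul, h, transpose_one]
  calc v * (u * T * uᵀ) * vᵀ = (v * u) * T * (uᵀ * vᵀ) := by simp only [Matrix.mul_assoc]
    _ = T := by rw [h, h2, Matrix.one_mul, Matrix.mul_one]

theorem PEqv.symm {T W : Matrix ι ι k} {T' W' : Matrix κ κ k} (h : PEqv T W T' W') :
    PEqv T' W' T W := by
  obtain ⟨u, v, huv, hvu, rfl, rfl⟩ := h
  refine ⟨v, u, hvu, huv, (cancel_aux hvu T).symm, ?_⟩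
  have := cancel_aux (u := vᵀ) (v := uᵀ) (by rw [← transpose_mul, hvu, transpose_one]) W
  simpa using this.symm

theorem PEqv.swap {T W : Matrix ι ι k} {T' W' : Matrix κ κ k} (h : PEqv T W T' W') :
    PEqv W T W' T' := by
  obtain ⟨u, v, huv, hvu, rfl, rfl⟩ := h
  refine ⟨vᵀ, uᵀ, ?_, ?_, ?_, ?_⟩
  · rw [← transpose_mul, huv, transpose_one]
  · rw [← transpose_mul, hvu, transpose_one]
  · simp
  · simp

theorem PEqv.trans {T W : Matrix ι ι k} {T' W' : Matrix κ κ k} {T'' W'' : Matrix μ μ k}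
    (h : PEqv T W T' W') (h' : PEqv T' W' T'' W'') : PEqv T W T'' W'' := by
  obtain ⟨u, v, huv, hvu, rfl, rfl⟩ := h
  obtain ⟨u', v', huv', hvu', rfl, rfl⟩ := h'
  refine ⟨u' * u, v * v', ?_, ?_, ?_, ?_⟩
  · calc u' * u * (v * v') = u' * (u * v) * v' := by simp only [Matrix.mul_assoc]
      _ = 1 := by rw [huv, Matrix.mul_one, huv']
  · calc v * v' * (u' * u) = v * (v' * u') * u := by simp only [Matrix.mul_assoc]
      _ = 1 := by rw [hvu', Matrix.mul_one, hvu]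
  · simp only [Matrix.mul_assoc, transpose_mul]
  · simp only [Matrix.mul_assoc, transpose_mul]

theorem PEqv.rank_le {T W : Matrix ι ι k} {T' W' : Matrix κ κ k} (h : PEqv T W T' W') :
    T'.rank ≤ T.rank := by
  obtain ⟨u, v, huv, hvu, rfl, rfl⟩ := h
  exact (rank_mul_le_left _ _).trans (rank_mul_le_right _ _)

theorem PEqv.rank_eq {T W : Matrix ι ι k} {T' W' : Matrix κ κ k} (h : PEqv T W T' W') :
    T.rank = T'.rank := le_antisymm h.symm.rank_le h.rank_le

theorem PEqv.skew {T W : Matrix ι ι k} {T' W' : Matrix κ κ k} (h : PEqv T W T' W')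
    (hT : Tᵀ = -T) : T'ᵀ = -T' := by
  obtain ⟨u, v, huv, hvu, rfl, rfl⟩ := h
  simp [transpose_mul, hT, Matrix.mul_assoc]

theorem PEqv.mul_zero {T W : Matrix ι ι k} {T' W' : Matrix κ κ k} (h : PEqv T W T' W')
    (hT : T * W = 0) : T' * W' = 0 := by
  obtain ⟨u, v, huv, hvu, rfl, rfl⟩ := h
  have h2 : uᵀ * vᵀ = 1 := by rw [← transpose_mul, hvu, transpose_one]
  calc u * T * uᵀ * (vᵀ * W * v) = u * T * (uᵀ * vᵀ) * W * v := by simp only [Matrix.mul_assoc]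
    _ = u * (T * W) * v := by rw [h2, Matrix.mul_one, Matrix.mul_assoc u]
    _ = 0 := by rw [hT]; simp

theorem PEqv.reindex (σ : κ ≃ ι) (T W : Matrix ι ι k) :
    PEqv T W (T.submatrix σ σ) (W.submatrix σ σ) := by
  refine ⟨(1 : Matrix ι ι k).submatrix σ id, (1 : Matrix ι ι k).submatrix id σ, ?_, ?_, ?_, ?_⟩
  · ext i j; simp [mul_apply, one_apply]
  · rw [submatrix_mul_equiv]; simp
  · ext i j; simp [mul_apply, one_apply]
  · ext i j; simp [mul_apply, one_apply]

theorem rank_fromBlocks_diag (A : Matrix ι ι k) (D : Matrix κ κ k) :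
    (fromBlocks A 0 0 D).rank = A.rank + D.rank := by
  have h1 : (fromBlocks A 0 0 D).mulVecLin =
      (LinearEquiv.sumArrowLequivProdArrow ι κ k k).symm.toLinearMap ∘ₗ
        (A.mulVecLin.prodMap D.mulVecLin) ∘ₗ
        (LinearEquiv.sumArrowLequivProdArrow ι κ k k).toLinearMap := by
    apply LinearMap.ext
    intro x
    funext i
    rcases i with i | i <;> simp [mulVec, dotProduct]
  unfold Matrix.rank
  rw [h1, LinearMap.range_comp, LinearEquiv.finrank_map_eq, LinearMap.range_comp,
    LinearEquiv.range, Submodule.map_top, LinearMap.range_prodMap,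
    ← Module.finrank_prod]
  refine LinearEquiv.finrank_eq
    { toFun := fun x => (⟨x.1.1, x.2.1⟩, ⟨x.1.2, x.2.2⟩)
      invFun := fun y => ⟨(y.1.1, y.2.1), y.1.2, y.2.2⟩
      map_add' := fun _ _ => rfl
      map_smul' := fun _ _ => rfl
      left_inv := fun _ => rfl
      right_inv := fun _ => rfl }

theorem fromBlocks_PEqv {μ : Type*} [Fintype μ] [DecidableEq μ] (A A' : Matrix μ μ k)
    {T W : Matrix ι ι k} {T' W' : Matrix κ κ k} (h : PEqv T W T' W') :
    PEqv (fromBlocks A 0 0 T) (fromBlocks A' 0 0 W) (fromBlocks A 0 0 T') (fromBlocks A' 0 0 W') := by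
  obtain ⟨u, v, huv, hvu, rfl, rfl⟩ := h
  refine ⟨fromBlocks 1 0 0 u, fromBlocks 1 0 0 v, ?_, ?_, ?_, ?_⟩ <;>
    simp [fromBlocks_multiply, fromBlocks_transpose, huv, hvu]

theorem skew_apply {T : Matrix ι ι k} (h : Tᵀ = -T) (i j : ι) : T j i = - T i j := by
  have := congrFun (congrFun h i) j
  simpa using this

theorem skew_diag (hchar : (2 : k) ≠ 0) {T : Matrix ι ι k} (h : Tᵀ = -T) (i : ι) : T i i = 0 := by
  have h1 := skew_apply h i i
  have h2 : (2 : k) * T i i = 0 := by linear_combination h1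
  exact (mul_eq_zero.mp h2).resolve_left hchar

end

/-- The standard skew two by two matrix. -/
def Jmat (k : Type*) [Field k] : Matrix (Fin 2) (Fin 2) k := !![0, 1; -1, 0]

theorem exists_sum_equiv {m n : ℕ} (hn : n = m + 2) (i j : Fin n) (hij : i ≠ j) :
    ∃ σ : Fin 2 ⊕ Fin m ≃ Fin n, σ (Sum.inl 0) = i ∧ σ (Sum.inl 1) = j := by
  let e0 : Fin 2 ⊕ Fin m ≃ Fin n := Fintype.equivOfCardEq (by simp [hn]; omega)
  let e1 := e0.trans (Equiv.swap (e0 (Sum.inl 0)) i)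
  have h1 : e1 (Sum.inl 0) = i := by simp [e1]
  have h2 : e1 (Sum.inl 1) ≠ i := by
    rw [← h1]; intro h; simpa using e1.injective h
  refine ⟨e1.trans (Equiv.swap (e1 (Sum.inl 1)) j), ?_, ?_⟩
  · simp only [Equiv.trans_apply, h1]
    exact Equiv.swap_apply_of_ne_of_ne h2.symm hij
  · simp

theorem reduce_step {k : Type*} [Field k] (hchar : (2 : k) ≠ 0) {n : ℕ}
    {T W : Matrix (Fin n) (Fin n) k} (hT : Tᵀ = -T) (hW : Wᵀ = -W) (hTW : T * W = 0)
    (h0 : T ≠ 0) : ∃ m, n = m + 2 ∧ ∀ m, n = m + 2 → ∃ T1 W1 : Matrix (Fin m) (Fin m) k,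
      T1ᵀ = -T1 ∧ W1ᵀ = -W1 ∧ T1 * W1 = 0 ∧
      PEqv T W (fromBlocks (Jmat k) 0 0 T1) (fromBlocks 0 0 0 W1) := by
  obtain ⟨i, j, hij⟩ : ∃ i j, T i j ≠ 0 := by
    by_contra! h
    exact h0 (by ext i j; exact h i j)
  have hne : i ≠ j := by
    rintro rfl; exact hij (skew_diag hchar hT i)
  have hn2 : 2 ≤ n := by
    by_contra! h
    have := i.2; have := j.2
    exact hne (Fin.ext (by omega))
  refine ⟨n - 2, by omega, ?_⟩
  intro m hm
  obtain ⟨σ, hi, hj⟩ := exists_sum_equiv hm i j hne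
  have e1 := PEqv.reindex σ T W
  have hT1 := e1.skew hT
  obtain ⟨B, hB⟩ : ∃ B, B = (T.submatrix σ σ).toBlocks₁₂ := ⟨_, rfl⟩
  obtain ⟨D, hD⟩ : ∃ D, D = (T.submatrix σ σ).toBlocks₂₂ := ⟨_, rfl⟩
  have hTb : T.submatrix σ σ = fromBlocks (T i j • Jmat k) B (-Bᵀ) D := by
    have hA : (T.submatrix σ σ).toBlocks₁₁ = T i j • Jmat k := by
      ext a b
      fin_cases a <;> fin_cases b <;>
        simp [toBlocks₁₁, hi, hj, Jmat, skew_diag hchar hT, skew_apply hT i j]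
    have hC : (T.submatrix σ σ).toBlocks₂₁ = -Bᵀ := by
      ext a b
      simp [hB, toBlocks₂₁, toBlocks₁₂, skew_apply hT (σ (Sum.inl b)) (σ (Sum.inr a))]
    rw [← hA, ← hC, hB, hD, fromBlocks_toBlocks]
  have hDs : Dᵀ = -D := by
    ext a b
    simp [hD, toBlocks₂₂, skew_apply hT (σ (Sum.inr a)) (σ (Sum.inr b))]
  generalize T i j = a at *
  have hJJ : Jmat k * Jmat k = -1 := by
    ext a b; fin_cases a <;> fin_cases b <;> simp [Jmat]
  have hJt : (Jmat k)ᵀ = -Jmat k := by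
    ext a b; fin_cases a <;> fin_cases b <;> simp [Jmat]
  obtain ⟨W2, T1, e2⟩ : ∃ W2 T1, PEqv (T.submatrix σ σ) (W.submatrix σ σ)
      (fromBlocks (Jmat k) 0 0 T1) W2 := by
    let P : Matrix (Fin 2) (Fin 2) k := !![a⁻¹, 0; 0, 1]
    let Q : Matrix (Fin 2) (Fin 2) k := !![a, 0; 0, 1]
    have hPQ : P * Q = 1 := by
      ext x y; fin_cases x <;> fin_cases y <;> simp [P, Q, hij]
    have hQP : Q * P = 1 := by
      ext x y; fin_cases x <;> fin_cases y <;> simp [P, Q, hij]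
    have hPJ : P * (a • Jmat k) * Pᵀ = Jmat k := by
      ext x y; fin_cases x <;> fin_cases y <;> simp [P, Jmat, hij, mul_apply, Fin.sum_univ_two]
    let E : Matrix (Fin m) (Fin 2) k := -(a⁻¹ • (Bᵀ * Jmat k))
    have hEJ : E * (a • Jmat k) = Bᵀ := by
      simp [E, smul_smul, hij, Matrix.mul_assoc, hJJ]
    have hJE : (a • Jmat k) * Eᵀ = - B := by
      simp [E, smul_smul, hij, ← Matrix.mul_assoc, hJJ, hJt]
    refine ⟨_, D + E * B, fromBlocks P 0 E 1, fromBlocks Q 0 (-(E * Q)) 1, ?_, ?_, ?_, rfl⟩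
    · simp [fromBlocks_multiply, hPQ]
    · simp [fromBlocks_multiply, hQP, Matrix.mul_assoc]
    · rw [hTb]
      simp only [fromBlocks_multiply, fromBlocks_transpose]
      simp only [transpose_zero, transpose_one, Matrix.zero_mul, Matrix.mul_zero, Matrix.mul_one,
        Matrix.one_mul, add_zero, zero_add, hPJ, hEJ]
      rw [Matrix.mul_assoc P (a • Jmat k) Eᵀ, hJE]
      simp [add_comm]
  have e3 := e1.trans e2
  have hTs := e3.skew hT
  have hWs := e3.swap.skew hW
  have hz := e3.mul_zero hTW
  rw [← fromBlocks_toBlocks W2] at e3 hWs hz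
  generalize W2.toBlocks₁₁ = a1 at *
  generalize W2.toBlocks₁₂ = a2 at *
  generalize W2.toBlocks₂₁ = a3 at *
  generalize W2.toBlocks₂₂ = a4 at *
  rw [fromBlocks_multiply, ← fromBlocks_zero, fromBlocks_inj] at hz
  simp only [Matrix.zero_mul, add_zero, zero_add] at hz
  rw [fromBlocks_transpose, fromBlocks_neg, fromBlocks_inj] at hTs hWs
  obtain ⟨z1, z2, z3, z4⟩ := hz
  have key : ∀ {q : ℕ} (X : Matrix (Fin 2) (Fin q) k), Jmat k * X = 0 → X = 0 := by
    intro q X h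
    have : Jmat k * (Jmat k * X) = 0 := by rw [h]; simp
    rw [← Matrix.mul_assoc, hJJ] at this
    simpa using this
  have y1 := key _ z1
  have y2 := key _ z2
  subst y1 y2
  have y3 : a3 = 0 := by
    have := hWs.2.2.1
    simpa using this.symm
  subst y3
  exact ⟨T1, a4, hTs.2.2.2, hWs.2.2.2, z4, e3⟩

theorem PEqv_of_rank {k : Type*} [Field k] (hchar : (2 : k) ≠ 0) (n : ℕ) :
    ∀ T W T' W' : Matrix (Fin n) (Fin n) k,
      Tᵀ = -T → Wᵀ = -W → T * W = 0 → T'ᵀ = -T' → W'ᵀ = -W' → T' * W' = 0 →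
        T.rank = T'.rank → W.rank = W'.rank → PEqv T W T' W' := by
  induction n using Nat.strong_induction_on with
  | _ n ih =>
  have main : ∀ T W T' W' : Matrix (Fin n) (Fin n) k,
      Tᵀ = -T → Wᵀ = -W → T * W = 0 → T'ᵀ = -T' → W'ᵀ = -W' → T' * W' = 0 →
        T.rank = T'.rank → W.rank = W'.rank → T ≠ 0 → T' ≠ 0 → PEqv T W T' W' := by
    intro T W T' W' a1 a2 a3 b1 b2 b3 r1 r2 h h'
    obtain ⟨m, hm, H⟩ := reduce_step hchar a1 a2 a3 h
    obtain ⟨m', hm', H'⟩ := reduce_step hchar b1 b2 b3 h'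
    obtain ⟨T1, W1, c1, c2, c3, e⟩ := H m hm
    obtain ⟨T1', W1', c1', c2', c3', e'⟩ := H' m hm
    have q1 := e.rank_eq
    have q1' := e'.rank_eq
    have q2 := e.swap.rank_eq
    have q2' := e'.swap.rank_eq
    rw [rank_fromBlocks_diag] at q1 q1' q2 q2'
    have := ih m (by omega) T1 W1 T1' W1' c1 c2 c3 c1' c2' c3' (by omega) (by omega)
    exact (e.trans (fromBlocks_PEqv _ _ this)).trans e'.symm
  have hz : ∀ T T' : Matrix (Fin n) (Fin n) k, T.rank = T'.rank → T = 0 → T' = 0 := by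
    intro T T' h h0
    rw [h0, rank_zero] at h
    have h3 := h.symm
    rw [Matrix.rank, Submodule.finrank_eq_zero, LinearMap.range_eq_bot] at h3
    ext i j
    have h4 := congrFun (LinearMap.congr_fun h3 (Pi.single j 1)) i
    simpa using h4
  intro T W T' W' a1 a2 a3 b1 b2 b3 r1 r2
  by_cases h : T = 0
  · by_cases hw : W = 0
    · have h' := hz _ _ r1 h
      have hw' := hz _ _ r2 hw
      subst h hw h' hw'
      exact ⟨1, 1, by simp, by simp, by simp, by simp⟩
    · refine (main W T W' T' a2 a1 ?_ b2 b1 ?_ r2 r1 hw (fun h' => hw (hz _ _ r2.symm h'))).swap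
      · simpa [a1, a2] using congrArg transpose a3
      · simpa [b1, b2] using congrArg transpose b3
  · exact main T W T' W' a1 a2 a3 b1 b2 b3 r1 r2 h (fun h' => h (hz _ _ r1.symm h'))

theorem PEqv_iff {k : Type*} [Field k] {n : ℕ} (T W T' W' : Matrix (Fin n) (Fin n) k) :
    PEqv T W T' W' ↔ ∃ u : Matrix (Fin n) (Fin n) k, IsUnit u ∧
            T' = u * T * uᵀ ∧ W' = (uᵀ)⁻¹ * W * u⁻¹ := by
  constructor
  · rintro ⟨u, v, huv, hvu, h1, h2⟩
    refine ⟨u, ⟨⟨u, v, huv, hvu⟩, rfl⟩, h1, ?_⟩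
    rw [← transpose_nonsing_inv, inv_eq_right_inv huv]; exact h2
  · rintro ⟨u, hu, h1, h2⟩
    have hd := (isUnit_iff_isUnit_det u).mp hu
    refine ⟨u, u⁻¹, mul_nonsing_inv u hd, nonsing_inv_mul u hd, h1, ?_⟩
    rw [transpose_nonsing_inv]; exact h2

/-- orbits of the `GLₙ(k)`-action on pairs of skew-symmetric matrices
with vanishing product are classified by the pair of ranks, and there are only finitely
many orbits (used in the proof of Theorem 5.1 of the paper). -/
theorem statement3 (k : Type*) [Field k] (hchar : (2 : k) ≠ 0) (n : ℕ) (hn : 0 < n) :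
    (∀ T W T' W' : Matrix (Fin n) (Fin n) k,
      Tᵀ = -T → Wᵀ = -W → T * W = 0 → T'ᵀ = -T' → W'ᵀ = -W' → T' * W' = 0 →
        ((∃ u : Matrix (Fin n) (Fin n) k, IsUnit u ∧
            T' = u * T * uᵀ ∧ W' = (uᵀ)⁻¹ * W * u⁻¹) ↔
          (T.rank = T'.rank ∧ W.rank = W'.rank))) ∧
    ∃ S : Finset (Matrix (Fin n) (Fin n) k × Matrix (Fin n) (Fin n) k),
      ∀ T W : Matrix (Fin n) (Fin n) k, Tᵀ = -T → Wᵀ = -W → T * W = 0 →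
        ∃ p ∈ S, p.1ᵀ = -p.1 ∧ p.2ᵀ = -p.2 ∧ p.1 * p.2 = 0 ∧
          ∃ u : Matrix (Fin n) (Fin n) k, IsUnit u ∧
            T = u * p.1 * uᵀ ∧ W = (uᵀ)⁻¹ * p.2 * u⁻¹ := by
  classical
  have iff1 : ∀ T W T' W' : Matrix (Fin n) (Fin n) k,
      Tᵀ = -T → Wᵀ = -W → T * W = 0 → T'ᵀ = -T' → W'ᵀ = -W' → T' * W' = 0 →
        ((∃ u : Matrix (Fin n) (Fin n) k, IsUnit u ∧
            T' = u * T * uᵀ ∧ W' = (uᵀ)⁻¹ * W * u⁻¹) ↔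
          (T.rank = T'.rank ∧ W.rank = W'.rank)) := by
    intro T W T' W' a1 a2 a3 b1 b2 b3
    rw [← PEqv_iff]
    exact ⟨fun h => ⟨h.rank_eq, h.swap.rank_eq⟩,
      fun h => PEqv_of_rank hchar n T W T' W' a1 a2 a3 b1 b2 b3 h.1 h.2⟩
  refine ⟨iff1, ?_⟩
  let Q : ℕ × ℕ → Matrix (Fin n) (Fin n) k × Matrix (Fin n) (Fin n) k → Prop := fun r p =>
    p.1ᵀ = -p.1 ∧ p.2ᵀ = -p.2 ∧ p.1 * p.2 = 0 ∧ p.1.rank = r.1 ∧ p.2.rank = r.2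
  let f : ℕ × ℕ → Matrix (Fin n) (Fin n) k × Matrix (Fin n) (Fin n) k := fun r =>
    if h : ∃ p, Q r p then h.choose else 0
  refine ⟨(Finset.range (n + 1) ×ˢ Finset.range (n + 1)).image f, ?_⟩
  intro T W a1 a2 a3
  have hex : ∃ p, Q (T.rank, W.rank) p := ⟨(T, W), a1, a2, a3, rfl, rfl⟩
  have hf : Q (T.rank, W.rank) (f (T.rank, W.rank)) := by
    have : f (T.rank, W.rank) = hex.choose := dif_pos hex
    rw [this]; exact hex.choose_spec
  obtain ⟨b1, b2, b3, r1, r2⟩ := hf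
  refine ⟨f (T.rank, W.rank), ?_, b1, b2, b3, (iff1 _ _ _ _ b1 b2 b3 a1 a2 a3).mpr ⟨r1, r2⟩⟩
  refine Finset.mem_image_of_mem f ?_
  have h1 := T.rank_le_width
  have h2 := W.rank_le_width
  simp only [Finset.mem_product, Finset.mem_range]
  omega

end
end
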